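/- arXiv:1802.02470 — 2 statements merged into one kernel-verified Lean document; each statement's English description precedes it below -/
import Mathlib

section
/- In the setup below, let ā = (a_s)_{s ∈ S} be the random vector whose components are jointly independent, with each a_s uniformly distributed on (ℤ/sℤ) \ {h'_1 mod s, …, h'_k mod s}, and let σ = ∏_{s ∈ S}(1 − 1/s). Then there is a constant K such that for every ε > 0, for all sufficiently large x, with probability at least 1 − ε one has |#(Q ∩ S(ā)) − σy/log x| ≤ K·(σy/log x)/(log₂ x)^{10}. -/
open scoped Classical ENNReal

/-- iterated logarithm: `log₂ x = log log x`. -/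
noncomputable def log2 (x : ℝ) : ℝ := Real.log (Real.log x)
/-- iterated logarithm: `log₃ x = log log log x`. -/
noncomputable def log3 (x : ℝ) : ℝ := Real.log (log2 x)
/-- the smoothness parameter `α = x^{log₃ x/(4 log₂ x)}`. -/
noncomputable def alpha (x : ℝ) : ℝ := x ^ (log3 x / (4 * log2 x))
/-- `y = c₀ x (log x · log₃ x)/log₂ x`. -/
noncomputable def yOf (c₀ x : ℝ) : ℝ := c₀ * x * (Real.log x * log3 x) / log2 x

/-- `S = {s prime : (log x)^20 < s ≤ α, s ∉ Z}`. -/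
noncomputable def Sset (x : ℝ) (Z : Finset ℕ) : Finset ℕ :=
  (Finset.range (⌊alpha x⌋₊ + 1)).filter fun s =>
    s.Prime ∧ (Real.log x) ^ (20 : ℕ) < (s : ℝ) ∧ (s : ℝ) ≤ alpha x ∧ s ∉ Z

/-- `Q = {q prime : x < q ≤ y}`. -/
noncomputable def Qset (c₀ x : ℝ) : Finset ℕ :=
  (Finset.range (⌊yOf c₀ x⌋₊ + 1)).filter fun q =>
    q.Prime ∧ x < (q : ℝ) ∧ (q : ℝ) ≤ yOf c₀ x

/-- A tuple `h : Fin k → ℕ` is admissible if for every prime `p` there is a residue class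
mod `p` avoided by all the `h i`. -/
def AdmissibleTuple {k : ℕ} (h : Fin k → ℕ) : Prop :=
  ∀ p : ℕ, p.Prime → ∃ a : ZMod p, ∀ i, (h i : ZMod p) ≠ a

/-- The random vector `ā = (a_s)_{s ∈ S}` has jointly independent components, with `a_s`
uniform on `(ℤ/sℤ) \ {h'_1, …, h'_k mod s}`. -/
def UniformAvoiding {Ω : Type} [MeasurableSpace Ω] (μ : MeasureTheory.Measure Ω)
    (S : Finset ℕ) {k : ℕ} (h : Fin k → ℕ) (A : Ω → (s : ℕ) → ZMod s) : Prop :=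
  ∀ f : (s : ℕ) → ZMod s,
    μ {ω | ∀ s ∈ S, A ω s = f s} =
      ∏ s ∈ S,
        if ∀ i, f s ≠ (h i : ZMod s)
        then (((s - (Finset.univ.image fun i : Fin k => (h i : ZMod s)).card : ℕ)) : ℝ≥0∞)⁻¹
        else 0

open Complex MeasureTheory Filter Topology Asymptotics in
/-- `riemannZeta₀ s = 1 - s ∫_1^∞ {t} t^(-s-1) dt`, written as a Mellin transform. -/
theorem riemannZeta₀_eq_mellin :
    ∀ s : ℂ, 0 < s.re → riemannZeta₀ s =
      1 + s * mellin (Set.indicator (Set.Ioi (1 : ℝ)) fun t : ℝ ↦ ((⌊t⌋₊ : ℂ) - t)) (-s) := by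
  set f : ℝ → ℂ := Set.indicator (Set.Ioi (1 : ℝ)) fun t : ℝ ↦ ((⌊t⌋₊ : ℂ) - t) with hf
  have hmeas : Measurable f := by
    apply Measurable.indicator _ measurableSet_Ioi
    exact (measurable_from_nat.comp Nat.measurable_floor).sub measurable_ofReal
  have hbound : ∀ t, ‖f t‖ ≤ 1 := by
    intro t
    rw [hf, Set.indicator_apply]
    split_ifs with h
    · have h1 := Nat.floor_le (zero_le_one.trans (le_of_lt (show (1 : ℝ) < t from h)))
      have h2 := Nat.lt_floor_add_one t
      rw [← ofReal_natCast, ← ofReal_sub, norm_real, Real.norm_eq_abs, abs_le]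
      constructor <;> linarith
    · simp
  have hloc : LocallyIntegrableOn f (Set.Ioi 0) := by
    apply LocallyIntegrable.locallyIntegrableOn
    refine (locallyIntegrable_const (1 : ℝ)).mono hmeas.aestronglyMeasurable ?_
    exact Eventually.of_forall fun t ↦ by simpa using hbound t
  have hdiff : ∀ s : ℂ, 0 < s.re → DifferentiableAt ℂ (fun s ↦ mellin f (-s)) s := by
    intro s hs
    have : DifferentiableAt ℂ (mellin f) (-s) := by
      refine mellin_differentiableAt_of_isBigO_rpow (a := 0) (b := (-s).re - 1) hloc ?_ ?_ ?_ ?_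
      · simp only [neg_zero, Real.rpow_zero]
        exact IsBigO.of_bound 1 (Eventually.of_forall fun t ↦ by simpa using hbound t)
      · simpa using hs
      · refine IsBigO.of_bound 1 ?_
        have : Set.Ioo (0 : ℝ) 1 ∈ 𝓝[>] (0 : ℝ) := Ioo_mem_nhdsGT one_pos
        filter_upwards [this] with t ht
        have : f t = 0 := by simp [hf, not_lt.mpr ht.2.le]
        rw [this]; simp
      · linarith
    exact this.fun_comp' s differentiableAt_id.neg
  have key : ∀ s : ℂ, 1 < s.re → riemannZeta₀ s = 1 + s * mellin f (-s) := by
    intro s hs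
    have hs0 : s ≠ 0 := fun h ↦ by simp [h] at hs; linarith
    have hs1 : s ≠ 1 := fun h ↦ by simp [h] at hs
    have h1 := LSeries_eq_mul_integral (1 : ℕ → ℂ) (r := 1) zero_le_one hs
      (LSeriesSummable_one_iff.mpr hs) (by
        refine IsBigO.of_bound 1 (Eventually.of_forall fun n ↦ ?_)
        simp)
    rw [LSeries_one_eq_riemannZeta hs] at h1
    have hI2 : ∫ t in Set.Ioi (1 : ℝ), (t : ℂ) ^ (-s) = 1 / (s - 1) := by
      rw [integral_Ioi_cpow_of_lt (by simpa using hs) one_pos]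
      have : s - 1 ≠ 0 := sub_ne_zero.mpr hs1
      have h2 : -s + 1 ≠ 0 := by contrapose! hs1; linear_combination -hs1
      simp
      field_simp
      ring
    have hint2 : IntegrableOn (fun t : ℝ ↦ (t : ℂ) ^ (-s)) (Set.Ioi 1) :=
      integrableOn_Ioi_cpow_of_lt (by simpa using hs) one_pos
    have hm : mellin f (-s) = ∫ t in Set.Ioi (1 : ℝ), (t : ℂ) ^ (-s - 1) * ((⌊t⌋₊ : ℂ) - t) := by
      rw [mellin, ← integral_indicator measurableSet_Ioi, ← integral_indicator measurableSet_Ioi]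
      congr 1
      ext t
      simp only [hf, Set.indicator_apply, Set.mem_Ioi, smul_eq_mul]
      by_cases h : 1 < t
      · simp [h, zero_lt_one.trans h]
      · simp [h]
    have hint1 : IntegrableOn (fun t : ℝ ↦ (t : ℂ) ^ (-s - 1) * ((⌊t⌋₊ : ℂ) - t)) (Set.Ioi 1) := by
      refine Integrable.mono' (g := fun t : ℝ ↦ t ^ (-s.re - 1))
        (integrableOn_Ioi_rpow_of_lt (by linarith) one_pos) ?_ ?_
      · refine Measurable.aestronglyMeasurable ?_
        refine Measurable.mul ?_ ?_
        · exact measurable_ofReal.pow_const _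
        · exact (measurable_from_nat.comp Nat.measurable_floor).sub measurable_ofReal
      · filter_upwards [ae_restrict_mem measurableSet_Ioi] with t ht
        have ht' : (1 : ℝ) < t := ht
        rw [norm_mul, norm_cpow_eq_rpow_re_of_pos (zero_lt_one.trans ht')]
        have := hbound t
        rw [hf, Set.indicator_of_mem ht] at this
        calc _ ≤ t ^ (-s - 1).re * 1 := by gcongr
          _ = _ := by simp
    have hsplit : ∫ t in Set.Ioi (1 : ℝ), (∑ k ∈ Finset.Icc 1 ⌊t⌋₊, (1 : ℕ → ℂ) k) * (t : ℂ) ^ (-(s + 1))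
        = (∫ t in Set.Ioi (1 : ℝ), (t : ℂ) ^ (-s - 1) * ((⌊t⌋₊ : ℂ) - t))
          + ∫ t in Set.Ioi (1 : ℝ), (t : ℂ) ^ (-s) := by
      rw [← integral_add hint1 hint2]
      refine setIntegral_congr_fun measurableSet_Ioi fun t ht ↦ ?_
      have ht' : (t : ℂ) ≠ 0 := by
        exact_mod_cast (zero_lt_one.trans (show (1 : ℝ) < t from ht)).ne'
      simp only [Pi.one_apply, Finset.sum_const, Nat.card_Icc, nsmul_eq_mul, mul_one]
      have e1 : -(s + 1) = -s - 1 := by ring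
      have e2 : (t : ℂ) ^ (-s) = (t : ℂ) ^ (-s - 1) * t := by
        rw [cpow_sub _ _ ht', cpow_one]; field_simp
      rw [e1, e2]
      push_cast [Nat.add_sub_cancel]
      ring
    rw [hsplit, ← hm, hI2] at h1
    have hs1' : s - 1 ≠ 0 := sub_ne_zero.mpr hs1
    have h0 : riemannZeta₀ s = riemannZeta s - (s - 1)⁻¹ := by simp [riemannZeta₀, hs1]
    rw [h0, h1]
    field_simp
    ring
  intro s hs
  have hopen : IsOpen {s : ℂ | 0 < s.re} := isOpen_lt continuous_const continuous_re
  have hA : AnalyticOnNhd ℂ riemannZeta₀ {s : ℂ | 0 < s.re} :=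
    differentiable_riemannZeta₀.differentiableOn.analyticOnNhd hopen
  have hB : AnalyticOnNhd ℂ (fun s ↦ 1 + s * mellin f (-s)) {s : ℂ | 0 < s.re} := by
    refine DifferentiableOn.analyticOnNhd ?_ hopen
    intro z hz
    exact ((differentiableAt_const _).add
      (differentiableAt_id.mul (hdiff z hz))).differentiableWithinAt
  have hpre : IsPreconnected {s : ℂ | 0 < s.re} :=
    (convex_halfSpace_re_gt 0).isPreconnected
  refine hA.eqOn_of_preconnected_of_eventuallyEq hB hpre (z₀ := 2) (by simp) ?_ hs
  have : {s : ℂ | 1 < s.re} ∈ 𝓝 (2 : ℂ) :=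
    (isOpen_lt continuous_const continuous_re).mem_nhds (by simp)
  filter_upwards [this] with z hz using key z hz

open Complex MeasureTheory in
theorem norm_riemannZeta₀_le {s : ℂ} (hs : 1 / 2 ≤ s.re) : ‖riemannZeta₀ s‖ ≤ 1 + 2 * ‖s‖ := by
  rw [riemannZeta₀_eq_mellin s (by linarith)]
  have hm : mellin (Set.indicator (Set.Ioi (1 : ℝ)) fun t : ℝ ↦ ((⌊t⌋₊ : ℂ) - t)) (-s)
      = ∫ t in Set.Ioi (1 : ℝ), (t : ℂ) ^ (-s - 1) * ((⌊t⌋₊ : ℂ) - t) := by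
    rw [mellin, ← integral_indicator measurableSet_Ioi, ← integral_indicator measurableSet_Ioi]
    congr 1
    ext t
    simp only [Set.indicator_apply, Set.mem_Ioi, smul_eq_mul]
    by_cases h : 1 < t
    · simp [h, zero_lt_one.trans h]
    · simp [h]
  have hle : ‖∫ t in Set.Ioi (1 : ℝ), (t : ℂ) ^ (-s - 1) * ((⌊t⌋₊ : ℂ) - t)‖ ≤
      ∫ t in Set.Ioi (1 : ℝ), t ^ (-s.re - 1) := by
    refine norm_integral_le_of_norm_le (integrableOn_Ioi_rpow_of_lt (by linarith) one_pos) ?_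
    filter_upwards [ae_restrict_mem measurableSet_Ioi] with t ht
    have ht' : (1 : ℝ) < t := ht
    rw [norm_mul, norm_cpow_eq_rpow_re_of_pos (zero_lt_one.trans ht')]
    have : ‖(⌊t⌋₊ : ℂ) - t‖ ≤ 1 := by
      have h1 := Nat.floor_le (zero_le_one.trans ht'.le)
      have h2 := Nat.lt_floor_add_one t
      rw [← ofReal_natCast, ← ofReal_sub, norm_real, Real.norm_eq_abs, abs_le]
      constructor <;> linarith
    calc _ ≤ t ^ (-s - 1).re * 1 := by gcongr
      _ = _ := by simp
  rw [integral_Ioi_rpow_of_lt (by linarith) one_pos] at hle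
  have h2 : -1 ^ (-s.re - 1 + 1) / (-s.re - 1 + 1) ≤ (2 : ℝ) := by
    rw [Real.one_rpow]
    have : (-1 : ℝ) / (-s.re - 1 + 1) = 1 / s.re := by
      rw [show -s.re - 1 + 1 = -s.re by ring, neg_div_neg_eq]
    rw [this, div_le_iff₀ (by linarith)]; linarith
  rw [hm]
  calc _ ≤ ‖(1 : ℂ)‖ + ‖s‖ * ‖∫ t in Set.Ioi (1 : ℝ), (t : ℂ) ^ (-s - 1) * ((⌊t⌋₊ : ℂ) - t)‖ := by
        rw [← norm_mul]; exact norm_add_le _ _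
    _ ≤ 1 + ‖s‖ * 2 := by rw [norm_one]; gcongr; exact hle.trans h2
    _ = _ := by ring

open Complex in
theorem norm_deriv_le_of_halfPlane {f : ℂ → ℂ} (hf : Differentiable ℂ f) {a A B r : ℝ}
    (hr : 0 < r) (hB : 0 ≤ B) (h : ∀ s : ℂ, a ≤ s.re → ‖f s‖ ≤ A + B * ‖s‖) {s : ℂ}
    (hs : a + r ≤ s.re) : ‖deriv f s‖ ≤ (A + B * r + B * ‖s‖) / r := by
  refine norm_deriv_le_of_forall_mem_sphere_norm_le hr hf.diffContOnCl fun z hz ↦ ?_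
  have hz' : ‖z - s‖ = r := by simpa [dist_eq_norm] using hz
  have h1 : |(z - s).re| ≤ r := (abs_re_le_norm _).trans hz'.le
  have h2 : a ≤ z.re := by rw [sub_re] at h1; linarith [abs_le.mp h1]
  have h3 : ‖z‖ ≤ r + ‖s‖ := by
    calc ‖z‖ = ‖(z - s) + s‖ := by ring_nf
      _ ≤ _ := by rw [← hz']; exact norm_add_le _ _
  calc ‖f z‖ ≤ A + B * ‖z‖ := h z h2
    _ ≤ A + B * (r + ‖s‖) := by gcongr
    _ = _ := by ring

theorem norm_deriv_riemannZeta₀_le {s : ℂ} (hs : 3 / 4 ≤ s.re) :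
    ‖deriv riemannZeta₀ s‖ ≤ 6 + 8 * ‖s‖ := by
  refine (norm_deriv_le_of_halfPlane differentiable_riemannZeta₀ (a := 1 / 2) (A := 1) (B := 2)
    (r := 1 / 4) (by norm_num) (by norm_num) (fun z hz ↦ norm_riemannZeta₀_le hz)
    (by linarith)).trans (le_of_eq ?_)
  ring

theorem norm_deriv_deriv_riemannZeta₀_le {s : ℂ} (hs : 1 ≤ s.re) :
    ‖deriv (deriv riemannZeta₀) s‖ ≤ 32 + 32 * ‖s‖ := by
  refine (norm_deriv_le_of_halfPlane differentiable_riemannZeta₀.deriv (a := 3 / 4) (A := 6)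
    (B := 8) (r := 1 / 4) (by norm_num) (by norm_num)
    (fun z hz ↦ norm_deriv_riemannZeta₀_le hz) (by linarith)).trans (le_of_eq ?_)
  ring

open Complex in
theorem norm_riemannZeta_product_ge_one {x : ℝ} (hx : 0 < x) (y : ℝ) :
    1 ≤ ‖riemannZeta (1 + x)‖ ^ 3 * ‖riemannZeta (1 + x + I * y)‖ ^ 4 *
      ‖riemannZeta (1 + x + 2 * I * y)‖ := by
  have := DirichletCharacter.norm_LFunction_product_ge_one (1 : DirichletCharacter ℂ 1) hx y
  simpa [DirichletCharacter.LFunctionTrivChar, DirichletCharacter.LFunction_modOne_eq] using this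

theorem riemannZeta₁_ne_zero {s : ℂ} (hs : 1 ≤ s.re) : riemannZeta₁ s ≠ 0 := by
  by_cases h : s = 1
  · simp [h]
  · intro h0
    apply riemannZeta_ne_zero_of_one_le_re hs
    rw [riemannZeta_eq_inv_sub_mul h, h0, mul_zero]

open Complex in
theorem norm_riemannZeta_le {s : ℂ} (hs : 1 / 2 ≤ s.re) {d : ℝ} (hd : 0 < d) (h1 : d ≤ ‖s - 1‖) :
    ‖riemannZeta s‖ ≤ 1 / d + (1 + 2 * ‖s‖) := by
  have hs1 : s ≠ 1 := by rintro rfl; simp at h1; linarith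
  rw [riemannZeta_eq_inv_sub_add hs1]
  refine (norm_add_le _ _).trans ?_
  gcongr
  · rw [norm_inv, ← one_div]; gcongr
  · exact norm_riemannZeta₀_le hs

open Complex in
theorem norm_deriv_riemannZeta_le {s : ℂ} (hs : 3 / 4 ≤ s.re) (h1 : 1 ≤ ‖s - 1‖) :
    ‖deriv riemannZeta s‖ ≤ 7 + 8 * ‖s‖ := by
  have hs1 : s ≠ 1 := by rintro rfl; simp at h1; linarith
  rw [deriv_riemannZeta_eq_neg_inv_sub_sq_add hs1]
  refine (norm_add_le _ _).trans ?_
  have h2 : ‖-(s - 1)⁻¹ ^ 2‖ ≤ 1 := by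
    rw [norm_neg, norm_pow, norm_inv]
    exact pow_le_one₀ (by positivity) (inv_le_one_of_one_le₀ h1)
  linarith [norm_deriv_riemannZeta₀_le hs]

open Complex in
/-- Polynomial lower bound for zeta to the right of the line `Re s = 1`. -/
theorem norm_riemannZeta_ge {σ t : ℝ} (h1 : 1 < σ) (h2 : σ ≤ 2) (ht : 1 ≤ |t|) :
    15 / 10 ^ 9 / (4 + |t|) ^ 4 ≤ ‖riemannZeta (σ + t * I)‖ := by
  set N : ℝ := 4 + |t| with hN
  have hN0 : 0 < N := by positivity
  set η : ℝ := 1 / 10 ^ 9 / N ^ 5 with hη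
  have hη0 : 0 < η := by positivity
  have hη1 : η ≤ 1 := by
    rw [hη, div_div, div_le_one (by positivity)]
    have : 1 ≤ N ^ 5 := one_le_pow₀ (by linarith)
    nlinarith
  have hnorm : ∀ σ' t' : ℝ, 0 ≤ σ' → ‖(σ' + t' * I : ℂ)‖ ≤ σ' + |t'| := by
    intro σ' t' h
    refine (norm_add_le _ _).trans ?_
    simp [abs_of_nonneg h]
  have him : ∀ σ' t' : ℝ, |t'| ≤ ‖(σ' + t' * I : ℂ) - 1‖ := by
    intro σ' t'
    refine le_trans ?_ (abs_im_le_norm _)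
    simp
  have big : ∀ σ' : ℝ, 1 + η ≤ σ' → σ' ≤ 2 →
      2 * (15 / 10 ^ 9 / N ^ 4) ≤ ‖riemannZeta (σ' + t * I)‖ := by
    intro σ' ha hb
    have h := norm_riemannZeta_product_ge_one (x := σ' - 1) (by linarith) t
    have e1 : (1 + ((σ' - 1 : ℝ) : ℂ)) = σ' + (0 : ℝ) * I := by push_cast; ring
    have e2 : (1 + ((σ' - 1 : ℝ) : ℂ) + I * t) = σ' + t * I := by push_cast; ring
    have e3 : (1 + ((σ' - 1 : ℝ) : ℂ) + 2 * I * t) = σ' + (2 * t : ℝ) * I := by push_cast; ring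
    rw [e3, e2, e1] at h
    have b1 : ‖riemannZeta (σ' + (0 : ℝ) * I)‖ ≤ 6 / η := by
      have := norm_riemannZeta_le (s := σ' + (0 : ℝ) * I) (by simp; linarith) hη0 (by
        have : (σ' + (0 : ℝ) * I - 1 : ℂ) = ((σ' - 1 : ℝ) : ℂ) := by push_cast; ring
        rw [this, norm_real, Real.norm_eq_abs, abs_of_nonneg] <;> linarith)
      have h3 := hnorm σ' 0 (by linarith)
      have h4 : 1 ≤ 1 / η := by rw [le_div_iff₀ hη0]; linarith
      rw [abs_zero] at h3
      calc _ ≤ _ := this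
        _ ≤ 1 / η + 5 * (1 / η) := by linarith
        _ = _ := by ring
    have b2 : ‖riemannZeta (σ' + (2 * t : ℝ) * I)‖ ≤ 4 * N := by
      have := norm_riemannZeta_le (s := σ' + (2 * t : ℝ) * I) (by simp; linarith) one_pos (by
        refine le_trans ?_ (him _ _)
        rw [abs_mul, abs_two]; linarith)
      have h3 := hnorm σ' (2 * t) (by linarith)
      rw [abs_mul, abs_two] at h3
      linarith
    set a := ‖riemannZeta (σ' + t * I)‖ with ha'
    have ha0 : 0 ≤ a := norm_nonneg _
    have h5 : 1 ≤ (6 / η) ^ 3 * a ^ 4 * (4 * N) := by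
      refine h.trans ?_
      gcongr
    have h6 : (2 * (15 / 10 ^ 9 / N ^ 4)) ^ 4 ≤ a ^ 4 := by
      have h7 : (6 / η) ^ 3 * a ^ 4 * (4 * N) = 864 * 10 ^ 27 * N ^ 16 * a ^ 4 := by
        rw [hη]; field_simp; norm_num; ring
      rw [h7] at h5
      have h8 : (2 * (15 / 10 ^ 9 / N ^ 4)) ^ 4 = 810000 / 10 ^ 36 / N ^ 16 := by
        field_simp; norm_num
      rw [h8, div_le_iff₀ (by positivity)]
      nlinarith
    exact le_of_pow_le_pow_left₀ (by norm_num) ha0 h6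
  have hd0 : 0 ≤ 15 / 10 ^ 9 / N ^ 4 := by positivity
  by_cases hcase : 1 + η ≤ σ
  · linarith [big σ hcase h2]
  · push Not at hcase
    have hb := big (1 + η) le_rfl (by linarith)
    set S : Set ℂ := {z | 1 ≤ z.re} ∩ {z | z.re ≤ 2} ∩ ({z | t ≤ z.im} ∩ {z | z.im ≤ t}) with hS
    have hconv : Convex ℝ S :=
      ((convex_halfSpace_re_ge 1).inter (convex_halfSpace_re_le 2)).inter
        ((convex_halfSpace_im_ge t).inter (convex_halfSpace_im_le t))
    have hmem : ∀ z ∈ S, 1 ≤ ‖z - 1‖ ∧ ‖z‖ ≤ N - 2 := by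
      intro z hz
      obtain ⟨⟨hz1, hz2⟩, hz3, hz4⟩ := hz
      have hzim : z.im = t := le_antisymm hz4 hz3
      have hz : z = (z.re : ℂ) + t * I := by rw [← hzim]; exact (re_add_im z).symm
      constructor
      · rw [hz]; exact ht.trans (him _ _)
      · rw [hz]
        have := hnorm z.re t (zero_le_one.trans hz1)
        have hz2' : z.re ≤ 2 := hz2
        linarith
    have hlip := Convex.norm_image_sub_le_of_norm_deriv_le (f := riemannZeta) (s := S)
      (x := σ + t * I) (y := (1 + η : ℝ) + t * I) (C := 8 * N)
      (fun z hz ↦ by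
        apply differentiableAt_riemannZeta
        rintro rfl
        have := (hmem _ hz).1
        simp at this
        linarith)
      (fun z hz ↦ by
        have h := hmem z hz
        have := norm_deriv_riemannZeta_le (s := z) (by linarith [show 1 ≤ z.re from hz.1.1]) h.1
        linarith) hconv
      (by simp [hS]; constructor <;> linarith) (by simp [hS]; constructor <;> linarith)
    have e : (((1 + η : ℝ) : ℂ) + t * I) - (σ + t * I) = ((1 + η - σ : ℝ) : ℂ) := by
      push_cast; ring
    rw [e, norm_real, Real.norm_eq_abs, abs_of_nonneg (by linarith)] at hlip
    have h9 : 8 * N * (1 + η - σ) ≤ 15 / 10 ^ 9 / N ^ 4 := by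
      calc 8 * N * (1 + η - σ) ≤ 15 * N * η := by
            apply mul_le_mul <;> first | positivity | linarith
        _ = _ := by rw [hη]; field_simp
    have := norm_sub_norm_le (riemannZeta (((1 + η : ℝ) : ℂ) + t * I)) (riemannZeta (σ + t * I))
    linarith

open Complex in
/-- Polynomial lower bound for `(s - 1) ζ(s)` in the strip `1 < Re s ≤ 2`. -/
theorem exists_norm_riemannZeta₁_ge : ∃ c : ℝ, 0 < c ∧ ∀ σ t : ℝ, 1 < σ → σ ≤ 2 →
    c / (4 + |t|) ^ 4 ≤ ‖riemannZeta₁ (σ + t * I)‖ := by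
  have hcomp : IsCompact (Set.Icc (1 : ℝ) 2 ×ℂ Set.Icc (-1 : ℝ) 1) :=
    isCompact_Icc.reProdIm isCompact_Icc
  obtain ⟨z₀, hz₀, hmin⟩ := hcomp.exists_isMinOn (f := fun z ↦ ‖riemannZeta₁ z‖)
    ⟨1, by simp [mem_reProdIm]⟩ differentiable_riemannZeta₁.continuous.norm.continuousOn
  have hz₀1 : 1 ≤ z₀.re := (mem_reProdIm.mp hz₀).1.1
  have hpos : 0 < ‖riemannZeta₁ z₀‖ := norm_pos_iff.mpr (riemannZeta₁_ne_zero hz₀1)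
  refine ⟨min ‖riemannZeta₁ z₀‖ (15 / 10 ^ 9), by positivity, fun σ t h1 h2 ↦ ?_⟩
  have hN : 1 ≤ (4 + |t|) ^ 4 := one_le_pow₀ (by linarith [abs_nonneg t])
  by_cases ht : 1 ≤ |t|
  · have hne : (σ + t * I : ℂ) ≠ 1 := by
      intro h; have := congrArg re h; simp at this; linarith
    have h3 := norm_riemannZeta_ge h1 h2 ht
    rw [riemannZeta_eq_inv_sub_mul hne, norm_mul, norm_inv] at h3
    have h4 : 1 ≤ ‖(σ + t * I : ℂ) - 1‖ := by
      refine (ht.trans ?_).trans (abs_im_le_norm _)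
      simp
    have h5 : ‖(σ + t * I : ℂ) - 1‖⁻¹ ≤ 1 := inv_le_one_of_one_le₀ h4
    calc _ ≤ 15 / 10 ^ 9 / (4 + |t|) ^ 4 := by gcongr; exact min_le_right _ _
      _ ≤ _ := h3
      _ ≤ 1 * ‖riemannZeta₁ (σ + t * I)‖ := by gcongr
      _ = _ := one_mul _
  · push Not at ht
    have : (σ + t * I : ℂ) ∈ Set.Icc (1 : ℝ) 2 ×ℂ Set.Icc (-1 : ℝ) 1 := by
      rw [mem_reProdIm]; simp; exact ⟨⟨h1.le, h2⟩, abs_le.mp ht.le⟩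
    have h3 : ‖riemannZeta₁ z₀‖ ≤ ‖riemannZeta₁ (σ + t * I)‖ := hmin this
    calc _ ≤ min ‖riemannZeta₁ z₀‖ (15 / 10 ^ 9) := div_le_self (by positivity) hN
      _ ≤ _ := (min_le_left _ _).trans h3

/-- The regular function `-ζ'/ζ - ζ` near the half-plane `Re s ≥ 1`. -/
noncomputable def zetaReg (s : ℂ) : ℂ :=
  -deriv riemannZeta₁ s / riemannZeta₁ s - riemannZeta₀ s

theorem zetaReg_eq {s : ℂ} (hs : 1 < s.re) :
    zetaReg s = -deriv riemannZeta s / riemannZeta s - riemannZeta s := by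
  have h1 : s ≠ 1 := by rintro rfl; simp at hs
  have h2 : s - 1 ≠ 0 := sub_ne_zero.mpr h1
  have h3 := riemannZeta₁_ne_zero hs.le
  rw [deriv_riemannZeta_eq_neg_inv_sub_sq_mul_add h1, riemannZeta_eq_inv_sub_mul h1, zetaReg]
  have h4 : riemannZeta₁ s = 1 + (s - 1) * riemannZeta₀ s := rfl
  have h5 : riemannZeta₀ s = (riemannZeta₁ s - 1) / (s - 1) := by rw [h4]; field_simp; ring
  rw [h5]
  field_simp
  ring

theorem deriv_riemannZeta₁ (s : ℂ) :
    deriv riemannZeta₁ s = riemannZeta₀ s + (s - 1) * deriv riemannZeta₀ s := by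
  have : riemannZeta₁ = fun s ↦ 1 + (s - 1) * riemannZeta₀ s := rfl
  rw [this, deriv_const_add, deriv_fun_mul (by fun_prop) (by fun_prop)]
  simp

theorem deriv_deriv_riemannZeta₁ (s : ℂ) :
    deriv (deriv riemannZeta₁) s =
      2 * deriv riemannZeta₀ s + (s - 1) * deriv (deriv riemannZeta₀) s := by
  have : deriv riemannZeta₁ = fun s ↦ riemannZeta₀ s + (s - 1) * deriv riemannZeta₀ s :=
    funext deriv_riemannZeta₁
  have hd : Differentiable ℂ (deriv riemannZeta₀) := differentiable_riemannZeta₀.deriv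
  rw [this, deriv_fun_add (by fun_prop) (by fun_prop), deriv_fun_mul (by fun_prop) (by fun_prop)]
  simp
  ring

theorem hasDerivAt_zetaReg {s : ℂ} (hs : 1 ≤ s.re) :
    HasDerivAt zetaReg (-deriv (deriv riemannZeta₁) s / riemannZeta₁ s +
      (deriv riemannZeta₁ s / riemannZeta₁ s) ^ 2 - deriv riemannZeta₀ s) s := by
  have h3 := riemannZeta₁_ne_zero hs
  have a := (differentiable_riemannZeta₁.deriv s).hasDerivAt
  have b := (differentiable_riemannZeta₁ s).hasDerivAt
  have c := (differentiable_riemannZeta₀ s).hasDerivAt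
  refine ((a.fun_neg.fun_div b h3).fun_sub c).congr_deriv ?_
  field_simp
  ring

open Complex in
/-- `-ζ'/ζ - ζ` and its derivative grow at most polynomially, uniformly for `1 < Re s ≤ 2`. -/
theorem exists_norm_zetaReg_le : ∃ C : ℝ, 0 < C ∧ ∀ σ t : ℝ, 1 < σ → σ ≤ 2 →
    ‖zetaReg (σ + t * I)‖ ≤ C * (4 + |t|) ^ 12 ∧
    ‖deriv zetaReg (σ + t * I)‖ ≤ C * (4 + |t|) ^ 12 := by
  obtain ⟨c, hc, hlow⟩ := exists_norm_riemannZeta₁_ge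
  refine ⟨100 / c + (100 / c) ^ 2 + 100, by positivity, fun σ t h1 h2 ↦ ?_⟩
  set N : ℝ := 4 + |t| with hN
  have hN1 : 1 ≤ N := by linarith [abs_nonneg t]
  have hN0 : 0 < N := by linarith
  set s : ℂ := σ + t * I with hs
  have hre : s.re = σ := by simp [hs]
  have hsn : ‖s‖ ≤ N - 2 := by
    refine (norm_add_le _ _).trans ?_
    simp [abs_of_pos (zero_lt_one.trans h1)]
    linarith
  have hsn1 : ‖s - 1‖ ≤ N := by
    refine (norm_sub_le _ _).trans ?_
    rw [norm_one]; linarith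
  have hz : c / N ^ 4 ≤ ‖riemannZeta₁ s‖ := hlow σ t h1 h2
  have hz0 : 0 < c / N ^ 4 := by positivity
  have e0 : ‖riemannZeta₀ s‖ ≤ 2 * N := by
    have := norm_riemannZeta₀_le (s := s) (by linarith); linarith
  have e1 : ‖deriv riemannZeta₀ s‖ ≤ 8 * N := by
    have := norm_deriv_riemannZeta₀_le (s := s) (by linarith); linarith
  have e2 : ‖deriv (deriv riemannZeta₀) s‖ ≤ 32 * N := by
    have := norm_deriv_deriv_riemannZeta₀_le (s := s) (by linarith); linarith
  have hNN : N ≤ N ^ 2 := by nlinarith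
  have d1 : ‖deriv riemannZeta₁ s‖ ≤ 100 * N ^ 2 := by
    rw [deriv_riemannZeta₁]
    calc _ ≤ ‖riemannZeta₀ s‖ + ‖s - 1‖ * ‖deriv riemannZeta₀ s‖ := by
          rw [← norm_mul]; exact norm_add_le _ _
      _ ≤ 2 * N + N * (8 * N) := by gcongr
      _ ≤ _ := by nlinarith
  have d2 : ‖deriv (deriv riemannZeta₁) s‖ ≤ 100 * N ^ 2 := by
    rw [deriv_deriv_riemannZeta₁]
    calc _ ≤ ‖2 * deriv riemannZeta₀ s‖ + ‖s - 1‖ * ‖deriv (deriv riemannZeta₀) s‖ := by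
          rw [← norm_mul (s - 1)]; exact norm_add_le _ _
      _ ≤ 2 * (8 * N) + N * (32 * N) := by
          rw [norm_mul]; gcongr; simp
      _ ≤ _ := by nlinarith
  have q1 : ‖deriv riemannZeta₁ s / riemannZeta₁ s‖ ≤ 100 / c * N ^ 6 := by
    rw [norm_div]
    calc _ ≤ 100 * N ^ 2 / (c / N ^ 4) := by gcongr
      _ = _ := by field_simp
  have q2 : ‖deriv (deriv riemannZeta₁) s / riemannZeta₁ s‖ ≤ 100 / c * N ^ 6 := by
    rw [norm_div]
    calc _ ≤ 100 * N ^ 2 / (c / N ^ 4) := by gcongr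
      _ = _ := by field_simp
  have p1 : N ^ 6 ≤ N ^ 12 := pow_le_pow_right₀ hN1 (by norm_num)
  have p2 : N ≤ N ^ 12 := le_self_pow₀ hN1 (by norm_num)
  have hcc : 0 < 100 / c := by positivity
  have hN12 : 0 < N ^ 12 := by positivity
  constructor
  · rw [zetaReg, neg_div]
    calc _ ≤ ‖-(deriv riemannZeta₁ s / riemannZeta₁ s)‖ + ‖riemannZeta₀ s‖ := norm_sub_le _ _
      _ ≤ 100 / c * N ^ 6 + 2 * N := by rw [norm_neg]; gcongr
      _ ≤ 100 / c * N ^ 12 + 2 * N ^ 12 := by gcongr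
      _ ≤ _ := by nlinarith [mul_nonneg (sq_nonneg (100 / c)) hN12.le]
  · rw [(hasDerivAt_zetaReg (by linarith)).deriv, neg_div]
    calc _ ≤ ‖-(deriv (deriv riemannZeta₁) s / riemannZeta₁ s)‖ +
          ‖(deriv riemannZeta₁ s / riemannZeta₁ s) ^ 2‖ + ‖deriv riemannZeta₀ s‖ :=
          (norm_sub_le _ _).trans (by gcongr; exact norm_add_le _ _)
      _ ≤ 100 / c * N ^ 6 + (100 / c * N ^ 6) ^ 2 + 8 * N := by
          rw [norm_neg, norm_pow]; gcongr
      _ ≤ 100 / c * N ^ 12 + (100 / c) ^ 2 * N ^ 12 + 100 * N ^ 12 := by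
          rw [mul_pow, ← pow_mul]
          gcongr
          linarith
      _ = _ := by ring

section LaplaceMonomial
open Complex MeasureTheory Set Filter Topology

lemma integrableOn_pow_mul_exp_neg_mul_Ioi (n : ℕ) {σ : ℝ} (hσ : 0 < σ) :
    IntegrableOn (fun v : ℝ ↦ v ^ n * Real.exp (-σ * v)) (Ioi 0) := by
  have := integrableOn_rpow_mul_exp_neg_mul_rpow (s := n) (p := 1) (b := σ)
    (by have : (0 : ℝ) ≤ n := n.cast_nonneg
        linarith) one_pos hσ
  simpa using this

lemma norm_pow_mul_cexp (n : ℕ) (s : ℂ) {v : ℝ} (hv : 0 ≤ v) :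
    ‖(v : ℂ) ^ n * cexp (-s * v)‖ = v ^ n * Real.exp (-s.re * v) := by
  rw [norm_mul, norm_pow, Complex.norm_exp]
  simp [abs_of_nonneg hv]

lemma integrableOn_pow_mul_cexp_neg_mul_Ioi (n : ℕ) {s : ℂ} (hs : 0 < s.re) :
    IntegrableOn (fun v : ℝ ↦ (v : ℂ) ^ n * cexp (-s * v)) (Ioi 0) := by
  refine Integrable.mono' (integrableOn_pow_mul_exp_neg_mul_Ioi n hs) ?_ ?_
  · exact (by fun_prop : Continuous fun v : ℝ ↦ (v : ℂ) ^ n * cexp (-s * v)).aestronglyMeasurable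
  · filter_upwards [ae_restrict_mem measurableSet_Ioi] with v hv
    rw [norm_pow_mul_cexp n s (le_of_lt hv)]

lemma tendsto_pow_mul_cexp_neg_mul_atTop (n : ℕ) {s : ℂ} (hs : 0 < s.re) :
    Tendsto (fun v : ℝ ↦ (v : ℂ) ^ n * cexp (-s * v)) atTop (𝓝 0) := by
  rw [tendsto_zero_iff_norm_tendsto_zero]
  have := tendsto_rpow_mul_exp_neg_mul_atTop_nhds_zero n s.re hs
  refine this.congr' ?_
  filter_upwards [eventually_ge_atTop 0] with v hv
  rw [norm_pow_mul_cexp n s hv, Real.rpow_natCast]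

lemma integral_pow_mul_cexp_neg_mul_Ioi (n : ℕ) {s : ℂ} (hs : 0 < s.re) :
    ∫ v in Ioi (0 : ℝ), (v : ℂ) ^ n * cexp (-s * v) = n.factorial / s ^ (n + 1) := by
  have hs0 : s ≠ 0 := by rintro rfl; simp at hs
  have hexp (v : ℝ) : HasDerivAt (fun v : ℝ ↦ cexp (-s * v)) (cexp (-s * v) * (-s)) v := by
    have h1 : HasDerivAt (fun v : ℝ ↦ -s * (v : ℂ)) (-s) v := by
      simpa using (hasDerivAt_id v).ofReal_comp.const_mul (-s)
    exact h1.cexp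
  induction n with
  | zero =>
    have h := integral_Ioi_of_hasDerivAt_of_tendsto' (a := (0 : ℝ))
      (f := fun v : ℝ ↦ (-1 / s) * cexp (-s * v)) (f' := fun v : ℝ ↦ cexp (-s * v)) (m := 0)
      (fun v _ ↦ ((hexp v).const_mul (-1 / s)).congr_deriv (by field_simp))
      (by simpa using integrableOn_pow_mul_cexp_neg_mul_Ioi 0 hs)
      (by simpa using (tendsto_pow_mul_cexp_neg_mul_atTop 0 hs).const_mul (-1 / s))
    simp only [pow_zero, one_mul]
    rw [h]
    simp [neg_div]
  | succ n ih =>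
    have hpow (v : ℝ) : HasDerivAt (fun v : ℝ ↦ (v : ℂ) ^ (n + 1)) ((n + 1) * (v : ℂ) ^ n) v := by
      simpa using ((hasDerivAt_id v).ofReal_comp).fun_pow (n + 1)
    have hi1 := (integrableOn_pow_mul_cexp_neg_mul_Ioi n hs).const_mul ((n : ℂ) + 1)
    have hi2 := (integrableOn_pow_mul_cexp_neg_mul_Ioi (n + 1) hs).const_mul s
    have h := integral_Ioi_of_hasDerivAt_of_tendsto' (a := (0 : ℝ))
      (f := fun v : ℝ ↦ (v : ℂ) ^ (n + 1) * cexp (-s * v))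
      (f' := fun v : ℝ ↦ ((n : ℂ) + 1) * ((v : ℂ) ^ n * cexp (-s * v)) -
        s * ((v : ℂ) ^ (n + 1) * cexp (-s * v))) (m := 0)
      (fun v _ ↦ ((hpow v).mul (hexp v)).congr_deriv (by ring)) (hi1.sub hi2)
      (tendsto_pow_mul_cexp_neg_mul_atTop (n + 1) hs)
    rw [integral_sub hi1 hi2, integral_const_mul, integral_const_mul, ih] at h
    simp only [ofReal_zero, ne_eq, Nat.add_eq_zero_iff, one_ne_zero, and_false, not_false_eq_true,
      zero_pow, zero_mul, sub_zero] at h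
    rw [sub_eq_zero] at h
    have h2 : ∫ v in Ioi (0 : ℝ), (v : ℂ) ^ (n + 1) * cexp (-s * v) =
        ((n + 1) * (n.factorial / s ^ (n + 1))) / s := by
      rw [h]; field_simp
    rw [h2, Nat.factorial_succ]
    push_cast
    field_simp
    ring

end LaplaceMonomial

section Perron
open Complex MeasureTheory Set Filter Topology
open scoped Real FourierTransform

/-- The causal kernel `v ↦ v₊ᵐ e^{-σ v} / m!`, whose Fourier transform is
`w ↦ (σ + 2πiw)^{-(m+1)}`. -/
noncomputable def perronKernel (m : ℕ) (σ : ℝ) : ℝ → ℂ :=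
  fun v ↦ ((max v 0 : ℝ) : ℂ) ^ m / m.factorial * cexp (-σ * v)

lemma continuous_perronKernel (m : ℕ) (σ : ℝ) : Continuous (perronKernel m σ) := by
  unfold perronKernel
  fun_prop

lemma perronKernel_of_nonpos {m : ℕ} (hm : m ≠ 0) (σ : ℝ) {v : ℝ} (hv : v ≤ 0) :
    perronKernel m σ v = 0 := by
  simp [perronKernel, max_eq_right hv, hm]

lemma integrable_perronKernel {m : ℕ} (hm : m ≠ 0) {σ : ℝ} (hσ : 0 < σ) :
    Integrable (perronKernel m σ) := by
  rw [← integrableOn_iff_integrable_of_support_subset (s := Ioi 0)]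
  · refine IntegrableOn.congr_fun
      ((integrableOn_pow_mul_cexp_neg_mul_Ioi m (s := σ) (by simpa)).const_mul
        (1 / (m.factorial : ℂ))) (fun v hv ↦ ?_) measurableSet_Ioi
    simp only [perronKernel, max_eq_left (le_of_lt (mem_Ioi.1 hv))]
    ring
  · intro v hv
    by_contra h
    exact hv (perronKernel_of_nonpos hm σ (not_lt.1 h))

lemma fourier_perronKernel {m : ℕ} (hm : m ≠ 0) {σ : ℝ} (hσ : 0 < σ) (w : ℝ) :
    𝓕 (perronKernel m σ) w = 1 / (σ + (2 * π * w : ℝ) * I) ^ (m + 1) := by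
  rw [Real.fourier_real_eq_integral_exp_smul]
  have h0 : (m.factorial : ℂ) ≠ 0 := by exact_mod_cast m.factorial_ne_zero
  rw [← setIntegral_eq_integral_of_forall_compl_eq_zero (s := Ioi 0)]
  · have h := integral_pow_mul_cexp_neg_mul_Ioi m (s := σ + (2 * π * w : ℝ) * I) (by simpa)
    have h2 : ∫ v in Ioi (0 : ℝ), cexp (↑(-2 * π * v * w) * I) • perronKernel m σ v =
        ∫ v in Ioi (0 : ℝ), (1 / (m.factorial : ℂ)) *
          ((v : ℂ) ^ m * cexp (-(σ + (2 * π * w : ℝ) * I) * v)) := by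
      refine setIntegral_congr_fun measurableSet_Ioi fun v hv ↦ ?_
      simp only [perronKernel, max_eq_left (le_of_lt (mem_Ioi.1 hv)), smul_eq_mul]
      have : cexp (-(σ + (2 * π * w : ℝ) * I) * v) =
          cexp (↑(-2 * π * v * w) * I) * cexp (-σ * v) := by
        rw [← Complex.exp_add]; congr 1; push_cast; ring
      rw [this]; ring
    rw [h2, integral_const_mul, h]
    field_simp
  · intro v hv
    rw [perronKernel_of_nonpos hm σ (not_lt.1 hv), smul_zero]

lemma one_add_sq_le_norm_sq {σ : ℝ} (hσ : 1 ≤ σ) (w : ℝ) :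
    1 + w ^ 2 ≤ ‖(σ + (2 * π * w : ℝ) * I : ℂ)‖ ^ 2 := by
  rw [← Complex.normSq_eq_norm_sq, Complex.normSq_add_mul_I]
  have h1 : 1 ≤ σ ^ 2 := by nlinarith
  have h2 : w ^ 2 ≤ (2 * π * w) ^ 2 := by
    rw [mul_pow]
    have : 1 ≤ (2 * π) ^ 2 := by nlinarith [Real.pi_gt_three]
    nlinarith [sq_nonneg w]
  linarith

lemma vertical_ne_zero {σ : ℝ} (hσ : 1 ≤ σ) (w : ℝ) : (σ + (2 * π * w : ℝ) * I : ℂ) ≠ 0 := by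
  intro h
  have := congrArg re h
  simp at this
  linarith

lemma continuous_inv_vertical_pow (m : ℕ) {σ : ℝ} (hσ : 1 ≤ σ) :
    Continuous fun w : ℝ ↦ 1 / (σ + (2 * π * w : ℝ) * I : ℂ) ^ (m + 1) := by
  refine Continuous.div (by fun_prop) (by fun_prop) fun w ↦ pow_ne_zero _ (vertical_ne_zero hσ w)

lemma integrable_inv_vertical_pow {m : ℕ} (hm : m ≠ 0) {σ : ℝ} (hσ : 1 ≤ σ) :
    Integrable fun w : ℝ ↦ 1 / (σ + (2 * π * w : ℝ) * I : ℂ) ^ (m + 1) := by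
  refine Integrable.mono' integrable_inv_one_add_sq
    (continuous_inv_vertical_pow m hσ).aestronglyMeasurable (Eventually.of_forall fun w ↦ ?_)
  have h1 := one_add_sq_le_norm_sq hσ w
  have h2 : (1 : ℝ) ≤ ‖(σ + (2 * π * w : ℝ) * I : ℂ)‖ := by
    have := norm_nonneg (σ + (2 * π * w : ℝ) * I : ℂ)
    nlinarith [sq_nonneg w]
  rw [norm_div, norm_one, norm_pow, one_div]
  refine inv_anti₀ (by positivity) (h1.trans (pow_le_pow_right₀ h2 ?_))
  omega

lemma integral_cexp_mul_inv_vertical_pow {m : ℕ} (hm : m ≠ 0) {σ : ℝ} (hσ : 1 ≤ σ) (v : ℝ) :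
    ∫ w : ℝ, cexp ((2 * π * w * v : ℝ) * I) * (1 / (σ + (2 * π * w : ℝ) * I : ℂ) ^ (m + 1)) =
      perronKernel m σ v := by
  have hσ0 : 0 < σ := by linarith
  have hF : 𝓕 (perronKernel m σ) =
      fun w : ℝ ↦ 1 / (σ + (2 * π * w : ℝ) * I : ℂ) ^ (m + 1) :=
    funext (fourier_perronKernel hm hσ0)
  have h := (continuous_perronKernel m σ).fourierInv_fourier_eq (integrable_perronKernel hm hσ0)
    (by rw [hF]; exact integrable_inv_vertical_pow hm hσ)
  rw [← congrFun h v, hF, Real.fourierInv_eq']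
  refine integral_congr_ae (Eventually.of_forall fun w ↦ ?_)
  simp only [smul_eq_mul, RCLike.inner_apply, conj_trivial]
  congr 4
  ring

end Perron

section Explicit
open Complex MeasureTheory Set Filter Topology
open scoped Real FourierTransform ArithmeticFunction

/-- The coefficients `Λ(n) - 1`, with the value `0` at `n = 0`. -/
noncomputable def lambdaSubOne (n : ℕ) : ℝ :=
  if n = 0 then 0 else ArithmeticFunction.vonMangoldt n - 1

lemma hasSum_lambdaSubOne {s : ℂ} (hs : 1 < s.re) :
    HasSum (fun n : ℕ ↦ (lambdaSubOne n : ℂ) * cexp (-(Real.log n) * s)) (zetaReg s) := by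
  have h1 := ArithmeticFunction.LSeriesSummable_vonMangoldt hs
  have h2 := LSeriesSummable_one_iff.2 hs
  have h := (h1.sub h2).LSeriesHasSum
  rw [LSeries_sub h1 h2, LSeries_one_eq_riemannZeta hs,
    ArithmeticFunction.LSeries_vonMangoldt_eq_deriv_riemannZeta_div hs, ← zetaReg_eq hs, LSeriesHasSum] at h
  convert h using 1
  ext n
  rcases Nat.eq_zero_or_pos n with rfl | hn
  · simp [lambdaSubOne]
  · have hn0 : (n : ℂ) ≠ 0 := by exact_mod_cast hn.ne'
    rw [LSeries.term_of_ne_zero hn.ne', Complex.cpow_def_of_ne_zero hn0, div_eq_mul_inv,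
      ← Complex.exp_neg, Complex.natCast_log, lambdaSubOne, if_neg hn.ne', neg_mul]
    simp

lemma integrable_cexp_mul_inv_vertical_pow {m : ℕ} (hm : m ≠ 0) {σ : ℝ} (hσ : 1 ≤ σ) (v : ℝ) :
    Integrable fun w : ℝ ↦
      cexp ((2 * π * w * v : ℝ) * I) * (1 / (σ + (2 * π * w : ℝ) * I : ℂ) ^ (m + 1)) := by
  refine (integrable_inv_vertical_pow hm hσ).bdd_mul (c := 1)
    (by fun_prop : Continuous fun w : ℝ ↦ cexp ((2 * π * w * v : ℝ) * I)).aestronglyMeasurable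
    (Eventually.of_forall fun w ↦ ?_)
  rw [Complex.norm_exp_ofReal_mul_I]

lemma hasSum_lambdaSubOne_mul_perronKernel {m : ℕ} (hm : m ≠ 0) {σ : ℝ} (hσ : 1 < σ) (u : ℝ) :
    HasSum (fun n : ℕ ↦ ((lambdaSubOne n : ℂ) * cexp (-(Real.log n) * σ)) *
        perronKernel m σ (u - Real.log n))
      (∫ w : ℝ, cexp ((2 * π * w * u : ℝ) * I) *
        (zetaReg (σ + (2 * π * w : ℝ) * I) / (σ + (2 * π * w : ℝ) * I : ℂ) ^ (m + 1))) := by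
  set c : ℕ → ℂ := fun n ↦ (lambdaSubOne n : ℂ) * cexp (-(Real.log n) * σ) with hc
  set f : ℕ → ℝ → ℂ := fun n w ↦ c n * (cexp ((2 * π * w * (u - Real.log n) : ℝ) * I) *
    (1 / (σ + (2 * π * w : ℝ) * I : ℂ) ^ (m + 1))) with hf
  have hint (n : ℕ) : Integrable (f n) :=
    (integrable_cexp_mul_inv_vertical_pow hm hσ.le (u - Real.log n)).const_mul (c n)
  have hnorm (n : ℕ) : ∫ w, ‖f n w‖ =
      ‖c n‖ * ∫ w : ℝ, ‖1 / (σ + (2 * π * w : ℝ) * I : ℂ) ^ (m + 1)‖ := by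
    rw [← integral_const_mul]
    refine integral_congr_ae (Eventually.of_forall fun w ↦ ?_)
    simp only [hf, norm_mul, Complex.norm_exp_ofReal_mul_I, one_mul]
  have hsum : Summable fun n ↦ ∫ w, ‖f n w‖ := by
    simp only [hnorm]
    exact (hasSum_lambdaSubOne (s := σ) (by simpa)).summable.norm.mul_right _
  have h := hasSum_integral_of_summable_integral_norm hint hsum
  have e1 : (fun n ↦ ∫ w, f n w) = fun n ↦ c n * perronKernel m σ (u - Real.log n) := by
    ext n
    simp only [hf]
    rw [integral_const_mul, integral_cexp_mul_inv_vertical_pow hm hσ.le]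
  rw [e1] at h
  suffices hw : ∀ w : ℝ, ∑' n, f n w = cexp ((2 * π * w * u : ℝ) * I) *
      (zetaReg (σ + (2 * π * w : ℝ) * I) / (σ + (2 * π * w : ℝ) * I : ℂ) ^ (m + 1)) by
    simpa only [hw] using h
  intro w
  have h3 := ((hasSum_lambdaSubOne (s := σ + (2 * π * w : ℝ) * I) (by simpa)).mul_right
    (cexp ((2 * π * w * u : ℝ) * I) * (1 / (σ + (2 * π * w : ℝ) * I : ℂ) ^ (m + 1)))).tsum_eq
  have h4 (n : ℕ) : f n w = (lambdaSubOne n : ℂ) *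
      cexp (-(Real.log n) * (σ + (2 * π * w : ℝ) * I)) *
      (cexp ((2 * π * w * u : ℝ) * I) * (1 / (σ + (2 * π * w : ℝ) * I : ℂ) ^ (m + 1))) := by
    have : cexp (-(Real.log n) * σ) * cexp ((2 * π * w * (u - Real.log n) : ℝ) * I) =
        cexp (-(Real.log n) * (σ + (2 * π * w : ℝ) * I)) * cexp ((2 * π * w * u : ℝ) * I) := by
      rw [← Complex.exp_add, ← Complex.exp_add]
      congr 1
      push_cast
      ring
    simp only [hf, hc]
    linear_combination (lambdaSubOne n : ℂ) *
      (1 / (σ + (2 * π * w : ℝ) * I : ℂ) ^ (m + 1)) * this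
  simp only [h4]
  rw [h3]
  ring

lemma exists_norm_integral_zetaReg_le : ∃ C : ℝ, 0 < C ∧ ∀ σ u : ℝ, 1 < σ → σ ≤ 2 → 0 < u →
    ‖∫ w : ℝ, cexp ((2 * π * w * u : ℝ) * I) *
      (zetaReg (σ + (2 * π * w : ℝ) * I) / (σ + (2 * π * w : ℝ) * I : ℂ) ^ (13 + 1))‖ ≤ C / u := by
  obtain ⟨C, hC, hb⟩ := exists_norm_zetaReg_le
  set D : ℝ := 15 * (2 * π * C * 5 ^ 12) with hD
  refine ⟨D * π, by positivity, fun σ u h1 h2 hu ↦ ?_⟩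
  set s : ℝ → ℂ := fun w ↦ σ + (2 * π * w : ℝ) * I with hs
  set G : ℝ → ℂ := fun w ↦ zetaReg (s w) / s w ^ 14 with hG
  have hsd (w : ℝ) : HasDerivAt s (2 * π * I) w := by
    have := (((hasDerivAt_id w).const_mul (2 * π)).ofReal_comp.mul_const I).const_add (σ : ℂ)
    simpa [hs] using this
  have hs0 (w : ℝ) : s w ≠ 0 := vertical_ne_zero h1.le w
  have hGd (w : ℝ) : HasDerivAt G (2 * π * I * (deriv zetaReg (s w) / s w ^ 14) -
      14 * (2 * π * I) * (zetaReg (s w) / s w ^ 15)) w := by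
    have hz : HasDerivAt zetaReg (deriv zetaReg (s w)) (s w) :=
      (hasDerivAt_zetaReg (by simp [hs, h1.le])).differentiableAt.hasDerivAt
    have := (hz.comp w (hsd w)).div ((hsd w).fun_pow 14) (pow_ne_zero _ (hs0 w))
    refine this.congr_deriv ?_
    have := hs0 w
    field_simp
    simp only [Function.comp]
    push_cast
    ring
  have hsq (w : ℝ) : 1 + w ^ 2 ≤ ‖s w‖ ^ 2 := one_add_sq_le_norm_sq h1.le w
  have hs1 (w : ℝ) : 1 ≤ ‖s w‖ := by
    have := norm_nonneg (s w)
    nlinarith [sq_nonneg w, hsq w]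
  have h5 (w : ℝ) : 4 + |2 * π * w| ≤ 5 * ‖s w‖ := by
    have h := abs_im_le_norm (s w)
    have : (s w).im = 2 * π * w := by simp [hs]
    rw [this] at h
    linarith [hs1 w]
  have hzb (w : ℝ) : ‖zetaReg (s w)‖ ≤ C * 5 ^ 12 * ‖s w‖ ^ 12 := by
    refine (hb σ (2 * π * w) h1 h2).1.trans ?_
    rw [mul_assoc C, ← mul_pow]
    have := h5 w
    gcongr
  have hzb' (w : ℝ) : ‖deriv zetaReg (s w)‖ ≤ C * 5 ^ 12 * ‖s w‖ ^ 12 := by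
    refine (hb σ (2 * π * w) h1 h2).2.trans ?_
    rw [mul_assoc C, ← mul_pow]
    have := h5 w
    gcongr
  have hquot (z : ℂ) (w : ℝ) (j : ℕ) (hj : 14 ≤ j) (hz : ‖z‖ ≤ C * 5 ^ 12 * ‖s w‖ ^ 12) :
      ‖z / s w ^ j‖ ≤ C * 5 ^ 12 * (1 + w ^ 2)⁻¹ := by
    have hp : 0 < ‖s w‖ := by linarith [hs1 w]
    calc ‖z / s w ^ j‖ = ‖z‖ / ‖s w‖ ^ j := by rw [norm_div, norm_pow]
      _ ≤ (C * 5 ^ 12 * ‖s w‖ ^ 12) / ‖s w‖ ^ 14 := by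
        gcongr
        exact hs1 w
      _ = C * 5 ^ 12 * (‖s w‖ ^ 2)⁻¹ := by field_simp
      _ ≤ _ := by
        have := hsq w
        gcongr
  have hGb (w : ℝ) : ‖G w‖ ≤ C * 5 ^ 12 * (1 + w ^ 2)⁻¹ := hquot _ w 14 le_rfl (hzb w)
  have hG'b (w : ℝ) : ‖deriv G w‖ ≤ D * (1 + w ^ 2)⁻¹ := by
    rw [(hGd w).deriv]
    have n1 : ‖(2 * π * I : ℂ)‖ = 2 * π := by
      simp [abs_of_pos Real.pi_pos]
    calc _ ≤ 2 * π * ‖deriv zetaReg (s w) / s w ^ 14‖ +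
          14 * (2 * π) * ‖zetaReg (s w) / s w ^ 15‖ := by
          refine (norm_sub_le _ _).trans (le_of_eq ?_)
          rw [norm_mul (2 * π * I : ℂ), norm_mul (14 * (2 * π * I) : ℂ), norm_mul (14 : ℂ), n1]
          norm_num
      _ ≤ 2 * π * (C * 5 ^ 12 * (1 + w ^ 2)⁻¹) + 14 * (2 * π) * (C * 5 ^ 12 * (1 + w ^ 2)⁻¹) := by
          gcongr
          · exact hquot _ w 14 le_rfl (hzb' w)
          · exact hquot _ w 15 (by norm_num) (hzb w)
      _ = _ := by rw [hD]; ring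
  have hGdiff : Differentiable ℝ G := fun w ↦ (hGd w).differentiableAt
  have hGi : Integrable G :=
    (integrable_inv_one_add_sq.const_mul (C * 5 ^ 12)).mono'
      hGdiff.continuous.aestronglyMeasurable (Eventually.of_forall hGb)
  have hG'i : Integrable (deriv G) :=
    (integrable_inv_one_add_sq.const_mul D).mono'
      (stronglyMeasurable_deriv G).aestronglyMeasurable (Eventually.of_forall hG'b)
  have hFd := congrFun (Real.fourier_deriv hGi hGdiff hG'i) (-u)
  have hI : ‖𝓕 (deriv G) (-u)‖ ≤ D * π := by
    rw [Real.fourier_real_eq_integral_exp_smul]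
    refine (norm_integral_le_integral_norm _).trans ?_
    have hπ : D * π = ∫ w : ℝ, D * (1 + w ^ 2)⁻¹ := by
      rw [integral_const_mul, integral_univ_inv_one_add_sq]
    rw [hπ]
    refine integral_mono_of_nonneg (Eventually.of_forall fun _ ↦ norm_nonneg _)
      (integrable_inv_one_add_sq.const_mul D) (Eventually.of_forall fun w ↦ ?_)
    simp only [norm_smul, Complex.norm_exp_ofReal_mul_I, one_mul]
    exact hG'b w
  have hFG : 𝓕 G (-u) = ∫ w : ℝ, cexp ((2 * π * w * u : ℝ) * I) *
      (zetaReg (σ + (2 * π * w : ℝ) * I) / (σ + (2 * π * w : ℝ) * I : ℂ) ^ (13 + 1)) := by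
    rw [Real.fourier_real_eq_integral_exp_smul]
    refine integral_congr_ae (Eventually.of_forall fun w ↦ ?_)
    simp only [smul_eq_mul]
    congr 4
    ring
  rw [← hFG]
  rw [hFd, norm_smul] at hI
  have n2 : ‖(2 * π * I * (-u : ℝ) : ℂ)‖ = 2 * π * u := by
    simp [abs_of_pos Real.pi_pos, abs_of_pos hu]
  rw [n2] at hI
  rw [le_div_iff₀ hu]
  have := norm_nonneg (𝓕 G (-u))
  nlinarith [Real.pi_gt_three, mul_nonneg this hu.le]

/-- Smoothed prime number theorem, with weight `log₊¹³(x/n)`. -/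
theorem exists_abs_sum_lambdaSubOne_mul_log_pow_le : ∃ C : ℝ, 0 < C ∧
    ∀ x : ℝ, Real.exp 1 ≤ x →
      |∑ n ∈ Finset.range (⌊x⌋₊ + 1), lambdaSubOne n * (Real.log x - Real.log n) ^ 13| ≤
        C * x / Real.log x := by
  obtain ⟨C, hC, hb⟩ := exists_norm_integral_zetaReg_le
  refine ⟨Nat.factorial 13 * C * Real.exp 1, by positivity, fun x hx ↦ ?_⟩
  have hx0 : 0 < x := (Real.exp_pos 1).trans_le hx
  set u := Real.log x with hu
  have hu1 : 1 ≤ u := by rwa [hu, Real.le_log_iff_exp_le hx0]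
  set σ := 1 + 1 / u with hσ
  have hσ1 : 1 < σ := by rw [hσ]; simp; linarith
  have hσ2 : σ ≤ 2 := by
    have : 1 / u ≤ 1 := by rw [div_le_one (by linarith)]; exact hu1
    linarith
  have h := hasSum_lambdaSubOne_mul_perronKernel (m := 13) (by norm_num) hσ1 u
  have hI := hb σ u hσ1 hσ2 (by linarith)
  rw [← h.tsum_eq] at hI
  have hxs : Real.exp (σ * u) = Real.exp 1 * x := by
    rw [hσ, add_mul, one_mul, one_div, inv_mul_cancel₀ (by linarith), Real.exp_add,
      Real.exp_log hx0, mul_comm]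
  have hval (n : ℕ) (hn : n ∈ Finset.range (⌊x⌋₊ + 1)) :
      ((lambdaSubOne n : ℂ) * cexp (-(Real.log n) * σ)) * perronKernel 13 σ (u - Real.log n) =
      ((lambdaSubOne n * (u - Real.log n) ^ 13 / (Nat.factorial 13 * (Real.exp 1 * x)) : ℝ) : ℂ) := by
    rcases Nat.eq_zero_or_pos n with rfl | hn0
    · simp [lambdaSubOne]
    · have hnx : (n : ℝ) ≤ x := by
        rw [Finset.mem_range, Nat.lt_succ_iff] at hn
        exact (Nat.le_floor_iff hx0.le).1 hn
      have hl : Real.log n ≤ u := Real.log_le_log (by exact_mod_cast hn0) hnx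
      rw [perronKernel, max_eq_left (by linarith), ← hxs]
      have : cexp (-(Real.log n) * σ) * cexp (-σ * (u - Real.log n : ℝ)) =
          (Real.exp (σ * u) : ℂ)⁻¹ := by
        rw [← Complex.exp_add, ← Complex.ofReal_inv, ← Real.exp_neg, Complex.ofReal_exp]
        congr 1; push_cast; ring
      push_cast at this ⊢
      rw [div_eq_mul_inv (_ * _) (_ * _), mul_inv, ← this]
      ring
  have hzero (n : ℕ) (hn : n ∉ Finset.range (⌊x⌋₊ + 1)) :
      ((lambdaSubOne n : ℂ) * cexp (-(Real.log n) * σ)) * perronKernel 13 σ (u - Real.log n) =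
      0 := by
    rw [Finset.mem_range, not_lt] at hn
    have hnx : x < n := (Nat.lt_floor_add_one x).trans_le (by exact_mod_cast hn)
    have hl : u ≤ Real.log n := Real.log_le_log hx0 hnx.le
    rw [perronKernel_of_nonpos (by norm_num) _ (by linarith), mul_zero]
  rw [tsum_eq_sum hzero, Finset.sum_congr rfl hval, ← Complex.ofReal_sum, Complex.norm_real,
    Real.norm_eq_abs, ← Finset.sum_div, abs_div, abs_of_pos (by positivity :
      0 < (Nat.factorial 13 : ℝ) * (Real.exp 1 * x)), div_le_iff₀ (by positivity)] at hI
  refine hI.trans (le_of_eq ?_)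
  ring

end Explicit

section Unsmoothing
open Finset Real
open scoped ArithmeticFunction

/-- The logarithmic Riesz mean `∑_{1 ≤ n ≤ eᵘ} f(n) (u - log n)ʲ`. -/
noncomputable def rieszSum (f : ℕ → ℝ) (j : ℕ) (u : ℝ) : ℝ :=
  ∑ n ∈ Icc 1 ⌊exp u⌋₊, f n * (u - log n) ^ j

lemma succ_mul_pow_mul_sub_le {a b : ℝ} (hb : 0 ≤ b) (hab : b ≤ a) (j : ℕ) :
    (j + 1) * b ^ j * (a - b) ≤ a ^ (j + 1) - b ^ (j + 1) := by
  induction j with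
  | zero => simp
  | succ j ih =>
    have h1 : b * ((j + 1) * b ^ j * (a - b)) ≤ a * (a ^ (j + 1) - b ^ (j + 1)) := by
      have := sub_nonneg.2 hab
      have h2 : 0 ≤ (j + 1) * b ^ j * (a - b) := by positivity
      exact mul_le_mul hab ih h2 (hb.trans hab)
    push_cast
    calc _ = b * ((j + 1) * b ^ j * (a - b)) + b ^ (j + 1) * (a - b) := by ring
      _ ≤ a * (a ^ (j + 1) - b ^ (j + 1)) + b ^ (j + 1) * (a - b) := by gcongr
      _ = _ := by ring

lemma pow_succ_sub_pow_succ_le {a b : ℝ} (hb : 0 ≤ b) (hab : b ≤ a) (j : ℕ) :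
    a ^ (j + 1) - b ^ (j + 1) ≤ (j + 1) * a ^ j * (a - b) := by
  induction j with
  | zero => simp
  | succ j ih =>
    have ha := hb.trans hab
    have hs := sub_nonneg.2 hab
    push_cast
    calc a ^ (j + 1 + 1) - b ^ (j + 1 + 1)
        = a * (a ^ (j + 1) - b ^ (j + 1)) + b ^ (j + 1) * (a - b) := by ring
      _ ≤ a * ((j + 1) * a ^ j * (a - b)) + a ^ (j + 1) * (a - b) := by gcongr
      _ = _ := by ring

lemma log_le_of_mem_Icc_floor_exp {u : ℝ} {n : ℕ} (hn : n ∈ Icc 1 ⌊exp u⌋₊) : log n ≤ u := by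
  rw [mem_Icc, Nat.le_floor_iff (exp_pos u).le] at hn
  rw [log_le_iff_le_exp (by exact_mod_cast hn.1)]
  exact hn.2

lemma Icc_floor_exp_subset {u v : ℝ} (h : u ≤ v) : Icc 1 ⌊exp u⌋₊ ⊆ Icc 1 ⌊exp v⌋₊ :=
  Icc_subset_Icc le_rfl (Nat.floor_mono (exp_le_exp.2 h))

lemma le_rieszSum_succ_sub {f : ℕ → ℝ} (hf : ∀ n, 0 ≤ f n) (j : ℕ) (u : ℝ) {η : ℝ} (hη : 0 ≤ η) :
    (j + 1) * η * rieszSum f j u ≤ rieszSum f (j + 1) (u + η) - rieszSum f (j + 1) u := by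
  have hsub := Icc_floor_exp_subset (show u ≤ u + η by linarith)
  have h1 : ∑ n ∈ Icc 1 ⌊exp u⌋₊, f n * (u + η - log n) ^ (j + 1) ≤ rieszSum f (j + 1) (u + η) :=
    sum_le_sum_of_subset_of_nonneg hsub fun n hn _ ↦ mul_nonneg (hf n)
      (pow_nonneg (sub_nonneg.2 (log_le_of_mem_Icc_floor_exp hn)) _)
  refine le_trans ?_ (sub_le_sub_right h1 _)
  rw [rieszSum, rieszSum, mul_sum, ← sum_sub_distrib]
  refine sum_le_sum fun n hn ↦ ?_
  have hl := log_le_of_mem_Icc_floor_exp hn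
  have h2 := succ_mul_pow_mul_sub_le (sub_nonneg.2 hl)
    (show u - log n ≤ u + η - log n by linarith) j
  calc _ = f n * ((j + 1) * (u - log n) ^ j * (u + η - log n - (u - log n))) := by ring
    _ ≤ f n * ((u + η - log n) ^ (j + 1) - (u - log n) ^ (j + 1)) :=
      mul_le_mul_of_nonneg_left h2 (hf n)
    _ = _ := by ring

lemma rieszSum_succ_sub_le {f : ℕ → ℝ} (hf : ∀ n, 0 ≤ f n) (j : ℕ) (u : ℝ) {η : ℝ} (hη : 0 ≤ η) :
    rieszSum f (j + 1) (u + η) - rieszSum f (j + 1) u ≤ (j + 1) * η * rieszSum f j (u + η) := by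
  have hsub := Icc_floor_exp_subset (show u ≤ u + η by linarith)
  have h1 : rieszSum f (j + 1) u = ∑ n ∈ Icc 1 ⌊exp (u + η)⌋₊,
      f n * (max (u - log n) 0) ^ (j + 1) := by
    rw [rieszSum]
    refine sum_subset_zero_on_sdiff hsub (fun n hn ↦ ?_) fun n hn ↦ ?_
    · rw [mem_sdiff, mem_Icc, mem_Icc, not_and, not_le, Nat.floor_lt (exp_pos u).le] at hn
      have h3 := hn.2 hn.1.1
      have h4 : u ≤ log n := by
        rw [le_log_iff_exp_le (by exact_mod_cast hn.1.1)]
        exact h3.le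
      rw [max_eq_right (by linarith)]
      simp
    · rw [max_eq_left (sub_nonneg.2 (log_le_of_mem_Icc_floor_exp hn))]
  rw [h1, rieszSum, rieszSum, mul_sum, ← sum_sub_distrib]
  refine sum_le_sum fun n hn ↦ ?_
  have hl := sub_nonneg.2 (log_le_of_mem_Icc_floor_exp hn)
  have h2 := pow_succ_sub_pow_succ_le (le_max_right (u - log n) 0)
    (max_le (show u - log n ≤ u + η - log n by linarith) hl) j
  have h3 : u + η - log n - max (u - log n) 0 ≤ η := by
    linarith [le_max_left (u - log n) 0]
  rw [← mul_sub]
  calc _ ≤ f n * ((j + 1) * (u + η - log n) ^ j * η) := by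
        refine mul_le_mul_of_nonneg_left (h2.trans ?_) (hf n)
        gcongr
    _ = _ := by ring

lemma sum_Icc_inv_sqrt_le (M : ℕ) : ∑ n ∈ Icc 1 M, 1 / √(n : ℝ) ≤ 2 * √(M : ℝ) := by
  induction M with
  | zero => simp
  | succ M ih =>
    rw [sum_Icc_succ_top (by omega)]
    have hM : (0 : ℝ) ≤ M := M.cast_nonneg
    push_cast
    set a := √(M : ℝ)
    set b := √((M : ℝ) + 1)
    have ha : a ^ 2 = M := sq_sqrt hM
    have hb : b ^ 2 = M + 1 := sq_sqrt (by linarith)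
    have ha0 : 0 ≤ a := sqrt_nonneg _
    have hb0 : 0 < b := sqrt_pos.2 (by linarith)
    have : 1 / b ≤ 2 * b - 2 * a := by
      rw [div_le_iff₀ hb0]
      nlinarith [sq_nonneg (b - a)]
    linarith

lemma exists_rieszSum_one_le (j : ℕ) : ∃ C : ℝ, 0 < C ∧ ∀ u, rieszSum 1 j u ≤ C * exp u := by
  refine ⟨2 ^ j * j.factorial * 2, by positivity, fun u ↦ ?_⟩
  have h1 : ∀ n ∈ Icc 1 ⌊exp u⌋₊, (1 : ℕ → ℝ) n * (u - log n) ^ j ≤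
      2 ^ j * j.factorial * exp (u / 2) * (1 / √(n : ℝ)) := by
    intro n hn
    have hl := sub_nonneg.2 (log_le_of_mem_Icc_floor_exp hn)
    have hn0 : (0 : ℝ) < n := by exact_mod_cast (mem_Icc.1 hn).1
    have h2 := Real.pow_div_factorial_le_exp ((u - log n) / 2) (by linarith) j
    have h3 : exp ((u - log n) / 2) = exp (u / 2) * (1 / √(n : ℝ)) := by
      rw [sub_div, exp_sub, ← log_sqrt hn0.le, exp_log (sqrt_pos.2 hn0)]
      ring
    rw [h3, div_le_iff₀ (by positivity), div_pow, div_le_iff₀ (by positivity)] at h2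
    simp only [Pi.one_apply, one_mul]
    linarith
  refine (sum_le_sum h1).trans ?_
  rw [← mul_sum]
  have h4 : √(⌊exp u⌋₊ : ℝ) ≤ exp (u / 2) := by
    rw [exp_half]
    exact sqrt_le_sqrt (Nat.floor_le (exp_pos u).le)
  calc _ ≤ 2 ^ j * j.factorial * exp (u / 2) * (2 * exp (u / 2)) := by
        gcongr
        exact (sum_Icc_inv_sqrt_le _).trans (by linarith)
    _ = 2 ^ j * j.factorial * 2 * (exp (u / 2) * exp (u / 2)) := by ring
    _ = _ := by rw [← exp_add, add_halves]

lemma exists_rieszSum_one_sub_le (j : ℕ) : ∃ D : ℝ, 0 < D ∧ ∀ u η, 0 ≤ η → η ≤ 1 →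
    rieszSum 1 j (u + η) - rieszSum 1 j u ≤ D * (η * exp u + 1) := by
  have hexp {η : ℝ} (h0 : 0 ≤ η) (h1 : η ≤ 1) : exp η ≤ 1 + 2 * η := by
    have := Real.abs_exp_sub_one_sub_id_le (x := η) (by rwa [abs_of_nonneg h0])
    have := (abs_le.1 this).2
    nlinarith
  rcases j with _ | j
  · refine ⟨2, by norm_num, fun u η h0 h1 ↦ ?_⟩
    simp only [rieszSum, Pi.one_apply, pow_zero, mul_one, sum_const, Nat.card_Icc,
      add_tsub_cancel_right, nsmul_eq_mul]
    have h2 := Nat.floor_le (exp_pos (u + η)).le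
    have h3 := Nat.lt_floor_add_one (exp u)
    have h4 : exp (u + η) ≤ exp u * (1 + 2 * η) := by
      rw [exp_add]
      exact mul_le_mul_of_nonneg_left (hexp h0 h1) (exp_pos u).le
    nlinarith
  · obtain ⟨C, hC, h⟩ := exists_rieszSum_one_le j
    refine ⟨(j + 1) * C * 3, by positivity, fun u η h0 h1 ↦ ?_⟩
    refine (rieszSum_succ_sub_le (fun _ ↦ zero_le_one) j u h0).trans ?_
    calc _ ≤ (j + 1) * η * (C * exp (u + η)) := by gcongr; exact h _
      _ ≤ (j + 1) * η * (C * (exp u * 3)) := by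
        rw [exp_add]
        gcongr
        linarith [hexp h0 h1]
      _ = (j + 1) * C * 3 * (η * exp u) := by ring
      _ ≤ _ := by gcongr; linarith

end Unsmoothing

section Unsmoothing
open Finset Real
open scoped ArithmeticFunction

/-- `f` has mean value one in the sense of its `j`-th Riesz mean, with a power-of-log saving. -/
def RieszMeanOne (f : ℕ → ℝ) (j : ℕ) : Prop :=
  ∃ δ C u₁ : ℝ, 0 < δ ∧ δ ≤ 1 ∧ 0 < C ∧ 2 ≤ u₁ ∧ ∀ u, u₁ ≤ u →
    |rieszSum f j u - rieszSum 1 j u| ≤ C * (exp u * u ^ (-δ))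

lemma RieszMeanOne.of_succ {f : ℕ → ℝ} (hf : ∀ n, 0 ≤ f n) {j : ℕ} (h : RieszMeanOne f (j + 1)) :
    RieszMeanOne f j := by
  obtain ⟨δ, C, u₁, hδ, hδ1, hC, hu₁, hb⟩ := h
  obtain ⟨D, hD, hN⟩ := exists_rieszSum_one_sub_le j
  refine ⟨δ / 2, 2 * D + 4 * C, u₁ + 1, by linarith, by linarith, by positivity, by linarith,
    fun u hu ↦ ?_⟩
  have hu0 : 0 < u := by linarith
  have hu1 : 1 ≤ u := by linarith
  set η := u ^ (-(δ / 2)) with hη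
  have hη0 : 0 < η := rpow_pos_of_pos hu0 _
  have hη1 : η ≤ 1 := rpow_le_one_of_one_le_of_nonpos hu1 (by linarith)
  have hη2 : u ^ (-δ) = η ^ 2 := by
    rw [hη, ← rpow_natCast, ← rpow_mul hu0.le]
    congr 1; push_cast; ring
  have hE := exp_pos u
  have hηE : 1 ≤ η * exp u := by
    rw [hη, rpow_neg hu0.le, inv_mul_eq_div, le_div_iff₀ (rpow_pos_of_pos hu0 _), one_mul]
    calc u ^ (δ / 2) ≤ u ^ (1 : ℝ) := rpow_le_rpow_of_exponent_le hu1 (by linarith)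
      _ = u := rpow_one u
      _ ≤ _ := by linarith [add_one_le_exp u]
  have he3 : exp (u + η) ≤ exp u * 3 := by
    rw [exp_add]
    gcongr
    exact (exp_le_exp.2 hη1).trans (by linarith [exp_one_lt_d9])
  have hem : exp (u - η) ≤ exp u := exp_le_exp.2 (by linarith)
  have b0 := hb u (by linarith)
  have b1 : |rieszSum f (j + 1) (u + η) - rieszSum 1 (j + 1) (u + η)| ≤ C * (exp u * 3 * η ^ 2) := by
    refine (hb (u + η) (by linarith)).trans ?_
    have : (u + η) ^ (-δ) ≤ η ^ 2 := by
      rw [← hη2]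
      exact rpow_le_rpow_of_nonpos hu0 (by linarith) (by linarith)
    gcongr
  have b2 : |rieszSum f (j + 1) (u - η) - rieszSum 1 (j + 1) (u - η)| ≤
      C * (exp u * (2 * η ^ 2)) := by
    refine (hb (u - η) (by linarith)).trans ?_
    have : (u - η) ^ (-δ) ≤ 2 * η ^ 2 := by
      calc (u - η) ^ (-δ) ≤ (2⁻¹ * u) ^ (-δ) :=
            rpow_le_rpow_of_nonpos (by linarith) (by linarith) (by linarith)
        _ = 2 ^ δ * η ^ 2 := by
            rw [mul_rpow (by norm_num) hu0.le, hη2, inv_rpow (by norm_num), rpow_neg (by norm_num),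
              inv_inv]
        _ ≤ 2 ^ (1 : ℝ) * η ^ 2 := by
            gcongr
            norm_num
        _ = _ := by rw [rpow_one]
    have : 0 ≤ (u - η) ^ (-δ) := rpow_nonneg (by linarith) _
    gcongr
  rw [hη2] at b0
  rw [abs_le] at b0 b1 b2
  have s1 := le_rieszSum_succ_sub hf j u hη0.le
  have s2 := rieszSum_succ_sub_le (f := 1) (fun _ ↦ zero_le_one) j u hη0.le
  have s3 := rieszSum_succ_sub_le hf j (u - η) hη0.le
  have s4 := le_rieszSum_succ_sub (f := 1) (fun _ ↦ zero_le_one) j (u - η) hη0.le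
  have n1 := hN u η hη0.le hη1
  have n2 := hN (u - η) η hη0.le hη1
  rw [sub_add_cancel] at s3 s4 n2
  have n1' : rieszSum 1 j (u + η) - rieszSum 1 j u ≤ D * (2 * (η * exp u)) :=
    n1.trans (by gcongr; linarith)
  have n2' : rieszSum 1 j u - rieszSum 1 j (u - η) ≤ D * (2 * (η * exp u)) := by
    refine n2.trans ?_
    have : η * exp (u - η) ≤ η * exp u := by gcongr
    gcongr
    linarith
  set t : ℝ := (j + 1) * η with ht
  have ht0 : 0 < t := by positivity
  have htη : η ≤ t := by
    have : (0 : ℝ) ≤ j := j.cast_nonneg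
    rw [ht]; nlinarith
  have hfin : 4 * C * (exp u * η ^ 2) ≤ t * (4 * C * (exp u * η)) := by
    have : 0 ≤ 4 * C * (exp u * η) := by positivity
    nlinarith
  have hCE : 0 ≤ C * (exp u * η ^ 2) := by positivity
  rw [abs_le]
  constructor
  · refine le_of_mul_le_mul_left ?_ ht0
    have := mul_le_mul_of_nonneg_left n2' ht0.le
    linarith
  · refine le_of_mul_le_mul_left ?_ ht0
    have := mul_le_mul_of_nonneg_left n1' ht0.le
    linarith

lemma rieszMeanOne_vonMangoldt : RieszMeanOne (fun n ↦ Λ n) 0 := by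
  have h13 : RieszMeanOne (fun n ↦ Λ n) 13 := by
    obtain ⟨C, hC, h⟩ := exists_abs_sum_lambdaSubOne_mul_log_pow_le
    refine ⟨1, C, 2, one_pos, le_rfl, hC, le_rfl, fun u hu ↦ ?_⟩
    have h1 := h (exp u) (exp_le_exp.2 (by linarith))
    rw [log_exp] at h1
    rw [rpow_neg_one, ← div_eq_mul_inv, ← mul_div_assoc]
    refine le_trans (le_of_eq ?_) h1
    congr 1
    rw [rieszSum, rieszSum, ← sum_sub_distrib]
    refine sum_subset_zero_on_sdiff (fun n hn ↦ ?_) (fun n hn ↦ ?_) fun n hn ↦ ?_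
    · rw [mem_Icc] at hn
      exact mem_range.2 (by omega)
    · have : n = 0 := by
        rw [mem_sdiff, mem_range, mem_Icc] at hn
        omega
      simp [lambdaSubOne, this]
    · rw [lambdaSubOne, if_neg (by have := (mem_Icc.1 hn).1; omega)]
      simp only [Pi.one_apply]
      ring
  exact Nat.decreasingInduction (motive := fun j _ ↦ RieszMeanOne (fun n ↦ Λ n) j)
    (fun _ _ ih ↦ ih.of_succ fun _ ↦ ArithmeticFunction.vonMangoldt_nonneg) h13 (Nat.zero_le 13)

/-- The prime number theorem with a power-of-log saving. -/
theorem exists_abs_psi_sub_le : ∃ δ C x₁ : ℝ, 0 < δ ∧ δ ≤ 1 ∧ 0 < C ∧ 2 ≤ x₁ ∧ ∀ x, x₁ ≤ x →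
    |Chebyshev.psi x - x| ≤ C * (x * log x ^ (-δ)) := by
  obtain ⟨δ, C, u₁, hδ, hδ1, hC, hu₁, h⟩ := rieszMeanOne_vonMangoldt
  refine ⟨δ, C + 1, exp u₁, hδ, hδ1, by positivity, by linarith [add_one_le_exp u₁],
    fun x hx ↦ ?_⟩
  have hx0 : 0 < x := (exp_pos _).trans_le hx
  have hu : u₁ ≤ log x := by rwa [le_log_iff_exp_le hx0]
  have h1 := h (log x) hu
  rw [exp_log hx0] at h1
  have h2 : rieszSum (fun n ↦ Λ n) 0 (log x) = Chebyshev.psi x := by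
    rw [rieszSum, exp_log hx0, Chebyshev.psi]
    simp only [pow_zero, mul_one]
    rfl
  have h3 : rieszSum 1 0 (log x) = ⌊x⌋₊ := by
    simp [rieszSum, exp_log hx0]
  rw [h2, h3] at h1
  have h4 : 1 ≤ x * log x ^ (-δ) := by
    have hl : 0 < log x := by linarith
    rw [rpow_neg hl.le, ← div_eq_mul_inv, le_div_iff₀ (rpow_pos_of_pos hl _), one_mul]
    calc log x ^ δ ≤ log x ^ (1 : ℝ) := rpow_le_rpow_of_exponent_le (by linarith) hδ1
      _ = log x := rpow_one _
      _ ≤ x := by linarith [log_le_sub_one_of_pos hx0]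
  have h5 := Nat.floor_le hx0.le
  have h6 := Nat.lt_floor_add_one x
  rw [abs_le] at h1 ⊢
  constructor <;> linarith

end Unsmoothing

section PrimeCounting
open Finset Real Filter Asymptotics

lemma rpow_neg_one_le_rpow_neg {u δ : ℝ} (hu : 1 ≤ u) (hδ : δ ≤ 1) : u⁻¹ ≤ u ^ (-δ) := by
  rw [← rpow_neg_one]
  exact rpow_le_rpow_of_exponent_le hu (by linarith)

theorem exists_abs_primeCounting_sub_le : ∃ δ C x₁ : ℝ, 0 < δ ∧ δ ≤ 1 ∧ 0 < C ∧ 3 ≤ x₁ ∧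
    ∀ x, x₁ ≤ x → |(Nat.primeCounting ⌊x⌋₊ : ℝ) - x / log x| ≤ C * (x / log x * log x ^ (-δ)) := by
  obtain ⟨δ, C, x₁, hδ, hδ1, hC, hx₁, hψ⟩ := exists_abs_psi_sub_le
  obtain ⟨C₁, hC₁, h1⟩ := Chebyshev.primeCounting_sub_theta_div_log_isBigO.exists_pos
  obtain ⟨C₂, hC₂, h2⟩ := Chebyshev.isBigO_psi_sub_theta_sqrt.exists_pos
  rw [IsBigOWith] at h1 h2
  obtain ⟨x₂, h12⟩ := eventually_atTop.1 (h1.and h2)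
  refine ⟨δ, C₁ + C₂ * 2 + C, max 3 (max x₁ x₂), hδ, hδ1, by positivity, le_max_left _ _,
    fun x hx ↦ ?_⟩
  simp only [max_le_iff] at hx
  obtain ⟨hx3, hx1, hx2⟩ := hx
  obtain ⟨a1, a2⟩ := h12 x hx2
  have a3 := hψ x hx1
  have hx0 : 0 < x := by linarith
  have hl : 1 ≤ log x := by
    rw [le_log_iff_exp_le hx0]; linarith [exp_one_lt_d9]
  have hl0 : 0 < log x := by linarith
  set u := log x with hu
  set e := u ^ (-δ) with he
  have he1 : u⁻¹ ≤ e := rpow_neg_one_le_rpow_neg hl hδ1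
  rw [norm_eq_abs, norm_eq_abs, abs_of_nonneg (by positivity : 0 ≤ x / u ^ 2)] at a1
  rw [norm_eq_abs, norm_eq_abs, Pi.sub_apply, abs_of_nonneg (sqrt_nonneg x)] at a2
  have hs : √x ≤ 2 * (x * u⁻¹) := by
    have h3 : u ≤ 2 * √x := by
      have := log_le_sub_one_of_pos (sqrt_pos.2 hx0)
      rw [log_sqrt hx0.le] at this
      linarith
    rw [← div_eq_mul_inv, ← mul_div_assoc, le_div_iff₀ hl0]
    nlinarith [mul_self_sqrt hx0.le, sqrt_nonneg x]
  have b1 : x / u ^ 2 ≤ x / u * e := by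
    calc x / u ^ 2 = x / u * u⁻¹ := by field_simp
      _ ≤ _ := by gcongr
  have b2 : √x ≤ 2 * (x * e) := hs.trans (by gcongr)
  have b4 : |Chebyshev.theta x - x| ≤ (C₂ * 2 + C) * (x * e) := by
    have : Chebyshev.theta x - x = (Chebyshev.psi x - x) - (Chebyshev.psi x - Chebyshev.theta x) := by
      ring
    rw [this]
    refine (abs_sub _ _).trans ?_
    nlinarith [mul_le_mul_of_nonneg_left b2 hC₂.le]
  have b5 : |Chebyshev.theta x / u - x / u| ≤ (C₂ * 2 + C) * (x / u * e) := by
    rw [← sub_div, abs_div, abs_of_pos hl0, div_le_iff₀ hl0]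
    refine b4.trans (le_of_eq ?_)
    field_simp
  calc _ ≤ |(Nat.primeCounting ⌊x⌋₊ : ℝ) - Chebyshev.theta x / u| +
        |Chebyshev.theta x / u - x / u| := abs_sub_le _ _ _
    _ ≤ C₁ * (x / u * e) + (C₂ * 2 + C) * (x / u * e) := by
      gcongr
      exact a1.trans (by gcongr)
    _ = _ := by ring

lemma tendsto_log2 : Tendsto log2 atTop atTop := tendsto_log_atTop.comp tendsto_log_atTop

lemma tendsto_log3 : Tendsto log3 atTop atTop := tendsto_log_atTop.comp tendsto_log2

lemma card_Qset {c₀ x : ℝ} (hx : 0 ≤ x) (hxy : x ≤ yOf c₀ x) :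
    ((Qset c₀ x).card : ℝ) = Nat.primeCounting ⌊yOf c₀ x⌋₊ - Nat.primeCounting ⌊x⌋₊ := by
  have h1 : (range (⌊yOf c₀ x⌋₊ + 1)).filter Nat.Prime =
      Qset c₀ x ∪ (range (⌊x⌋₊ + 1)).filter Nat.Prime := by
    ext q
    simp only [Qset, mem_filter, mem_union, mem_range, Nat.lt_succ_iff, Nat.le_floor_iff hx,
      Nat.le_floor_iff (hx.trans hxy)]
    constructor
    · rintro ⟨ha, hb⟩
      rcases lt_or_ge x q with h | h
      · exact Or.inl ⟨ha, hb, h, ha⟩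
      · exact Or.inr ⟨h, hb⟩
    · rintro (⟨ha, hb, _, _⟩ | ⟨ha, hb⟩)
      · exact ⟨ha, hb⟩
      · exact ⟨ha.trans hxy, hb⟩
  have h2 : Disjoint (Qset c₀ x) ((range (⌊x⌋₊ + 1)).filter Nat.Prime) := by
    rw [disjoint_left]
    intro q ha hb
    simp only [Qset, mem_filter, mem_range, Nat.lt_succ_iff, Nat.le_floor_iff hx] at ha hb
    linarith [ha.2.2.1, hb.1]
  have h3 := congrArg card h1
  rw [card_union_of_disjoint h2] at h3
  rw [Nat.primeCounting, Nat.primeCounting, Nat.primeCounting', Nat.count_eq_card_filter_range,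
    Nat.count_eq_card_filter_range, eq_sub_iff_add_eq]
  exact_mod_cast h3.symm

lemma eventually_mul_log_pow_le {δ : ℝ} (hδ : 0 < δ) (C : ℝ) (n : ℕ) :
    ∀ᶠ L : ℝ in atTop, C * log L ^ n ≤ L ^ δ := by
  have h := (isLittleO_log_rpow_rpow_atTop (n : ℝ) hδ).const_mul_left C
  filter_upwards [h.bound one_pos, eventually_gt_atTop 0] with L hL hL0
  rw [norm_eq_abs, norm_eq_abs, one_mul, abs_of_nonneg (rpow_nonneg hL0.le _), rpow_natCast] at hL
  exact (le_abs_self _).trans hL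

lemma eventually_yOf_bounds {c₀ : ℝ} (hc₀ : 0 < c₀) : ∀ᶠ x : ℝ in atTop,
    x * log x ≤ yOf c₀ x * log2 x ∧ x ≤ yOf c₀ x ∧ yOf c₀ x ≤ x * log x ^ 2 := by
  have hL := eventually_mul_log_pow_le one_pos 1 1
  have hL' := eventually_mul_log_pow_le one_pos c₀ 1
  filter_upwards [eventually_gt_atTop 0, tendsto_log_atTop.eventually hL,
    tendsto_log_atTop.eventually hL', tendsto_log_atTop.eventually_ge_atTop 1,
    tendsto_log2.eventually_ge_atTop 1, tendsto_log3.eventually_ge_atTop 1,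
    tendsto_log3.eventually_ge_atTop (1 / c₀)] with x hx h1 h2 hl1 hl2 hl3 hl3'
  simp only [pow_one, one_mul, rpow_one] at h1 h2
  change log2 x ≤ log x at h1
  change c₀ * log2 x ≤ log x at h2
  have hc : 1 ≤ c₀ * log3 x := by rwa [div_le_iff₀' hc₀] at hl3'
  have h32 : log3 x ≤ log2 x := by
    have := log_le_sub_one_of_pos (show 0 < log2 x by linarith)
    rw [log3]; linarith
  have hy : yOf c₀ x * log2 x = x * log x * (c₀ * log3 x) := by
    rw [yOf, div_mul_cancel₀ _ (by linarith)]; ring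
  have hxl : 0 < x * log x := by positivity
  have e1 : x * log x ≤ yOf c₀ x * log2 x := by rw [hy]; nlinarith
  refine ⟨e1, ?_, ?_⟩
  · refine le_of_mul_le_mul_right ?_ (show 0 < log2 x by linarith)
    nlinarith
  · refine le_of_mul_le_mul_right ?_ (show 0 < log2 x by linarith)
    rw [hy]
    have : c₀ * log3 x ≤ log x * log2 x := by
      nlinarith
    nlinarith

theorem eventually_card_Qset {c₀ : ℝ} (hc₀ : 0 < c₀) : ∀ᶠ x : ℝ in atTop,
    |((Qset c₀ x).card : ℝ) - yOf c₀ x / log x| ≤ yOf c₀ x / log x / log2 x ^ 10 := by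
  obtain ⟨δ, C, x₁, hδ, hδ1, hC, hx₁, hπ⟩ := exists_abs_primeCounting_sub_le
  have hL := eventually_mul_log_pow_le hδ (2 * C + 3) 11
  filter_upwards [eventually_yOf_bounds hc₀, eventually_ge_atTop x₁,
    tendsto_log_atTop.eventually hL, tendsto_log_atTop.eventually_ge_atTop 1,
    tendsto_log2.eventually_ge_atTop 1] with x ⟨hy1, hy2, hy3⟩ hx hLx hl1 hl2
  have hx0 : 0 < x := by linarith
  rw [card_Qset hx0.le hy2]
  set y := yOf c₀ x
  set u := log x with hu
  change (2 * C + 3) * log2 x ^ 11 ≤ u ^ δ at hLx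
  set ℓ := log2 x with hℓ
  have hℓu : log u = ℓ := rfl
  have hy0 : 0 < y := by linarith
  have hu0 : 0 < u := by linarith
  have huy : u ≤ log y := log_le_log hx0 hy2
  have huy2 : log y ≤ u + 2 * ℓ := by
    have := log_le_log hy0 hy3
    rwa [log_mul hx0.ne' (by positivity), log_pow, hℓu, Nat.cast_ofNat] at this
  set e := u ^ (-δ) with he
  have he0 : 0 < e := rpow_pos_of_pos hu0 _
  have he1 : u⁻¹ ≤ e := rpow_neg_one_le_rpow_neg hl1 hδ1
  have he2 : e ≤ 1 := rpow_le_one_of_one_le_of_nonpos hl1 (by linarith)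
  have hY : 0 < y / u := by positivity
  have a1 : |(Nat.primeCounting ⌊y⌋₊ : ℝ) - y / log y| ≤ C * (y / u * e) := by
    refine (hπ y (hx.trans hy2)).trans ?_
    have : log y ^ (-δ) ≤ e := rpow_le_rpow_of_nonpos hu0 huy (by linarith)
    gcongr
    · exact rpow_nonneg (by linarith) _
  have a2 : (Nat.primeCounting ⌊x⌋₊ : ℝ) ≤ (1 + C) * (y / u * (ℓ * e)) := by
    have h1 := (abs_le.1 (hπ x hx)).2
    have h2 : x / u * e ≤ x / u := mul_le_of_le_one_right (by positivity) he2
    have h3 : x ≤ y * (ℓ * u⁻¹) := by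
      rw [← div_eq_mul_inv, ← mul_div_assoc, le_div_iff₀ hu0]; exact hy1
    have h4 : x ≤ y * (ℓ * e) := h3.trans (by gcongr)
    have h5 : x / u ≤ y / u * (ℓ * e) := by
      rw [div_mul_eq_mul_div]; gcongr
    nlinarith
  have a3 : |y / log y - y / u| ≤ y / u * (2 * (ℓ * e)) := by
    rw [abs_sub_comm, abs_of_nonneg (sub_nonneg.2 (by gcongr))]
    have hly : 0 < log y := by linarith
    calc y / u - y / log y = y / u * ((log y - u) / log y) := by field_simp
      _ ≤ y / u * (2 * ℓ / u) := by
          gcongr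
          linarith
      _ = y / u * (2 * (ℓ * u⁻¹)) := by field_simp
      _ ≤ _ := by gcongr
  have a4 : |(Nat.primeCounting ⌊y⌋₊ : ℝ) - Nat.primeCounting ⌊x⌋₊ - y / u| ≤
      (2 * C + 3) * (y / u * (ℓ * e)) := by
    have a5 : C * (y / u * e) ≤ C * (y / u * (ℓ * e)) := by
      gcongr
      nlinarith
    have a6 : (0 : ℝ) ≤ Nat.primeCounting ⌊x⌋₊ := Nat.cast_nonneg _
    rw [abs_le] at a1 a3 ⊢
    constructor <;> nlinarith
  refine a4.trans ?_
  rw [le_div_iff₀ (by positivity)]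
  have hue : e * u ^ δ = 1 := by rw [he, ← rpow_add hu0]; simp
  calc _ = y / u * (e * ((2 * C + 3) * ℓ ^ 11)) := by ring
    _ ≤ y / u * (e * u ^ δ) := by gcongr
    _ = _ := by rw [hue, mul_one]

end PrimeCounting

section SecondMoment
open Finset

/-- The weight of the classes avoiding two given ones. -/
noncomputable def avoidWeight {ι : Type} {β : ι → Type} [∀ i, Fintype (β i)]
    (w : ∀ i, β i → ℝ) (i : ι) (a b : β i) : ℝ :=
  ∑ c, if a ≠ c ∧ b ≠ c then w i c else 0

lemma avoidWeight_nonneg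
    {ι : Type} {β : ι → Type} [∀ i, Fintype (β i)] {w : ∀ i, β i → ℝ}
    (hw : ∀ i b, 0 ≤ w i b) (i : ι) (a b : β i) :
    0 ≤ avoidWeight w i a b :=
  sum_nonneg fun c _ ↦ by split_ifs <;> simp [hw]

lemma avoidWeight_le_one
    {ι : Type} {β : ι → Type} [∀ i, Fintype (β i)] {w : ∀ i, β i → ℝ}
    (hw : ∀ i b, 0 ≤ w i b) (hw1 : ∀ i, ∑ b, w i b = 1)
    (i : ι) (a b : β i) : avoidWeight w i a b ≤ 1 := by
  rw [← hw1 i]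
  exact sum_le_sum fun c _ ↦ by split_ifs <;> simp [hw]

variable {ι : Type} [Fintype ι] [DecidableEq ι] {β : ι → Type} [∀ i, Fintype (β i)]

/-- The number of `q ∈ Q` whose residues `r i q` all differ from the chosen classes `f i`. -/
noncomputable def sievedCount (Q : Finset ℕ) (r : ∀ i, ℕ → β i) (f : ∀ i, β i) : ℝ :=
  ((Q.filter fun q ↦ ∀ i, r i q ≠ f i).card : ℝ)

lemma sum_prod_weight (w : ∀ i, β i → ℝ) : ∑ f : ∀ i, β i, ∏ i, w i (f i) = ∏ i, ∑ b, w i b := by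
  rw [prod_univ_sum, Fintype.piFinset_univ]

lemma sum_prod_weight_mul_ite (w : ∀ i, β i → ℝ) (P : ∀ i, β i → Prop)
    [∀ i b, Decidable (P i b)] :
    ∑ f : ∀ i, β i, (∏ i, w i (f i)) * (if ∀ i, P i (f i) then 1 else 0) =
      ∏ i, ∑ b, if P i b then w i b else 0 := by
  rw [← sum_prod_weight]
  refine sum_congr rfl fun f _ ↦ ?_
  split_ifs with h
  · simp [h]
  · obtain ⟨i, hi⟩ := not_forall.1 h
    rw [mul_zero, prod_eq_zero (mem_univ i)]
    simp [hi]

lemma sum_weight_mul_sq_sievedCount_sub (w : ∀ i, β i → ℝ) (hw1 : ∀ i, ∑ b, w i b = 1)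
    (Q : Finset ℕ) (r : ∀ i, ℕ → β i) (σ : ℝ) :
    ∑ f : ∀ i, β i, (∏ i, w i (f i)) * (sievedCount Q r f - σ * Q.card) ^ 2 =
      ∑ p ∈ Q ×ˢ Q, (∏ i, avoidWeight w i (r i p.1) (r i p.2) -
        σ * ∏ i, avoidWeight w i (r i p.1) (r i p.1) -
        σ * ∏ i, avoidWeight w i (r i p.2) (r i p.2) + σ ^ 2) := by
  have hX (f : ∀ i, β i) : sievedCount Q r f - σ * Q.card =
      ∑ q ∈ Q, ((if ∀ i, r i q ≠ f i then 1 else 0) - σ) := by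
    rw [sum_sub_distrib, sum_boole, sum_const, nsmul_eq_mul, sievedCount, mul_comm]
  have hav (q q' : ℕ) : ∏ i, avoidWeight w i (r i q) (r i q') =
      ∑ f : ∀ i, β i, (∏ i, w i (f i)) *
        ((if ∀ i, r i q ≠ f i then 1 else 0) * (if ∀ i, r i q' ≠ f i then 1 else 0)) := by
    simp only [avoidWeight]
    rw [← sum_prod_weight_mul_ite w fun i c ↦ r i q ≠ c ∧ r i q' ≠ c]
    refine sum_congr rfl fun f _ ↦ ?_
    simp only [ite_zero_mul_ite_zero, forall_and, one_mul]
  have hone : ∑ f : ∀ i, β i, ∏ i, w i (f i) = 1 := by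
    rw [sum_prod_weight]; simp [hw1]
  have hsq (f : ∀ i, β i) : (sievedCount Q r f - σ * Q.card) ^ 2 =
      ∑ p ∈ Q ×ˢ Q, ((if ∀ i, r i p.1 ≠ f i then 1 else 0) - σ) *
        ((if ∀ i, r i p.2 ≠ f i then 1 else 0) - σ) := by
    rw [hX, sq, sum_mul_sum, ← sum_product']
  simp only [hsq, mul_sum]
  rw [sum_comm]
  refine sum_congr rfl fun p _ ↦ ?_
  have hσ : σ ^ 2 = ∑ f : ∀ i, β i, σ ^ 2 * ∏ i, w i (f i) := by rw [← mul_sum, hone, mul_one]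
  rw [hav, hav, hav, hσ, mul_sum, mul_sum, ← sum_sub_distrib, ← sum_sub_distrib,
    ← sum_add_distrib]
  refine sum_congr rfl fun f _ ↦ ?_
  split_ifs <;> ring

/-- Chebyshev's inequality for the number of survivors of a random sieve. -/
lemma sum_weight_deviation_le {w : ∀ i, β i → ℝ} (hw : ∀ i b, 0 ≤ w i b)
    (hw1 : ∀ i, ∑ b, w i b = 1) (Q : Finset ℕ) (r : ∀ i, ℕ → β i) {σ η l : ℝ} (hσ : 0 ≤ σ)
    (hσ1 : σ ≤ 1) (hη : 0 ≤ η) (hl : 0 < l) (B : Finset (ℕ × ℕ))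
    (h1 : ∀ p ∈ Q ×ˢ Q, p ∉ B → |∏ i, avoidWeight w i (r i p.1) (r i p.1) - σ| ≤ η * σ ∧
      |∏ i, avoidWeight w i (r i p.2) (r i p.2) - σ| ≤ η * σ ∧
      |∏ i, avoidWeight w i (r i p.1) (r i p.2) - σ ^ 2| ≤ η * σ ^ 2) :
    ∑ f : ∀ i, β i with l < |sievedCount Q r f - σ * Q.card|, ∏ i, w i (f i) ≤
      (3 * η * σ ^ 2 * Q.card ^ 2 + 2 * B.card) / l ^ 2 := by
  have hW (f : ∀ i, β i) : 0 ≤ ∏ i, w i (f i) := prod_nonneg fun i _ ↦ hw i _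
  have hP0 (a b : ℕ) : 0 ≤ ∏ i, avoidWeight w i (r i a) (r i b) :=
    prod_nonneg fun i _ ↦ avoidWeight_nonneg hw i _ _
  have hP1 (a b : ℕ) : ∏ i, avoidWeight w i (r i a) (r i b) ≤ 1 :=
    prod_le_one (fun i _ ↦ avoidWeight_nonneg hw i _ _) fun i _ ↦ avoidWeight_le_one hw hw1 i _ _
  rw [le_div_iff₀ (by positivity), sum_mul]
  calc _ ≤ ∑ f : ∀ i, β i with l < |sievedCount Q r f - σ * Q.card|,
        (∏ i, w i (f i)) * (sievedCount Q r f - σ * Q.card) ^ 2 := by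
        refine sum_le_sum fun f hf ↦ mul_le_mul_of_nonneg_left ?_ (hW f)
        rw [mem_filter] at hf
        rw [← sq_abs (sievedCount Q r f - σ * Q.card)]
        exact pow_le_pow_left₀ hl.le hf.2.le 2
    _ ≤ ∑ f : ∀ i, β i, (∏ i, w i (f i)) * (sievedCount Q r f - σ * Q.card) ^ 2 :=
        sum_le_sum_of_subset_of_nonneg (filter_subset _ _) fun f _ _ ↦
          mul_nonneg (hW f) (sq_nonneg _)
    _ ≤ ∑ p ∈ Q ×ˢ Q, (3 * η * σ ^ 2 + if p ∈ B then 2 else 0) := by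
        rw [sum_weight_mul_sq_sievedCount_sub w hw1]
        refine sum_le_sum fun p hp ↦ ?_
        split_ifs with hB
        · have := hP1 p.1 p.2
          have := mul_nonneg hσ (hP0 p.1 p.1)
          have := mul_nonneg hσ (hP0 p.2 p.2)
          have : 0 ≤ 3 * η * σ ^ 2 := by positivity
          nlinarith
        · obtain ⟨a1, a2, a3⟩ := h1 p hp hB
          have b1 := mul_le_mul_of_nonneg_left (abs_le.1 a1).1 hσ
          have b2 := mul_le_mul_of_nonneg_left (abs_le.1 a2).1 hσ
          have b3 := (abs_le.1 a3).2
          nlinarith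
    _ ≤ _ := by
        rw [sum_add_distrib, sum_const, nsmul_eq_mul, card_product]
        have : ∑ p ∈ Q ×ˢ Q, (if p ∈ B then (2 : ℝ) else 0) ≤ 2 * B.card := by
          rw [← sum_filter, sum_const, nsmul_eq_mul, mul_comm]
          gcongr
          intro p hp
          exact (mem_filter.1 hp).2
        push_cast
        nlinarith

end SecondMoment

section UniformAvoiding
open Finset MeasureTheory

variable {k : ℕ}

/-- The number of classes modulo `s` hit by `h`. -/
noncomputable def numHit (h : Fin k → ℕ) (s : ℕ) : ℕ :=
  (univ.image fun i : Fin k ↦ (h i : ZMod s)).card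

/-- The uniform probability weights on the classes modulo `s` avoided by `h`. -/
noncomputable def classWeight (h : Fin k → ℕ) (s : ℕ) (a : ZMod s) : ℝ :=
  if ∀ i, a ≠ (h i : ZMod s) then ((s - numHit h s : ℕ) : ℝ)⁻¹ else 0

lemma numHit_le (h : Fin k → ℕ) (s : ℕ) : numHit h s ≤ k :=
  card_image_le.trans (by simp)

lemma classWeight_nonneg (h : Fin k → ℕ) (s : ℕ) (a : ZMod s) : 0 ≤ classWeight h s a := by
  unfold classWeight
  split_ifs <;> positivity

lemma card_filter_avoid (h : Fin k → ℕ) (s : ℕ) [NeZero s] :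
    (univ.filter fun a : ZMod s ↦ ∀ i, a ≠ (h i : ZMod s)).card = s - numHit h s := by
  have : (univ.filter fun a : ZMod s ↦ ∀ i, a ≠ (h i : ZMod s)) =
      (univ.image fun i : Fin k ↦ (h i : ZMod s))ᶜ := by
    ext a
    simp [eq_comm]
  rw [this, card_compl, ZMod.card, numHit]

lemma sum_classWeight (h : Fin k → ℕ) {s : ℕ} [NeZero s] (hs : k < s) :
    ∑ a, classWeight h s a = 1 := by
  simp only [classWeight]
  rw [← sum_filter, sum_const, card_filter_avoid, nsmul_eq_mul, mul_inv_cancel₀]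
  have := numHit_le h s
  exact_mod_cast (by omega : s - numHit h s ≠ 0)

lemma UniformAvoiding.measure_mem_le {Ω : Type} [MeasurableSpace Ω] {μ : Measure Ω}
    {S : Finset ℕ} {h : Fin k → ℕ} {A : Ω → (s : ℕ) → ZMod s} (hA : UniformAvoiding μ S h A)
    (hS : ∀ s ∈ S, k < s) (F : Finset (∀ s : S, ZMod s)) :
    μ {ω | (fun s : S ↦ A ω s) ∈ F} ≤
      ENNReal.ofReal (∑ f ∈ F, ∏ s : S, classWeight h s (f s)) := by
  have hset : {ω | (fun s : S ↦ A ω s) ∈ F} = ⋃ f ∈ F, {ω | ∀ s : S, A ω s = f s} := by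
    ext ω
    simp only [Set.mem_ofPred_eq, Set.mem_iUnion, exists_prop]
    exact ⟨fun hω ↦ ⟨_, hω, fun _ ↦ rfl⟩, fun ⟨f, hf, hω⟩ ↦ (funext hω : _ = f) ▸ hf⟩
  have hnn (f : ∀ s : S, ZMod s) : 0 ≤ ∏ s : S, classWeight h s (f s) :=
    prod_nonneg fun s _ ↦ classWeight_nonneg h s _
  rw [hset, ENNReal.ofReal_sum_of_nonneg fun f _ ↦ hnn f]
  refine (measure_biUnion_finset_le F _).trans (sum_le_sum fun f _ ↦ ?_)
  let g : (s : ℕ) → ZMod s := fun s ↦ if hs : s ∈ S then f ⟨s, hs⟩ else 0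
  have hg (s : S) : g s = f s := by simp [g]
  have hev : {ω | ∀ s : S, A ω s = f s} = {ω | ∀ s ∈ S, A ω s = g s} := by
    ext ω
    simp only [Set.mem_ofPred_eq]
    exact ⟨fun hω s hs ↦ (hω ⟨s, hs⟩).trans (hg ⟨s, hs⟩).symm, fun hω s ↦ (hω s s.2).trans (hg s)⟩
  rw [hev, hA g, ENNReal.ofReal_prod_of_nonneg fun (s : S) _ ↦ classWeight_nonneg h s (f s),
    ← prod_coe_sort]
  refine prod_le_prod' fun s _ ↦ le_of_eq ?_
  rw [hg]
  simp only [classWeight]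
  split_ifs with h1
  · have hpos : (0 : ℝ) < (s - numHit h s : ℕ) := by
      have := numHit_le h s
      have := hS s s.2
      exact_mod_cast (by omega : 0 < (s : ℕ) - numHit h s)
    rw [ENNReal.ofReal_inv_of_pos hpos, ENNReal.ofReal_natCast, numHit]
  · simp

/-- If the weights of the exceptional vectors sum to at most `ε`, the complementary event has
probability at least `1 - ε`. -/
lemma UniformAvoiding.le_measure {Ω : Type} [MeasurableSpace Ω] {μ : Measure Ω}
    [IsProbabilityMeasure μ]
    {S : Finset ℕ} {h : Fin k → ℕ} {A : Ω → (s : ℕ) → ZMod s} (hA : UniformAvoiding μ S h A)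
    (hS : ∀ s ∈ S, k < s) (F : Finset (∀ s : S, ZMod s)) {ε : ℝ} (hε : 0 ≤ ε)
    (hF : ∑ f ∈ F, ∏ s : S, classWeight h s (f s) ≤ ε) {G : Set Ω}
    (hG : ∀ ω, (fun s : S ↦ A ω s) ∉ F → ω ∈ G) : ENNReal.ofReal (1 - ε) ≤ μ G := by
  have h1 : (1 : ℝ≥0∞) ≤ μ G + ENNReal.ofReal ε := by
    rw [← measure_univ (μ := μ)]
    calc μ Set.univ ≤ μ (G ∪ {ω | (fun s : S ↦ A ω s) ∈ F}) :=
          measure_mono fun ω _ ↦ (em _).symm.imp (hG ω) id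
      _ ≤ _ := (measure_union_le _ _).trans <| by
          gcongr
          exact (hA.measure_mem_le hS F).trans (ENNReal.ofReal_le_ofReal hF)
  rw [ENNReal.ofReal_sub _ hε, ENNReal.ofReal_one]
  exact tsub_le_iff_right.2 h1

end UniformAvoiding

section LocalFactors
open Finset

variable {k : ℕ}

lemma abs_prod_sub_prod_le {ι : Type} (S : Finset ι) (p t ε : ι → ℝ)
    (ht : ∀ i ∈ S, 0 < t i) (hp : ∀ i ∈ S, |p i - t i| ≤ t i * ε i) (hε : ∑ i ∈ S, ε i ≤ 1) :
    |∏ i ∈ S, p i - ∏ i ∈ S, t i| ≤ 2 * (∑ i ∈ S, ε i) * ∏ i ∈ S, t i := by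
  have hf (i) (hi : i ∈ S) : |p i / t i - 1| ≤ ε i := by
    rw [div_sub_one (ht i hi).ne', abs_div, abs_of_pos (ht i hi), div_le_iff₀ (ht i hi), mul_comm]
    exact hp i hi
  have hsum : ∑ i ∈ S, ‖p i / t i - 1‖ ≤ ∑ i ∈ S, ε i := sum_le_sum hf
  have hs0 : 0 ≤ ∑ i ∈ S, ‖p i / t i - 1‖ := sum_nonneg fun _ _ ↦ norm_nonneg _
  have h1 := S.norm_prod_one_add_sub_one_le fun i ↦ p i / t i - 1
  have h2 := Real.abs_exp_sub_one_le
    (x := ∑ i ∈ S, ‖p i / t i - 1‖) (by rw [abs_of_nonneg hs0]; exact hsum.trans hε)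
  have h0 : 0 < ∏ i ∈ S, t i := prod_pos ht
  have h3 : ∏ i ∈ S, (1 + (p i / t i - 1)) = (∏ i ∈ S, p i) / ∏ i ∈ S, t i := by
    rw [← prod_div_distrib]
    exact prod_congr rfl fun _ _ ↦ by ring
  rw [h3, Real.norm_eq_abs, div_sub_one h0.ne', abs_div, abs_of_pos h0, div_le_iff₀ h0] at h1
  refine h1.trans (mul_le_mul_of_nonneg_right ?_ h0.le)
  rw [abs_of_nonneg hs0] at h2
  linarith [le_abs_self (Real.exp (∑ i ∈ S, ‖p i / t i - 1‖) - 1)]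

lemma avoidWeight_classWeight (h : Fin k → ℕ) {S : Finset ℕ} [∀ s : S, NeZero (s : ℕ)] {s : S}
    (hs : k < (s : ℕ)) (a b : ZMod s) :
    avoidWeight (fun s : S ↦ classWeight h s) s a b = 1 - ∑ c ∈ {a, b}, classWeight h s c := by
  have hmem : ∑ c ∈ {a, b}, classWeight h s c =
      ∑ c, if c ∈ ({a, b} : Finset (ZMod s)) then classWeight h s c else 0 := by
    rw [sum_ite_mem, univ_inter]
  rw [hmem, avoidWeight, ← sum_classWeight h hs, ← sum_sub_distrib]
  refine sum_congr rfl fun c _ ↦ ?_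
  simp only [mem_insert, mem_singleton]
  by_cases h1 : a = c <;> by_cases h2 : b = c <;> simp [h1, h2, eq_comm]

lemma classWeight_le (h : Fin k → ℕ) (s : ℕ) (a : ZMod s) :
    classWeight h s a ≤ ((s - numHit h s : ℕ) : ℝ)⁻¹ := by
  unfold classWeight
  split_ifs
  · exact le_rfl
  · positivity

lemma inv_sub_numHit_bounds (h : Fin k → ℕ) {s : ℕ} (hs : 2 * k + 4 ≤ s) :
    (s : ℝ)⁻¹ ≤ ((s - numHit h s : ℕ) : ℝ)⁻¹ ∧
      ((s - numHit h s : ℕ) : ℝ)⁻¹ ≤ (s : ℝ)⁻¹ + 2 * k * ((s : ℝ)⁻¹) ^ 2 ∧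
      ((s - numHit h s : ℕ) : ℝ)⁻¹ ≤ 2 * (s : ℝ)⁻¹ := by
  have hm := numHit_le h s
  have hmR : (numHit h s : ℝ) ≤ k := by exact_mod_cast hm
  have hsR : (2 : ℝ) * k + 4 ≤ s := by exact_mod_cast hs
  have hk : (0 : ℝ) ≤ k := by positivity
  have hm0 : (0 : ℝ) ≤ numHit h s := by positivity
  rw [Nat.cast_sub (by omega)]
  have hs0 : (0 : ℝ) < s := by linarith
  have hd : (0 : ℝ) < s - numHit h s := by linarith
  refine ⟨inv_anti₀ hd (by linarith), ?_, ?_⟩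
  · rw [inv_le_iff_one_le_mul₀ hd, show ((s : ℝ)⁻¹ + 2 * k * ((s : ℝ)⁻¹) ^ 2) * (s - numHit h s) =
      (s + 2 * k) * (s - numHit h s) / (s : ℝ) ^ 2 by field_simp, one_le_div (by positivity)]
    nlinarith
  · rw [inv_le_iff_one_le_mul₀ hd, show 2 * (s : ℝ)⁻¹ * (s - numHit h s) =
      2 * (s - numHit h s) / s by field_simp, one_le_div hs0]
    linarith

lemma abs_one_sub_classWeight_single_sub_le (h : Fin k → ℕ) {s : ℕ} (hs : 2 * k + 4 ≤ s)
    (a : ZMod s) :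
    |1 - classWeight h s a - (1 - 1 / (s : ℝ))| ≤
      (1 - 1 / (s : ℝ)) * (4 * (4 * k + 1) * ((s : ℝ)⁻¹) ^ 2 +
        if ∃ i, a = (h i : ZMod s) then 16 * (s : ℝ)⁻¹ else 0) := by
  obtain ⟨h1, h2, h3⟩ := inv_sub_numHit_bounds h hs
  have hsR : (2 : ℝ) * k + 4 ≤ s := by exact_mod_cast hs
  have hk : (0 : ℝ) ≤ k := by positivity
  have hu : (s : ℝ)⁻¹ ≤ 1 / 4 := by
    rw [one_div]; exact inv_anti₀ (by norm_num) (by linarith)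
  have hu0 : 0 ≤ (s : ℝ)⁻¹ := by positivity
  rw [classWeight, one_div]
  generalize (s : ℝ)⁻¹ = u at *
  generalize ((s - numHit h s : ℕ) : ℝ)⁻¹ = v at *
  have hku : 0 ≤ k * u ^ 2 := by positivity
  by_cases hb : ∃ i, a = (h i : ZMod s)
  · rw [if_neg (by push Not; exact hb), if_pos hb, abs_le]
    constructor <;> nlinarith
  · rw [if_pos (by push Not at hb; exact hb), if_neg hb, abs_le]
    constructor <;> nlinarith

lemma abs_one_sub_classWeight_pair_sub_le (h : Fin k → ℕ) {s : ℕ} (hs : 2 * k + 4 ≤ s)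
    (a b : ZMod s) :
    |1 - ∑ c ∈ {a, b}, classWeight h s c - (1 - 1 / (s : ℝ)) ^ 2| ≤
      (1 - 1 / (s : ℝ)) ^ 2 * (4 * (4 * k + 1) * ((s : ℝ)⁻¹) ^ 2 +
        if a = b ∨ (∃ i, a = (h i : ZMod s)) ∨ ∃ i, b = (h i : ZMod s) then 16 * (s : ℝ)⁻¹
        else 0) := by
  obtain ⟨h1, h2, h3⟩ := inv_sub_numHit_bounds h hs
  have hsR : (2 : ℝ) * k + 4 ≤ s := by exact_mod_cast hs
  have hk : (0 : ℝ) ≤ k := by positivity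
  have hu : (s : ℝ)⁻¹ ≤ 1 / 4 := by
    rw [one_div]; exact inv_anti₀ (by norm_num) (by linarith)
  have hu0 : 0 ≤ (s : ℝ)⁻¹ := by positivity
  rw [one_div]
  have hle0 : 0 ≤ ∑ c ∈ {a, b}, classWeight h s c := sum_nonneg fun c _ ↦ classWeight_nonneg h s c
  have hle : ∑ c ∈ {a, b}, classWeight h s c ≤ 2 * ((s - numHit h s : ℕ) : ℝ)⁻¹ := by
    have := sum_le_card_nsmul {a, b} _ _ fun c _ ↦ classWeight_le h s c
    rw [nsmul_eq_mul] at this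
    refine this.trans (mul_le_mul_of_nonneg_right ?_ (by positivity))
    exact_mod_cast card_le_two
  have hgood (hb : ¬(a = b ∨ (∃ i, a = (h i : ZMod s)) ∨ ∃ i, b = (h i : ZMod s))) :
      ∑ c ∈ {a, b}, classWeight h s c = 2 * ((s - numHit h s : ℕ) : ℝ)⁻¹ := by
    push Not at hb
    rw [sum_pair hb.1, classWeight, classWeight, if_pos hb.2.1, if_pos hb.2.2, two_mul]
  generalize (s : ℝ)⁻¹ = u at *
  generalize ((s - numHit h s : ℕ) : ℝ)⁻¹ = v at *
  generalize ∑ c ∈ {a, b}, classWeight h s c = w at *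
  have hku : 0 ≤ k * u ^ 2 := by positivity
  have ht : (1 : ℝ) / 4 ≤ (1 - u) ^ 2 := by nlinarith
  have hmain : (4 * k + 1) * u ^ 2 ≤ (1 - u) ^ 2 * (4 * (4 * k + 1) * u ^ 2) := by
    have := mul_le_mul_of_nonneg_right ht (by positivity : 0 ≤ 4 * (4 * k + 1) * u ^ 2)
    linarith
  by_cases hb : a = b ∨ (∃ i, a = (h i : ZMod s)) ∨ ∃ i, b = (h i : ZMod s)
  · rw [if_pos hb, mul_add, abs_le]
    have := mul_le_mul_of_nonneg_right ht (by positivity : 0 ≤ 16 * u)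
    constructor <;> nlinarith
  · rw [if_neg hb, hgood hb, add_zero, abs_le]
    constructor <;> nlinarith

lemma card_filter_cast_eq_le {S : Finset ℕ} (hS : ∀ s ∈ S, s.Prime) {n m : ℕ} {X : ℝ}
    (hnm : n ≠ m) (hn : (n : ℝ) ≤ X) (hm : (m : ℝ) ≤ X) :
    ((S.filter fun s ↦ (n : ZMod s) = m).card : ℝ) ≤ 2 * Real.log X := by
  wlog hlt : m < n generalizing n m
  · have := this hnm.symm hm hn (by omega)
    simpa only [eq_comm] using this
  have hd : n - m ≠ 0 := by omega
  have hsub : (S.filter fun s ↦ (n : ZMod s) = m) ⊆ (n - m).primeFactors := fun s hs ↦ by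
    rw [mem_filter] at hs
    rw [Nat.mem_primeFactors]
    refine ⟨hS s hs.1, ?_, hd⟩
    rw [← CharP.cast_eq_zero_iff (ZMod s) s, Nat.cast_sub hlt.le, hs.2, sub_self]
  have hpow : 2 ^ (n - m).primeFactors.card ≤ n - m := by
    refine le_trans ?_ (Nat.le_of_dvd (Nat.pos_of_ne_zero hd) (Nat.prod_primeFactors_dvd _))
    exact pow_card_le_prod _ _ _ fun p hp ↦ (Nat.prime_of_mem_primeFactors hp).two_le
  have hXpos : (0 : ℝ) < n := by exact_mod_cast (by omega : 0 < n)
  have hR : (2 : ℝ) ^ (S.filter fun s ↦ (n : ZMod s) = m).card ≤ X := by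
    refine le_trans ?_ hn
    exact_mod_cast (pow_le_pow_right₀ one_le_two (card_le_card hsub)).trans
      (hpow.trans (Nat.sub_le n m))
  have hlog := Real.log_le_log (by positivity) hR
  rw [Real.log_pow] at hlog
  nlinarith [Real.log_two_gt_d9, (Nat.cast_nonneg _ :
    (0 : ℝ) ≤ (S.filter fun s ↦ (n : ZMod s) = m).card)]

lemma sum_inv_sq_le {S : Finset ℕ} {T : ℝ} (hT : 0 < T) (hS : ∀ s ∈ S, T < (s : ℝ)) :
    ∑ s ∈ S, ((s : ℝ)⁻¹) ^ 2 ≤ 2 / T := by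
  have hsub : S ⊆ Ioo ⌊T⌋₊ (S.sup id + 1) := fun s hs ↦ by
    rw [mem_Ioo]
    exact ⟨Nat.floor_lt hT.le |>.2 (hS s hs), Nat.lt_succ_of_le (le_sup (f := id) hs)⟩
  calc _ ≤ ∑ s ∈ Ioo ⌊T⌋₊ (S.sup id + 1), ((s : ℝ)⁻¹) ^ 2 :=
        sum_le_sum_of_subset_of_nonneg hsub fun _ _ _ ↦ by positivity
    _ ≤ 2 / (⌊T⌋₊ + 1) := by
        simp only [inv_pow]
        exact sum_Ioo_inv_sq_le _ _
    _ ≤ 2 / T := by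
        gcongr
        exact (Nat.lt_floor_add_one T).le

/-- The total relative error of the local factors. -/
lemma sum_local_error_le {S : Finset ℕ} {T C : ℝ} (hT : 0 < T) (hS : ∀ s ∈ S, T < (s : ℝ))
    (b : ℕ → Prop) [DecidablePred b] (hb : ((S.filter b).card : ℝ) ≤ C) :
    ∑ s ∈ S, (4 * (4 * k + 1) * ((s : ℝ)⁻¹) ^ 2 + if b s then 16 * (s : ℝ)⁻¹ else 0) ≤
      (8 * (4 * k + 1) + 16 * C) / T := by
  rw [sum_add_distrib, ← mul_sum, ← sum_filter]
  have h1 := mul_le_mul_of_nonneg_left (sum_inv_sq_le hT hS) (by positivity : 0 ≤ 4 * (4 * (k : ℝ) + 1))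
  have h2 : ∑ s ∈ S.filter b, 16 * (s : ℝ)⁻¹ ≤ C * (16 * T⁻¹) := by
    have := sum_le_card_nsmul (S.filter b) (fun s ↦ 16 * (s : ℝ)⁻¹) (16 * T⁻¹) fun s hs ↦ by
      have := hS s (mem_filter.1 hs).1
      gcongr
    rw [nsmul_eq_mul] at this
    exact this.trans (mul_le_mul_of_nonneg_right hb (by positivity))
  calc _ ≤ 4 * (4 * (k : ℝ) + 1) * (2 / T) + C * (16 * T⁻¹) := add_le_add h1 h2
    _ = _ := by field_simp; ring

lemma card_filter_exists_le {S : Finset ℕ} (hS : ∀ s ∈ S, s.Prime) {h : Fin k → ℕ} {n : ℕ} {X : ℝ}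
    (hX : ∀ i, (h i : ℝ) ≤ X) (hn : (n : ℝ) ≤ X) (hne : ∀ i, n ≠ h i) :
    ((S.filter fun s ↦ ∃ i, (n : ZMod s) = (h i : ZMod s)).card : ℝ) ≤ k * (2 * Real.log X) := by
  have : (S.filter fun s ↦ ∃ i, (n : ZMod s) = (h i : ZMod s)) ⊆
      univ.biUnion fun i ↦ S.filter fun s ↦ (n : ZMod s) = (h i : ZMod s) := fun s hs ↦ by
    simpa using hs
  calc _ ≤ ((∑ i : Fin k, (S.filter fun s ↦ (n : ZMod s) = (h i : ZMod s)).card : ℕ) : ℝ) := by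
        exact_mod_cast (card_le_card this).trans card_biUnion_le
    _ ≤ ∑ _i : Fin k, 2 * Real.log X := by
        rw [Nat.cast_sum]
        exact sum_le_sum fun i _ ↦ card_filter_cast_eq_le hS (hne i) hn (hX i)
    _ = _ := by simp

lemma abs_prod_avoid_sub_le {S : Finset ℕ} [∀ s : S, NeZero (s : ℕ)] (hS : ∀ s ∈ S, s.Prime)
    {T : ℝ} (hkT : 2 * (k : ℝ) + 4 ≤ T) (hT : ∀ s ∈ S, T < (s : ℝ)) {h : Fin k → ℕ} {X : ℝ}
    (hhX : ∀ i, (h i : ℝ) ≤ X) {η : ℝ} (hη1 : η ≤ 2)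
    (hη : 2 * ((8 * (4 * k + 1) + 16 * ((2 * k + 1) * (2 * Real.log X))) / T) ≤ η) {n m : ℕ}
    (hnm : n ≠ m) (hnh : ∀ i, n ≠ h i) (hmh : ∀ i, m ≠ h i) (hn : (n : ℝ) ≤ X)
    (hm : (m : ℝ) ≤ X) :
    |∏ s : S, avoidWeight (fun s : S ↦ classWeight h s) s n n - ∏ s ∈ S, (1 - 1 / (s : ℝ))| ≤
      η * ∏ s ∈ S, (1 - 1 / (s : ℝ)) ∧
    |∏ s : S, avoidWeight (fun s : S ↦ classWeight h s) s n m -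
        (∏ s ∈ S, (1 - 1 / (s : ℝ))) ^ 2| ≤ η * (∏ s ∈ S, (1 - 1 / (s : ℝ))) ^ 2 := by
  have hk : (0 : ℝ) ≤ k := by positivity
  have hT0 : 0 < T := by linarith
  have hks (s : S) : 2 * k + 4 ≤ (s : ℕ) := by
    have := hT s s.2
    exact_mod_cast (by linarith : 2 * (k : ℝ) + 4 ≤ (s : ℕ))
  have ht (s : S) : 0 < 1 - 1 / ((s : ℕ) : ℝ) := by
    have : (4 : ℝ) ≤ (s : ℕ) := by exact_mod_cast (by have := hks s; omega : 4 ≤ (s : ℕ))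
    rw [sub_pos, div_lt_one (by linarith)]
    linarith
  have hlog : 0 ≤ 2 * Real.log X := (Nat.cast_nonneg _).trans (card_filter_cast_eq_le hS hnm hn hm)
  have hfin (b : ℕ → Prop) [DecidablePred b]
      (hb : ((S.filter b).card : ℝ) ≤ (2 * k + 1) * (2 * Real.log X)) :
      2 * ∑ s : S, (4 * (4 * k + 1) * (((s : ℕ) : ℝ)⁻¹) ^ 2 +
        if b s then 16 * ((s : ℕ) : ℝ)⁻¹ else 0) ≤ η := by
    refine le_trans ?_ hη
    rw [sum_coe_sort S fun s : ℕ ↦ (4 * (4 * k + 1) * ((s : ℝ)⁻¹) ^ 2 +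
        if b s then 16 * (s : ℝ)⁻¹ else 0)]
    exact mul_le_mul_of_nonneg_left (sum_local_error_le hT0 hT b hb) zero_le_two
  have hcn := card_filter_exists_le hS hhX hn hnh
  have hcm := card_filter_exists_le hS hhX hm hmh
  have hcnm := card_filter_cast_eq_le hS hnm hn hm
  have hav (s : S) (a b : ZMod s) := avoidWeight_classWeight h (by have := hks s; omega) a b
  simp only [hav, pair_eq_singleton, sum_singleton]
  rw [← prod_coe_sort S, ← prod_pow]
  constructor
  · have hf := hfin (fun s ↦ ∃ i, (n : ZMod s) = (h i : ZMod s)) (by nlinarith)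
    refine (abs_prod_sub_prod_le univ _ _ _ (fun s _ ↦ ht s)
      (fun s _ ↦ abs_one_sub_classWeight_single_sub_le h (hks s) (n : ZMod s)) (by linarith)).trans ?_
    exact mul_le_mul_of_nonneg_right hf (prod_nonneg fun s _ ↦ (ht s).le)
  · have hf := hfin (fun s ↦ (n : ZMod s) = m ∨ (∃ i, (n : ZMod s) = (h i : ZMod s)) ∨
      ∃ i, (m : ZMod s) = (h i : ZMod s)) (by
        rw [filter_or, filter_or]
        have h1 := card_union_le (S.filter fun s ↦ (n : ZMod s) = m)
          ((S.filter fun s ↦ ∃ i, (n : ZMod s) = (h i : ZMod s)) ∪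
            S.filter fun s ↦ ∃ i, (m : ZMod s) = (h i : ZMod s))
        have h2 := card_union_le (S.filter fun s ↦ ∃ i, (n : ZMod s) = (h i : ZMod s))
          (S.filter fun s ↦ ∃ i, (m : ZMod s) = (h i : ZMod s))
        have h3 := Nat.cast_le (α := ℝ).2 (h1.trans (Nat.add_le_add_left h2 _))
        push_cast at h3
        linarith)
    refine (abs_prod_sub_prod_le univ _ _ _ (fun s _ ↦ pow_pos (ht s) 2)
      (fun s _ ↦ abs_one_sub_classWeight_pair_sub_le h (hks s) (n : ZMod s) (m : ZMod s)) (by linarith)).trans ?_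
    exact mul_le_mul_of_nonneg_right hf (prod_nonneg fun s _ ↦ (pow_pos (ht s) 2).le)

end LocalFactors

section Assembly
open Finset Filter

lemma prod_Ioc_one_sub_inv (N : ℕ) :
    ∏ n ∈ Ioc 1 (N + 1), (1 - 1 / (n : ℝ)) = 1 / (N + 1) := by
  induction N with
  | zero => simp
  | succ N ih =>
    rw [prod_Ioc_succ_top (by omega), ih]
    push_cast
    field_simp
    ring

lemma one_sub_inv_mem {s : ℕ} (hs : 1 < s) : 0 ≤ 1 - 1 / (s : ℝ) ∧ 1 - 1 / (s : ℝ) ≤ 1 := by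
  have : (1 : ℝ) ≤ s := by exact_mod_cast hs.le
  exact ⟨sub_nonneg.2 ((div_le_one (by linarith)).2 this), sub_le_self _ (by positivity)⟩

lemma one_div_le_prod_one_sub_inv {S : Finset ℕ} {N : ℕ} (hS : ∀ s ∈ S, 1 < s ∧ s ≤ N) :
    1 / ((N : ℝ) + 1) ≤ ∏ s ∈ S, (1 - 1 / (s : ℝ)) := by
  rw [← prod_Ioc_one_sub_inv]
  have hsub : S ⊆ Ioc 1 (N + 1) := fun s hs ↦ by
    have := hS s hs
    rw [mem_Ioc]
    omega
  rw [← prod_sdiff hsub]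
  refine mul_le_of_le_one_left (prod_nonneg fun s hs ↦ (one_sub_inv_mem (hS s hs).1).1) ?_
  refine prod_le_one (fun s hs ↦ ?_) fun s hs ↦ ?_
  · exact (one_sub_inv_mem (mem_Ioc.1 (mem_sdiff.1 hs).1).1).1
  · exact (one_sub_inv_mem (mem_Ioc.1 (mem_sdiff.1 hs).1).1).2

lemma mem_Sset {x : ℝ} {Z : Finset ℕ} {s : ℕ} (hs : s ∈ Sset x Z) :
    s.Prime ∧ Real.log x ^ 20 < s ∧ s ≤ ⌊alpha x⌋₊ := by
  rw [Sset, mem_filter, mem_range] at hs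
  exact ⟨hs.2.1, hs.2.2.1, by omega⟩

lemma prod_Sset_le_one (x : ℝ) (Z : Finset ℕ) : ∏ s ∈ Sset x Z, (1 - 1 / (s : ℝ)) ≤ 1 :=
  prod_le_one (fun _ hs ↦ (one_sub_inv_mem (mem_Sset hs).1.one_lt).1) fun _ hs ↦
    (one_sub_inv_mem (mem_Sset hs).1.one_lt).2

/-- The sifting density is at least `x ^ (-1/4) / 2`. -/
lemma eventually_le_prod_Sset : ∀ᶠ x : ℝ in atTop, ∀ Z : Finset ℕ,
    1 / (2 * x ^ (1 / 4 : ℝ)) ≤ ∏ s ∈ Sset x Z, (1 - 1 / (s : ℝ)) := by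
  filter_upwards [eventually_ge_atTop 1, tendsto_log2.eventually_ge_atTop 1] with x hx hl Z
  have hα : alpha x ≤ x ^ (1 / 4 : ℝ) := by
    refine Real.rpow_le_rpow_of_exponent_le hx ?_
    have h3 : log3 x ≤ log2 x := by
      have := Real.log_le_sub_one_of_pos (by linarith : 0 < log2 x)
      rw [log3]
      linarith
    rw [div_le_iff₀ (by linarith)]
    linarith
  have hx4 : 1 ≤ x ^ (1 / 4 : ℝ) := Real.one_le_rpow hx (by norm_num)
  have hfl : (⌊alpha x⌋₊ : ℝ) ≤ alpha x := Nat.floor_le (Real.rpow_nonneg (by linarith) _)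
  refine le_trans ?_ (one_div_le_prod_one_sub_inv fun s hs ↦
    ⟨(mem_Sset hs).1.one_lt, (mem_Sset hs).2.2⟩)
  exact one_div_le_one_div_of_le (by positivity) (by linarith)

variable {k : ℕ}

/-- The mean-square bound for the number of survivors, in the form of a tail estimate. -/
lemma sum_weight_tail_le {S Q : Finset ℕ} [∀ s : S, NeZero (s : ℕ)] (hS : ∀ s ∈ S, s.Prime)
    {T : ℝ} (hkT : 2 * (k : ℝ) + 4 ≤ T) (hT : ∀ s ∈ S, T < (s : ℝ)) {h : Fin k → ℕ} {X : ℝ}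
    (hhX : ∀ i, (h i : ℝ) ≤ X) (hQ : ∀ q ∈ Q, (q : ℝ) ≤ X) {η : ℝ} (hη0 : 0 ≤ η) (hη1 : η ≤ 2)
    (hη : 2 * ((8 * (4 * k + 1) + 16 * ((2 * k + 1) * (2 * Real.log X))) / T) ≤ η) {l : ℝ}
    (hl : 0 < l) :
    ∑ f : ∀ s : S, ZMod s with
        l < |sievedCount Q (fun (s : S) (q : ℕ) ↦ (q : ZMod s)) f -
          (∏ s ∈ S, (1 - 1 / (s : ℝ))) * Q.card|,
      ∏ s : S, classWeight h s (f s) ≤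
      (3 * η * (∏ s ∈ S, (1 - 1 / (s : ℝ))) ^ 2 * Q.card ^ 2 +
        2 * ((2 * k + 1) * Q.card)) / l ^ 2 := by
  have hks (s : S) : k < (s : ℕ) := by
    have := hT s s.2
    have hk : (0 : ℝ) ≤ k := by positivity
    exact_mod_cast (by linarith : (k : ℝ) < (s : ℕ))
  have hmem (s : ℕ) (hs : s ∈ S) := one_sub_inv_mem (hS s hs).one_lt
  set H := univ.image h
  have hH : H.card ≤ k := card_image_le.trans (by simp)
  set B := Q.diag ∪ (H ×ˢ Q ∪ Q ×ˢ H)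
  have hB : (B.card : ℝ) ≤ (2 * k + 1) * Q.card := by
    have h1 := card_union_le Q.diag (H ×ˢ Q ∪ Q ×ˢ H)
    have h2 := card_union_le (H ×ˢ Q) (Q ×ˢ H)
    rw [card_product, card_product] at h2
    rw [diag_card] at h1
    have h3 := Nat.mul_le_mul_right Q.card hH
    have h4 : B.card ≤ (2 * k + 1) * Q.card := by nlinarith
    exact_mod_cast h4
  have hgood : ∀ p ∈ Q ×ˢ Q, p ∉ B →
      |∏ s : S, avoidWeight (fun s : S ↦ classWeight h s) s p.1 p.1 - ∏ s ∈ S, (1 - 1 / (s : ℝ))| ≤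
        η * ∏ s ∈ S, (1 - 1 / (s : ℝ)) ∧
      |∏ s : S, avoidWeight (fun s : S ↦ classWeight h s) s p.2 p.2 - ∏ s ∈ S, (1 - 1 / (s : ℝ))| ≤
        η * ∏ s ∈ S, (1 - 1 / (s : ℝ)) ∧
      |∏ s : S, avoidWeight (fun s : S ↦ classWeight h s) s p.1 p.2 -
        (∏ s ∈ S, (1 - 1 / (s : ℝ))) ^ 2| ≤ η * (∏ s ∈ S, (1 - 1 / (s : ℝ))) ^ 2 := by
    rintro ⟨n, m⟩ hp hpB
    rw [mem_product] at hp
    simp only [B, H, mem_union, mem_diag, mem_product, mem_image, mem_univ, true_and, hp.1, hp.2,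
      not_or, and_true, not_exists] at hpB
    obtain ⟨hnm, hnh, hmh⟩ := hpB
    have h1 := abs_prod_avoid_sub_le hS hkT hT hhX hη1 hη hnm (fun i ↦ Ne.symm (hnh i))
      (fun i ↦ Ne.symm (hmh i)) (hQ n hp.1) (hQ m hp.2)
    have h2 := abs_prod_avoid_sub_le hS hkT hT hhX hη1 hη (Ne.symm hnm)
      (fun i ↦ Ne.symm (hmh i)) (fun i ↦ Ne.symm (hnh i)) (hQ m hp.2) (hQ n hp.1)
    exact ⟨h1.1, h2.1, h1.2⟩
  have hσ0 : 0 ≤ ∏ s ∈ S, (1 - 1 / (s : ℝ)) := prod_nonneg fun s hs ↦ (hmem s hs).1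
  have hσ1 : ∏ s ∈ S, (1 - 1 / (s : ℝ)) ≤ 1 :=
    prod_le_one (fun s hs ↦ (hmem s hs).1) fun s hs ↦ (hmem s hs).2
  have hdev := sum_weight_deviation_le (w := fun s : S ↦ classWeight h s)
    (fun s b ↦ classWeight_nonneg h s b) (fun s ↦ sum_classWeight h (hks s)) Q
    (fun (s : S) (q : ℕ) ↦ (q : ZMod s)) hσ0 hσ1 hη0 hl B hgood
  refine hdev.trans ?_
  gcongr

lemma tail_bound_le {c η σ Y N ℓ ε : ℝ} (hη : 0 ≤ η) (hσ : 0 < σ) (hY : 0 < Y) (hN : 0 ≤ N)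
    (hNY : N ≤ 2 * Y) (hℓ : 0 < ℓ) (hc : 0 ≤ c) (h1 : 12 * η * ℓ ^ 20 ≤ ε / 2)
    (h2 : 4 * c * ℓ ^ 20 ≤ ε / 2 * (σ ^ 2 * Y)) :
    (3 * η * σ ^ 2 * N ^ 2 + 2 * (c * N)) / (σ * Y / ℓ ^ 10) ^ 2 ≤ ε := by
  rw [div_le_iff₀ (by positivity), show (σ * Y / ℓ ^ 10) ^ 2 = σ ^ 2 * Y ^ 2 / ℓ ^ 20 by
    rw [div_pow]; ring_nf, ← mul_div_assoc, le_div_iff₀ (by positivity)]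
  have hN2 : N ^ 2 ≤ 4 * Y ^ 2 := by nlinarith
  calc (3 * η * σ ^ 2 * N ^ 2 + 2 * (c * N)) * ℓ ^ 20
      ≤ (3 * η * σ ^ 2 * (4 * Y ^ 2) + 2 * (c * (2 * Y))) * ℓ ^ 20 := by gcongr
    _ = 12 * η * ℓ ^ 20 * (σ ^ 2 * Y ^ 2) + 4 * c * ℓ ^ 20 * Y := by ring
    _ ≤ ε / 2 * (σ ^ 2 * Y ^ 2) + ε / 2 * (σ ^ 2 * Y) * Y := by gcongr
    _ = ε * (σ ^ 2 * Y ^ 2) := by ring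

/-- The relative error of the correlations of the random sieve. -/
noncomputable def sieveError (k : ℕ) (L : ℝ) : ℝ :=
  2 * ((8 * (4 * k + 1) + 16 * ((2 * k + 1) * (2 * (2 * L)))) / L ^ 20)

lemma sieveError_nonneg {L : ℝ} (hL : 0 ≤ L) : 0 ≤ sieveError k L := by
  unfold sieveError; positivity

lemma eventually_sieveError_mul_le (k : ℕ) {ε : ℝ} (hε : 0 < ε) :
    ∀ᶠ L : ℝ in atTop, 12 * sieveError k L * Real.log L ^ 20 ≤ ε := by
  set C : ℝ := 8 * (4 * k + 1) + 64 * (2 * k + 1)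
  have hC : 0 < C := by positivity
  filter_upwards [eventually_mul_log_pow_le zero_lt_one (24 * C / ε) 20, eventually_ge_atTop 1]
    with L hL hL1
  rw [Real.rpow_one, div_mul_eq_mul_div, div_le_iff₀ hε] at hL
  have hnum : 8 * (4 * (k : ℝ) + 1) + 16 * ((2 * k + 1) * (2 * (2 * L))) ≤ C * L := by
    have : 0 ≤ (k : ℝ) := by positivity
    simp only [C]
    nlinarith
  have hlog : 0 ≤ Real.log L := Real.log_nonneg hL1
  calc 12 * sieveError k L * Real.log L ^ 20 ≤ 12 * (2 * (C * L / L ^ 20)) * Real.log L ^ 20 := by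
        unfold sieveError
        gcongr
    _ = L * (24 * C * Real.log L ^ 20) / L ^ 20 := by ring
    _ ≤ L * (L * ε) / L ^ 20 := by gcongr
    _ ≤ ε := by
        rw [div_le_iff₀ (by positivity)]
        nlinarith [pow_le_pow_right₀ hL1 (by norm_num : 2 ≤ 20)]

lemma eventually_sieveError_le (k : ℕ) : ∀ᶠ L : ℝ in atTop, sieveError k L ≤ 2 := by
  filter_upwards [eventually_sieveError_mul_le k (zero_lt_two),
    Real.tendsto_log_atTop.eventually_ge_atTop 1, eventually_ge_atTop 0] with L h h1 h0
  have := sieveError_nonneg (k := k) h0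
  have := one_le_pow₀ h1 (n := 20)
  nlinarith

lemma eventually_diagonal_le {c₀ : ℝ} (hc₀ : 0 < c₀) {c ε : ℝ} (hc : 0 ≤ c) (hε : 0 < ε) :
    ∀ᶠ x : ℝ in atTop, ∀ σ : ℝ, 1 / (2 * x ^ (1 / 4 : ℝ)) ≤ σ →
      c * log2 x ^ 20 ≤ ε * (σ ^ 2 * (yOf c₀ x / Real.log x)) := by
  filter_upwards [eventually_yOf_bounds hc₀, eventually_ge_atTop 1,
    Real.tendsto_log_atTop.eventually (eventually_mul_log_pow_le zero_lt_one 1 20),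
    Real.tendsto_log_atTop.eventually_ge_atTop 1,
    eventually_mul_log_pow_le (by norm_num : (0 : ℝ) < 1 / 2) (4 * c / ε) 2]
    with x hy hx h20 hL hx2 σ hσ
  rw [Real.rpow_one, one_mul] at h20
  rw [div_mul_eq_mul_div, div_le_iff₀ hε] at hx2
  have hx4 : 0 < x ^ (1 / 4 : ℝ) := by positivity
  have hsq : (x ^ (1 / 4 : ℝ)) ^ 2 = x ^ (1 / 2 : ℝ) := by
    rw [← Real.rpow_natCast, ← Real.rpow_mul (by linarith)]; norm_num
  have hsq2 : x ^ (1 / 2 : ℝ) * x ^ (1 / 2 : ℝ) = x := by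
    rw [← Real.rpow_add (by linarith)]; norm_num
  have hσ2 : 1 / (4 * x ^ (1 / 2 : ℝ)) ≤ σ ^ 2 := by
    refine le_trans (le_of_eq ?_) (pow_le_pow_left₀ (by positivity) hσ 2)
    rw [← hsq]; ring
  calc c * log2 x ^ 20 ≤ c * Real.log x := by gcongr; exact h20
    _ = 4 * c * Real.log x ^ 2 / (4 * Real.log x) := by field_simp
    _ ≤ x ^ (1 / 2 : ℝ) * ε / (4 * Real.log x) := by gcongr
    _ = ε * (1 / (4 * x ^ (1 / 2 : ℝ)) * (x / Real.log x)) := by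
        have hxL : x / Real.log x = x ^ (1 / 2 : ℝ) * x ^ (1 / 2 : ℝ) / Real.log x := by rw [hsq2]
        rw [hxL]
        field_simp
    _ ≤ _ := by
        gcongr
        exact hy.2.1

lemma mem_Qset {c₀ x : ℝ} {q : ℕ} (hq : q ∈ Qset c₀ x) : (q : ℝ) ≤ yOf c₀ x :=
  (mem_filter.1 hq).2.2.2

end Assembly

/-- There is a constant `K` such that for every `ε > 0` and all sufficiently large `x`,
with probability at least `1 − ε` one has
`|#(Q ∩ S(ā)) − σ y/log x| ≤ K (σ y/log x)/(log₂ x)^10`. -/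
theorem statement9 (k : ℕ) (hk : 1 ≤ k) (c₀ : ℝ) (hc₀ : 0 < c₀) :
    ∃ K : ℝ, 0 < K ∧ ∀ ε : ℝ, 0 < ε →
      ∃ x₀ : ℝ, ∀ x : ℝ, x₀ ≤ x →
      ∀ Z : Finset ℕ, Z.card ≤ 1 → (∀ p ∈ Z, p.Prime) →
      ∀ h : Fin k → ℕ, Function.Injective h → AdmissibleTuple h →
        (∀ i, (h i).Prime ∧ x ≤ (h i : ℝ) ∧ (h i : ℝ) ≤ 2 * x) →
      ∀ (Ω : Type) (_ : MeasurableSpace Ω) (μ : MeasureTheory.Measure Ω),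
        MeasureTheory.IsProbabilityMeasure μ →
      ∀ A : Ω → (s : ℕ) → ZMod s,
        UniformAvoiding μ (Sset x Z) h A →
      ENNReal.ofReal (1 - ε) ≤
        μ {ω |
          |(((Qset c₀ x).filter fun q =>
                ∀ s ∈ Sset x Z, (q : ZMod s) ≠ A ω s).card : ℝ) -
              (∏ s ∈ Sset x Z, (1 - 1 / (s : ℝ))) * yOf c₀ x / Real.log x| ≤
            K * ((∏ s ∈ Sset x Z, (1 - 1 / (s : ℝ))) * yOf c₀ x / Real.log x) /
              log2 x ^ (10 : ℕ)} := by
  refine ⟨2, two_pos, fun ε hε ↦ Filter.eventually_atTop.1 ?_⟩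
  filter_upwards [eventually_yOf_bounds hc₀, eventually_card_Qset hc₀, eventually_le_prod_Sset,
    Real.tendsto_log_atTop.eventually (eventually_sieveError_mul_le k (half_pos hε)),
    Real.tendsto_log_atTop.eventually (eventually_sieveError_le k),
    eventually_diagonal_le hc₀ (by positivity : 0 ≤ 4 * (2 * (k : ℝ) + 1)) (half_pos hε),
    Filter.eventually_ge_atTop 2, Real.tendsto_log_atTop.eventually_ge_atTop (2 * (k : ℝ) + 4),
    tendsto_log2.eventually_ge_atTop 1,
    eventually_mul_log_pow_le zero_lt_one 1 2]
    with x hy hQ hσ hη hη2 hdiag hx2 hLk hl hLx Z _ _ h _ _ hh Ω _ μ _ A hA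
  rw [one_mul, Real.rpow_one] at hLx
  have hk0 : (0 : ℝ) ≤ k := by positivity
  have hL : 1 ≤ Real.log x := by linarith
  have hkT : 2 * (k : ℝ) + 4 ≤ Real.log x ^ 20 := hLk.trans (le_self_pow₀ hL (by norm_num))
  have hS (s : ℕ) (hs : s ∈ Sset x Z) : s.Prime := (mem_Sset hs).1
  have hT (s : ℕ) (hs : s ∈ Sset x Z) : Real.log x ^ 20 < s := (mem_Sset hs).2.1
  have hkS (s : ℕ) (hs : s ∈ Sset x Z) : k < s := by
    have := hT s hs
    exact_mod_cast (by linarith : (k : ℝ) < s)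
  have (s : Sset x Z) : NeZero (s : ℕ) := ⟨(hS s s.2).ne_zero⟩
  have hhX (i : Fin k) : (h i : ℝ) ≤ x ^ 2 := by
    nlinarith [(hh i).2.2]
  have hQX (q : ℕ) (hq : q ∈ Qset c₀ x) : (q : ℝ) ≤ x ^ 2 := by
    nlinarith [mem_Qset hq, hy.2.2]
  have hσx := hσ Z
  have hσ1 := prod_Sset_le_one x Z
  have hdx := hdiag _ hσx
  rw [mul_div_assoc]
  set σ := ∏ s ∈ Sset x Z, (1 - 1 / (s : ℝ)) with hσdef
  have hσ0 : 0 < σ := lt_of_lt_of_le (by positivity) hσx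
  set Y := yOf c₀ x / Real.log x
  have hY : 0 < Y := div_pos (by linarith) (by linarith)
  have hl10 : 1 ≤ log2 x ^ 10 := one_le_pow₀ hl
  have hN2 : ((Qset c₀ x).card : ℝ) ≤ 2 * Y := by
    have := (abs_le.1 hQ).2
    have := div_le_self hY.le hl10
    linarith
  have hη0 : 0 ≤ sieveError k (Real.log x) := sieveError_nonneg (by linarith)
  have hlam : 0 < σ * Y / log2 x ^ 10 := by positivity
  have htail := sum_weight_tail_le (S := Sset x Z) (Q := Qset c₀ x) hS hkT hT hhX hQX hη0 hη2
    (by rw [Real.log_pow]; exact le_rfl) hlam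
  rw [← hσdef] at htail
  refine hA.le_measure hkS _ hε.le (htail.trans (tail_bound_le hη0 hσ0 hY (Nat.cast_nonneg _) hN2
    (by linarith) (by positivity) hη hdx)) fun ω hω ↦ ?_
  rw [Finset.mem_filter, not_and, not_lt] at hω
  have hcount : sievedCount (Qset c₀ x) (fun (s : Sset x Z) (q : ℕ) ↦ (q : ZMod s))
      (fun s : Sset x Z ↦ A ω s) =
      (((Qset c₀ x).filter fun q ↦ ∀ s ∈ Sset x Z, (q : ZMod s) ≠ A ω s).card : ℝ) := by
    rw [sievedCount]
    congr 2
    ext q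
    simp
  have hdev := hω (Finset.mem_univ _)
  rw [hcount] at hdev
  have hmain := mul_le_mul_of_nonneg_left hQ hσ0.le
  rw [← abs_of_pos hσ0, ← abs_mul, abs_of_pos hσ0, mul_sub] at hmain
  rw [Set.mem_ofPred_eq]
  refine (abs_sub_le _ (σ * (Qset c₀ x).card) _).trans ((add_le_add hdev hmain).trans_eq ?_)
  ring
end

section
/- For every integer l ≥ 1 there is an absolute constant c > 0 such that there exist infinitely many integers k ≥ l with gcd(k, l) = 1 for which p(k, l) ≥ c·k·(log k · log₂ k · log₄ k)/(log₃ k)². -/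
/-- iterated logarithm: `log₄ x = log log log log x`. -/
noncomputable def log4 (x : ℝ) : ℝ := Real.log (log3 x)

/-- `leastPrimeAP k l` is the least prime in the arithmetic progression `{k n + l : n ≥ 1}`. -/
noncomputable def leastPrimeAP (k l : ℕ) : ℕ :=
  sInf {p : ℕ | p.Prime ∧ ∃ n : ℕ, 1 ≤ n ∧ p = k * n + l}

/-- The primes in the dyadic interval `(2 ^ i, 2 ^ (i + 1)]`. -/
def dyadicPrimes (i : ℕ) : Finset ℕ := (Finset.Ioc (2 ^ i) (2 ^ (i + 1))).filter Nat.Prime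

lemma card_dyadicPrimes_mul_le (i : ℕ) : (dyadicPrimes i).card * i ≤ 4 * 2 ^ i := by
  have h1 : (2 ^ i) ^ (dyadicPrimes i).card ≤ ∏ p ∈ dyadicPrimes i, p := by
    apply Finset.pow_card_le_prod
    intro p hp
    simp only [dyadicPrimes, Finset.mem_filter, Finset.mem_Ioc] at hp
    exact hp.1.1.le
  have h2 : ∏ p ∈ dyadicPrimes i, p ≤ primorial (2 ^ (i + 1)) := by
    unfold primorial
    apply Finset.prod_le_prod_of_subset_of_one_le'
    · intro p hp
      simp only [dyadicPrimes, Finset.mem_filter, Finset.mem_Ioc, Finset.mem_range] at hp ⊢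
      exact ⟨by omega, hp.2⟩
    · intro p hp _
      exact (Finset.mem_filter.1 hp).2.one_le
  have h3 := (h1.trans h2).trans (primorial_le_four_pow _)
  rw [show (4 : ℕ) = 2 ^ 2 by norm_num, ← pow_mul, ← pow_mul,
    Nat.pow_le_pow_iff_right (by norm_num)] at h3
  rw [pow_succ] at h3
  nlinarith

lemma exists_dyadicPrimes_of_lt {p M V : ℕ} (hp : p.Prime) (hM : 2 ^ M < p) (hV : p ≤ 2 ^ V) :
    ∃ i ∈ Finset.Ico M V, p ∈ dyadicPrimes i := by
  have h2 := hp.two_le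
  have hc : Nat.clog 2 p ≤ V := (Nat.clog_le_iff_le_pow (by norm_num)).2 hV
  have hm : M < Nat.clog 2 p := (Nat.lt_clog_iff_pow_lt (by norm_num)).2 hM
  refine ⟨Nat.clog 2 p - 1, Finset.mem_Ico.2 ⟨by omega, by omega⟩, ?_⟩
  simp only [dyadicPrimes, Finset.mem_filter, Finset.mem_Ioc]
  refine ⟨⟨Nat.pow_pred_clog_lt_self (by norm_num) (by omega), ?_⟩, hp⟩
  rw [show Nat.clog 2 p - 1 + 1 = Nat.clog 2 p by omega]
  exact Nat.le_pow_clog (by norm_num) _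

lemma le_card_primes_Ioc (M R : ℕ) (hR : 1 ≤ R) :
    (2 : ℝ) ^ R / R - 2 - 2 ^ M ≤ ((Finset.Ioc (2 ^ M) (2 ^ R)).filter Nat.Prime).card := by
  have h := Chebyshev.pi_ge (2 ^ R)
  have hR' : (1 : ℝ) ≤ R := by exact_mod_cast hR
  have hl2 : 0 < Real.log 2 := Real.log_pos (by norm_num)
  have h1 : Real.log (((2 ^ R : ℕ) : ℝ) + 1) ≤ (R + 1) * Real.log 2 := by
    rw [← Nat.cast_succ, ← Nat.cast_succ, ← Real.log_pow]
    apply Real.log_le_log (by positivity)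
    push_cast
    have : (1 : ℝ) ≤ 2 ^ R := one_le_pow₀ (by norm_num)
    rw [pow_succ]; linarith
  have h2 : (2 : ℝ) ^ R / R - 2 ≤ Nat.primeCounting (2 ^ R) := by
    refine le_trans ?_ h
    push_cast at h1 ⊢
    rw [Real.log_pow, le_div_iff₀ (by positivity), sub_mul, div_mul_eq_mul_div,
      mul_comm (R : ℝ), ← mul_assoc, mul_div_assoc, div_self (by positivity)]
    nlinarith
  have h3 : Nat.primeCounting (2 ^ R) ≤
      2 ^ M + ((Finset.Ioc (2 ^ M) (2 ^ R)).filter Nat.Prime).card := by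
    rw [Nat.primeCounting, Nat.primeCounting', Nat.count_eq_card_filter_range]
    calc _ ≤ (Finset.Icc 1 (2 ^ M) ∪ (Finset.Ioc (2 ^ M) (2 ^ R)).filter Nat.Prime).card := by
          apply Finset.card_le_card
          intro p hp
          simp only [Finset.mem_filter, Finset.mem_range, Finset.mem_union, Finset.mem_Icc,
            Finset.mem_Ioc] at hp ⊢
          have := hp.2.one_le
          by_cases h : p ≤ 2 ^ M
          · exact Or.inl ⟨this, h⟩
          · exact Or.inr ⟨by omega, hp.2⟩
      _ ≤ _ := by
          refine (Finset.card_union_le _ _).trans ?_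
          simp
  have h3' : (Nat.primeCounting (2 ^ R) : ℝ) ≤
      2 ^ M + ((Finset.Ioc (2 ^ M) (2 ^ R)).filter Nat.Prime).card := by exact_mod_cast h3
  linarith

lemma exists_residues_card_survivors_le (P S : Finset ℕ) (hP : ∀ p ∈ P, p.Prime) :
    ∃ a : ℕ → ℕ, ((S.filter fun n => ∀ p ∈ P, ¬ n ≡ a p [MOD p]).card : ℝ) ≤
      S.card * ∏ p ∈ P, (1 - (p : ℝ)⁻¹) := by
  induction P using Finset.induction_on with
  | empty => exact ⟨0, by simp⟩
  | insert p P hpP ih =>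
    obtain ⟨a, ha⟩ := ih fun q hq => hP q (Finset.mem_insert_of_mem hq)
    have hp : p.Prime := hP p (Finset.mem_insert_self _ _)
    set S' := S.filter fun n => ∀ q ∈ P, ¬ n ≡ a q [MOD q] with hS'
    have hp0 : (0 : ℝ) < p := by exact_mod_cast hp.pos
    obtain ⟨r, -, hr⟩ : ∃ r ∈ Finset.range p,
        (S'.card : ℝ) / p ≤ ((S'.filter fun n => n % p = r).card : ℝ) := by
      apply Finset.exists_le_card_fiber_of_nsmul_le_card_of_maps_to
      · intro n _
        exact Finset.mem_range.2 (Nat.mod_lt _ hp.pos)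
      · exact ⟨0, Finset.mem_range.2 hp.pos⟩
      · rw [Finset.card_range, nsmul_eq_mul]
        exact (mul_div_cancel₀ _ hp0.ne').le
    refine ⟨Function.update a p r, ?_⟩
    have hsub : (S.filter fun n => ∀ q ∈ insert p P, ¬ n ≡ Function.update a p r q [MOD q]) ⊆
        S'.filter fun n => ¬ n % p = r := by
      intro n hn
      simp only [Finset.mem_filter, hS'] at hn ⊢
      refine ⟨⟨hn.1, fun q hq => ?_⟩, fun h => ?_⟩
      · have := hn.2 q (Finset.mem_insert_of_mem hq)
        rwa [Function.update_of_ne (by rintro rfl; exact hpP hq)] at this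
      · have := hn.2 p (Finset.mem_insert_self _ _)
        rw [Function.update_self] at this
        exact this (h ▸ (Nat.mod_modEq n p).symm)
    have hc : ((S'.filter fun n => n % p = r).card : ℝ) + (S'.filter fun n => ¬ n % p = r).card
        = S'.card := by
      exact_mod_cast Finset.card_filter_add_card_filter_not (s := S') (fun n => n % p = r)
    rw [Finset.prod_insert hpP]
    have h1 : (1 : ℝ) ≤ p := by exact_mod_cast hp.one_le
    have h2 : 0 ≤ 1 - (p : ℝ)⁻¹ := by linarith [inv_le_one_of_one_le₀ h1]
    calc _ ≤ ((S'.filter fun n => ¬ n % p = r).card : ℝ) := by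
          exact_mod_cast Finset.card_le_card hsub
      _ ≤ S'.card * (1 - (p : ℝ)⁻¹) := by
          rw [mul_sub, mul_one, ← div_eq_mul_inv]; linarith
      _ ≤ (S.card * ∏ p ∈ P, (1 - (p : ℝ)⁻¹)) * (1 - (p : ℝ)⁻¹) := by gcongr
      _ = _ := by ring

lemma exists_residues_of_card_le (P S : Finset ℕ) (h : S.card ≤ P.card) :
    ∃ a : ℕ → ℕ, ∀ n ∈ S, ∃ p ∈ P, n ≡ a p [MOD p] := by
  obtain ⟨P', hP', hc⟩ := Finset.exists_subset_card_eq h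
  let e := Finset.equivOfCardEq hc
  refine ⟨fun p => if hp : p ∈ P' then e ⟨p, hp⟩ else 0, fun n hn => ?_⟩
  refine ⟨e.symm ⟨n, hn⟩, hP' (e.symm ⟨n, hn⟩).2, ?_⟩
  simp [Nat.ModEq]

lemma prod_one_sub_inv_primesBelow_le (L : ℕ) (hL : 1 ≤ L) :
    ∏ p ∈ (2 ^ L + 1).primesBelow, (1 - ((p : ℕ) : ℝ)⁻¹) ≤ 2 / L := by
  let f : ℕ →* ℝ :=
    { toFun := fun n => (n : ℝ)⁻¹
      map_one' := by simp
      map_mul' := fun m n => by simp [mul_comm] }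
  have hf : ∀ {p : ℕ}, p.Prime → ‖f p‖ < 1 := by
    intro p hp
    change ‖(p : ℝ)⁻¹‖ < 1
    rw [norm_inv, Real.norm_natCast]
    exact inv_lt_one_of_one_lt₀ (by exact_mod_cast hp.one_lt)
  obtain ⟨-, hs⟩ := EulerProduct.summable_and_hasSum_smoothNumbers_prod_primesBelow_geometric hf
    (2 ^ L + 1)
  set s : Finset (2 ^ L + 1).smoothNumbers :=
    (Finset.Icc 1 (2 ^ L)).attach.image fun n => ⟨n.1, by
      have := Finset.mem_Icc.1 n.2
      exact Nat.mem_smoothNumbers_of_lt (by omega) (by omega)⟩ with hsdef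
  have h1 := sum_le_hasSum s (fun m _ => by change 0 ≤ ((m : ℕ) : ℝ)⁻¹; positivity) hs
  have h2 : ∑ m ∈ s, f m = ((harmonic (2 ^ L) : ℚ) : ℝ) := by
    rw [hsdef, Finset.sum_image]
    · rw [harmonic_eq_sum_Icc]
      push_cast
      exact Finset.sum_attach (Finset.Icc 1 (2 ^ L)) fun n : ℕ => (n : ℝ)⁻¹
    · intro a _ b _ hab
      exact Subtype.ext (by simpa using hab)
  have h3 := log_add_one_le_harmonic (2 ^ L)
  have h4 : (L : ℝ) / 2 ≤ Real.log ((2 ^ L : ℕ) + 1) := by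
    calc (L : ℝ) / 2 ≤ L * Real.log 2 := by
          have := Real.log_two_gt_d9
          nlinarith [Nat.cast_nonneg (α := ℝ) L]
      _ = Real.log (2 ^ L) := by rw [Real.log_pow]
      _ ≤ _ := by
          apply Real.log_le_log (by positivity)
          push_cast
          linarith
  have hL' : (0 : ℝ) < L := by exact_mod_cast hL
  have h5 : (L : ℝ) / 2 ≤ (∏ p ∈ (2 ^ L + 1).primesBelow, (1 - ((p : ℕ) : ℝ)⁻¹))⁻¹ := by
    rw [← Finset.prod_inv_distrib]
    calc _ ≤ ∑ m ∈ s, f m := by rw [h2]; push_cast at h3 h4; linarith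
      _ ≤ _ := h1
  have := inv_anti₀ (by positivity) h5
  rwa [inv_inv, inv_div] at this

lemma prod_one_sub_inv_not_dvd_le (l L : ℕ) (hl : 1 ≤ l) (hL : 1 ≤ L) :
    ∏ p ∈ (2 ^ L + 1).primesBelow.filter (fun p : ℕ => ¬ p ∣ l), (1 - ((p : ℕ) : ℝ)⁻¹) ≤
      2 ^ l * (2 / L) := by
  have h := prod_one_sub_inv_primesBelow_le L hL
  rw [← Finset.prod_filter_mul_prod_filter_not _ (fun p : ℕ => p ∣ l)] at h
  set D := (2 ^ L + 1).primesBelow.filter (fun p : ℕ => p ∣ l)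
  have hfac : ∀ p : ℕ, p ∈ (2 ^ L + 1).primesBelow → (1 / 2 : ℝ) ≤ 1 - (p : ℝ)⁻¹ := by
    intro p hp
    have : (2 : ℝ) ≤ p := by exact_mod_cast (Nat.prime_of_mem_primesBelow hp).two_le
    have := inv_anti₀ (by norm_num) this
    linarith
  have hD : D.card ≤ l := by
    calc D.card ≤ (Finset.Icc 1 l).card := by
          apply Finset.card_le_card
          intro p hp
          rw [Finset.mem_filter] at hp
          exact Finset.mem_Icc.2 ⟨(Nat.prime_of_mem_primesBelow hp.1).one_le,
            Nat.le_of_dvd hl hp.2⟩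
      _ = l := by simp
  have h1 : (1 / 2 : ℝ) ^ l ≤ ∏ p ∈ D, (1 - ((p : ℕ) : ℝ)⁻¹) := by
    calc (1 / 2 : ℝ) ^ l ≤ (1 / 2) ^ D.card := pow_le_pow_of_le_one (by norm_num) (by norm_num) hD
      _ = ∏ p ∈ D, (1 / 2 : ℝ) := by simp
      _ ≤ _ := Finset.prod_le_prod (fun _ _ => by norm_num)
          fun p hp => hfac p (Finset.mem_filter.1 hp).1
  set E := ∏ p ∈ (2 ^ L + 1).primesBelow.filter (fun p : ℕ => ¬ p ∣ l), (1 - ((p : ℕ) : ℝ)⁻¹)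
  have hE : 0 ≤ E := Finset.prod_nonneg fun p hp => by
    linarith [hfac p (Finset.mem_filter.1 hp).1]
  have h2 : (1 / 2 : ℝ) ^ l * E ≤ 2 / L := (mul_le_mul_of_nonneg_right h1 hE).trans h
  calc E = 2 ^ l * ((1 / 2 : ℝ) ^ l * E) := by
        rw [← mul_assoc, ← mul_pow]; norm_num
    _ ≤ _ := by gcongr

lemma card_multiples_le (U q : ℕ) :
    (((Finset.Icc 1 U).filter fun n => q ∣ n).card : ℝ) ≤ U / q := by
  have : ((Finset.Icc 1 U).filter fun n => q ∣ n).card = U / q := by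
    rw [← Nat.Ioc_filter_dvd_card_eq_div]; rfl
  rw [this]
  exact Nat.cast_div_le

lemma card_le_of_forall_large_prime_factor {U M V : ℕ} (hM : 1 ≤ M) (hU : U ≤ 2 ^ V)
    {S : Finset ℕ} (hSU : S ⊆ Finset.Icc 1 U)
    (hS : ∀ n ∈ S, ∃ q, q.Prime ∧ 2 ^ M < q ∧ q ∣ n) :
    (S.card : ℝ) ≤ (V - M : ℕ) * (4 * U / M) := by
  have hM' : (0 : ℝ) < M := by exact_mod_cast hM
  have hsub : S ⊆ (Finset.Ico M V).biUnion fun i => (dyadicPrimes i).biUnion fun q =>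
        (Finset.Icc 1 U).filter fun n => q ∣ n := by
    intro n hn
    obtain ⟨h1, h2⟩ := Finset.mem_Icc.1 (hSU hn)
    obtain ⟨q, hq, hMq, hqn⟩ := hS n hn
    have hqU : q ≤ U := (Nat.le_of_dvd h1 hqn).trans h2
    obtain ⟨i, hi, hqi⟩ := exists_dyadicPrimes_of_lt hq hMq (hqU.trans hU)
    simp only [Finset.mem_biUnion, Finset.mem_filter, Finset.mem_Icc]
    exact ⟨i, hi, q, hqi, ⟨h1, h2⟩, hqn⟩
  have hblock : ∀ i ∈ Finset.Ico M V, (((dyadicPrimes i).biUnion fun q =>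
        (Finset.Icc 1 U).filter fun n => q ∣ n).card : ℝ) ≤ 4 * U / M := by
    intro i hi
    have hMi : (M : ℝ) ≤ i := by exact_mod_cast (Finset.mem_Ico.1 hi).1
    have hc : ((dyadicPrimes i).card : ℝ) * i ≤ 4 * 2 ^ i := by
      exact_mod_cast card_dyadicPrimes_mul_le i
    calc _ ≤ ∑ q ∈ dyadicPrimes i, (((Finset.Icc 1 U).filter fun n => q ∣ n).card : ℝ) := by
          exact_mod_cast Finset.card_biUnion_le
      _ ≤ ∑ q ∈ dyadicPrimes i, (U : ℝ) / 2 ^ i := by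
          apply Finset.sum_le_sum
          intro q hq
          refine (card_multiples_le U q).trans ?_
          have : (2 : ℝ) ^ i ≤ q := by
            have := (Finset.mem_Ioc.1 (Finset.mem_filter.1 hq).1).1.le
            exact_mod_cast this
          gcongr
      _ = (dyadicPrimes i).card * (U / 2 ^ i) := by simp
      _ ≤ 4 * U / M := by
          rw [mul_div_assoc', div_le_div_iff₀ (by positivity) hM']
          calc _ = ((dyadicPrimes i).card * M : ℝ) * U := by ring
            _ ≤ ((dyadicPrimes i).card * i : ℝ) * U := by gcongr
            _ ≤ (4 * 2 ^ i) * U := by gcongr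
            _ = _ := by ring
  calc _ ≤ (((Finset.Ico M V).biUnion fun i => (dyadicPrimes i).biUnion fun q =>
        (Finset.Icc 1 U).filter fun n => q ∣ n).card : ℝ) := by
        exact_mod_cast Finset.card_le_card hsub
    _ ≤ ∑ i ∈ Finset.Ico M V, (((dyadicPrimes i).biUnion fun q =>
        (Finset.Icc 1 U).filter fun n => q ∣ n).card : ℝ) := by
        exact_mod_cast Finset.card_biUnion_le
    _ ≤ ∑ i ∈ Finset.Ico M V, (4 * U / M : ℝ) := Finset.sum_le_sum hblock
    _ = _ := by simp

lemma pairwise_disjoint_dyadicPrimes : Pairwise (Function.onFun Disjoint dyadicPrimes) := by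
  refine (pairwise_disjoint_on dyadicPrimes).2 fun i j hij => Finset.disjoint_left.2 ?_
  intro p hpi hpj
  have h1 := (Finset.mem_Ioc.1 (Finset.mem_filter.1 hpi).1).2
  have h2 := (Finset.mem_Ioc.1 (Finset.mem_filter.1 hpj).1).1
  have h3 : 2 ^ (i + 1) ≤ 2 ^ j := Nat.pow_le_pow_right (by norm_num) hij
  omega

lemma card_smooth_le_rpow_mul_prod {X Y : ℕ} {σ : ℝ} (hσ : 0 < σ) {S : Finset ℕ}
    (hSX : S ⊆ Finset.Icc 1 X) (hS : ∀ n ∈ S, n ∈ Y.smoothNumbers) :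
    (S.card : ℝ) ≤ (X : ℝ) ^ σ * ∏ p ∈ Y.primesBelow, (1 - ((p : ℕ) : ℝ) ^ (-σ))⁻¹ := by
  let f : ℕ →* ℝ :=
    { toFun := fun n => (n : ℝ) ^ (-σ)
      map_one' := by simp
      map_mul' := fun m n => by
        push_cast
        exact Real.mul_rpow (Nat.cast_nonneg _) (Nat.cast_nonneg _) }
  have hf : ∀ {p : ℕ}, p.Prime → ‖f p‖ < 1 := by
    intro p hp
    change ‖(p : ℝ) ^ (-σ)‖ < 1
    rw [Real.norm_of_nonneg (by positivity)]
    exact Real.rpow_lt_one_of_one_lt_of_neg (by exact_mod_cast hp.one_lt) (by linarith)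
  obtain ⟨-, hs⟩ := EulerProduct.summable_and_hasSum_smoothNumbers_prod_primesBelow_geometric hf Y
  set s : Finset Y.smoothNumbers := S.attach.image fun n => ⟨n.1, hS _ n.2⟩ with hsdef
  have h1 := sum_le_hasSum s (fun m _ => by
    change 0 ≤ ((m : ℕ) : ℝ) ^ (-σ); positivity) hs
  have h2 : ∑ m ∈ s, f m = ∑ n ∈ S, (n : ℝ) ^ (-σ) := by
    rw [hsdef, Finset.sum_image]
    · exact Finset.sum_attach S fun n : ℕ => (n : ℝ) ^ (-σ)
    · intro a _ b _ hab
      exact Subtype.ext (by simpa using hab)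
  rw [h2] at h1
  calc (S.card : ℝ) = ∑ n ∈ S, (1 : ℝ) := by simp
    _ ≤ ∑ n ∈ S, (X : ℝ) ^ σ * (n : ℝ) ^ (-σ) := by
        apply Finset.sum_le_sum
        intro n hn
        obtain ⟨hn1, hnX⟩ := Finset.mem_Icc.1 (hSX hn)
        have hn0 : (0 : ℝ) < n := by exact_mod_cast hn1
        have hnX' : (n : ℝ) ≤ X := by exact_mod_cast hnX
        rw [Real.rpow_neg hn0.le, ← div_eq_mul_inv, le_div_iff₀ (by positivity), one_mul]
        exact Real.rpow_le_rpow hn0.le hnX' hσ.le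
    _ = (X : ℝ) ^ σ * ∑ n ∈ S, (n : ℝ) ^ (-σ) := by rw [Finset.mul_sum]
    _ ≤ _ := by
        gcongr
        exact h1

lemma sum_dyadicPrimes_rpow_le {L i : ℕ} {η : ℝ} (hη : 0 ≤ η) (hη1 : η ≤ 1) (hi : 1 ≤ i)
    (hiL : i ≤ L) :
    ∑ p ∈ dyadicPrimes i, ((p : ℕ) : ℝ) ^ (-(1 - η)) ≤ 4 * (i : ℝ)⁻¹ + 4 * 2 ^ (η * L) / L := by
  have hi0 : (0 : ℝ) < i := by exact_mod_cast hi
  have hL0 : (0 : ℝ) < L := by exact_mod_cast hi.trans hiL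
  have hiL' : (i : ℝ) ≤ L := by exact_mod_cast hiL
  have hc : ((dyadicPrimes i).card : ℝ) * i ≤ 4 * 2 ^ i := by
    exact_mod_cast card_dyadicPrimes_mul_le i
  have hconv : (2 : ℝ) ^ (η * i) ≤ 1 + i / L * 2 ^ (η * L) := by
    have hw : (1 : ℝ) ≤ 2 ^ (η * L) := Real.one_le_rpow (by norm_num) (by positivity)
    have := rpow_one_add_le_one_add_mul_self (s := 2 ^ (η * L) - 1) (by linarith)
      (p := i / L) (by positivity) ((div_le_one hL0).2 hiL')
    rw [add_sub_cancel, ← Real.rpow_mul (by norm_num), mul_assoc, mul_div_cancel₀ _ hL0.ne'] at this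
    have h3 : (0 : ℝ) ≤ i / L := by positivity
    nlinarith
  have hterm : ∀ p ∈ dyadicPrimes i,
      ((p : ℕ) : ℝ) ^ (-(1 - η)) ≤ (2 ^ i)⁻¹ * 2 ^ (η * i) := by
    intro p hp
    have hp1 : (2 : ℝ) ^ i ≤ p := by
      have := (Finset.mem_Ioc.1 (Finset.mem_filter.1 hp).1).1.le
      exact_mod_cast this
    calc (p : ℝ) ^ (-(1 - η)) ≤ ((2 : ℝ) ^ i) ^ (-(1 - η)) :=
          Real.rpow_le_rpow_of_nonpos (by positivity) hp1 (by linarith)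
      _ = _ := by
          rw [← Real.rpow_natCast, ← Real.rpow_mul (by norm_num), ← Real.rpow_neg (by norm_num),
            ← Real.rpow_add (by norm_num)]
          congr 1
          ring
  calc _ ≤ ∑ p ∈ dyadicPrimes i, ((2 : ℝ) ^ i)⁻¹ * 2 ^ (η * i) := Finset.sum_le_sum hterm
    _ = (dyadicPrimes i).card * i * ((2 ^ i)⁻¹ * 2 ^ (η * i) / i) := by
        rw [Finset.sum_const, nsmul_eq_mul]
        field_simp
    _ ≤ (4 * 2 ^ i) * ((2 ^ i)⁻¹ * (1 + i / L * 2 ^ (η * L)) / i) := by gcongr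
    _ = _ := by field_simp

lemma sum_primesBelow_rpow_le {L : ℕ} {η : ℝ} (hη : 0 ≤ η) (hη1 : η ≤ 1) (hL : 1 ≤ L) :
    ∑ p ∈ (2 ^ L + 1).primesBelow, ((p : ℕ) : ℝ) ^ (-(1 - η)) ≤
      5 + 4 * Real.log L + 4 * 2 ^ (η * L) := by
  have hsub : (2 ^ L + 1).primesBelow ⊆ (Finset.range L).biUnion dyadicPrimes := by
    intro p hp
    have hpp := Nat.prime_of_mem_primesBelow hp
    have hlt := Nat.lt_of_mem_primesBelow hp
    obtain ⟨i, hi, hpi⟩ := exists_dyadicPrimes_of_lt (M := 0) (V := L) hpp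
      (by simpa using hpp.one_lt) (by omega)
    exact Finset.mem_biUnion.2 ⟨i, Finset.mem_range.2 (Finset.mem_Ico.1 hi).2, hpi⟩
  have h0 : ∑ p ∈ dyadicPrimes 0, ((p : ℕ) : ℝ) ^ (-(1 - η)) ≤ 1 := by
    calc _ ≤ ∑ p ∈ dyadicPrimes 0, (1 : ℝ) := by
          apply Finset.sum_le_sum
          intro p hp
          have : 1 ≤ p := (Finset.mem_filter.1 hp).2.one_le
          exact Real.rpow_le_one_of_one_le_of_nonpos (by exact_mod_cast this) (by linarith)
      _ ≤ 1 := by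
          have : (dyadicPrimes 0).card ≤ 1 := (Finset.card_filter_le _ _).trans (by simp)
          simpa using this
  obtain ⟨K, rfl⟩ : ∃ K, L = K + 1 := ⟨L - 1, by omega⟩
  have hK0 : (0 : ℝ) < (K + 1 : ℕ) := by positivity
  have hharm : ∑ i ∈ Finset.range K, ((i + 1 : ℕ) : ℝ)⁻¹ ≤ 1 + Real.log (K + 1 : ℕ) := by
    have h1 := harmonic_le_one_add_log K
    have h2 : Real.log K ≤ Real.log (K + 1 : ℕ) := by
      rcases Nat.eq_zero_or_pos K with rfl | hK
      · simp
      · exact Real.log_le_log (by exact_mod_cast hK) (by push_cast; linarith)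
    unfold harmonic at h1
    push_cast at h1 h2 ⊢
    linarith
  calc _ ≤ ∑ p ∈ (Finset.range (K + 1)).biUnion dyadicPrimes, ((p : ℕ) : ℝ) ^ (-(1 - η)) :=
        Finset.sum_le_sum_of_subset_of_nonneg hsub fun _ _ _ => by positivity
    _ = ∑ i ∈ Finset.range (K + 1), ∑ p ∈ dyadicPrimes i, ((p : ℕ) : ℝ) ^ (-(1 - η)) :=
        Finset.sum_biUnion (pairwise_disjoint_dyadicPrimes.set_pairwise _)
    _ = ∑ i ∈ Finset.range K, ∑ p ∈ dyadicPrimes (i + 1), ((p : ℕ) : ℝ) ^ (-(1 - η)) +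
        ∑ p ∈ dyadicPrimes 0, ((p : ℕ) : ℝ) ^ (-(1 - η)) := Finset.sum_range_succ' _ _
    _ ≤ ∑ i ∈ Finset.range K, (4 * ((i + 1 : ℕ) : ℝ)⁻¹ +
        4 * 2 ^ (η * (K + 1 : ℕ)) / (K + 1 : ℕ)) + 1 := by
        refine add_le_add (Finset.sum_le_sum fun i hi => ?_) h0
        have := Finset.mem_range.1 hi
        exact sum_dyadicPrimes_rpow_le hη hη1 (by omega) (by omega)
    _ = 4 * ∑ i ∈ Finset.range K, ((i + 1 : ℕ) : ℝ)⁻¹ +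
        K / (K + 1 : ℕ) * (4 * 2 ^ (η * (K + 1 : ℕ))) + 1 := by
        rw [Finset.sum_add_distrib, Finset.mul_sum, Finset.sum_const, Finset.card_range,
          nsmul_eq_mul]
        ring
    _ ≤ 4 * (1 + Real.log (K + 1 : ℕ)) + 1 * (4 * 2 ^ (η * (K + 1 : ℕ))) + 1 := by
        gcongr
        rw [div_le_one hK0]
        push_cast
        linarith
    _ = _ := by ring

lemma prod_primesBelow_inv_one_sub_rpow_le {L : ℕ} {η : ℝ} (hη : 0 ≤ η) (hη1 : η ≤ 1 / 4)
    (hL : 1 ≤ L) :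
    ∏ p ∈ (2 ^ L + 1).primesBelow, (1 - ((p : ℕ) : ℝ) ^ (-(1 - η)))⁻¹ ≤
      Real.exp (15 + 12 * Real.log L + 12 * 2 ^ (η * L)) := by
  have hterm : ∀ p : ℕ, p ∈ (2 ^ L + 1).primesBelow →
      0 ≤ (1 - (p : ℝ) ^ (-(1 - η)))⁻¹ ∧
      (1 - (p : ℝ) ^ (-(1 - η)))⁻¹ ≤ Real.exp (3 * (p : ℝ) ^ (-(1 - η))) := by
    intro p hp
    have hp2 : (2 : ℝ) ≤ p := by exact_mod_cast (Nat.prime_of_mem_primesBelow hp).two_le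
    have ht0 : 0 ≤ (p : ℝ) ^ (-(1 - η)) := by positivity
    have ht : (p : ℝ) ^ (-(1 - η)) ≤ 3 / 5 := by
      calc (p : ℝ) ^ (-(1 - η)) ≤ 2 ^ (-(1 - η)) :=
            Real.rpow_le_rpow_of_nonpos (by norm_num) hp2 (by linarith)
        _ ≤ 2 ^ (-(3 / 4) : ℝ) := Real.rpow_le_rpow_of_exponent_le (by norm_num) (by linarith)
        _ ≤ 3 / 5 := by
            refine le_of_pow_le_pow_left₀ (n := 4) (by norm_num) (by norm_num) ?_
            rw [← Real.rpow_natCast, ← Real.rpow_mul (by norm_num)]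
            norm_num
    set t := (p : ℝ) ^ (-(1 - η))
    refine ⟨inv_nonneg.2 (by linarith), ?_⟩
    calc (1 - t)⁻¹ ≤ 3 * t + 1 := by
          rw [inv_le_iff_one_le_mul₀ (by linarith)]
          nlinarith
      _ ≤ _ := Real.add_one_le_exp _
  calc _ ≤ ∏ p ∈ (2 ^ L + 1).primesBelow, Real.exp (3 * ((p : ℕ) : ℝ) ^ (-(1 - η))) :=
        Finset.prod_le_prod (fun p hp => (hterm p hp).1) fun p hp => (hterm p hp).2
    _ = Real.exp (3 * ∑ p ∈ (2 ^ L + 1).primesBelow, ((p : ℕ) : ℝ) ^ (-(1 - η))) := by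
        rw [← Real.exp_sum, Finset.mul_sum]
    _ ≤ _ := by
        apply Real.exp_le_exp.2
        linarith [sum_primesBelow_rpow_le hη (by linarith) hL]

lemma mul_le_two_pow {c n : ℕ} (hc : c ≤ 512) (hn : 16 ≤ n) : c * n ≤ 2 ^ n := by
  induction n, hn using Nat.le_induction with
  | base => omega
  | succ n hn ih => rw [pow_succ]; nlinarith

lemma card_smooth_le_of_tower {s F T R : ℕ} (hs : 4 ≤ s) (hT : T = 2 ^ s) (hR : R = 2 ^ T)
    (hF : F + s + 6 = T) {S : Finset ℕ} (hSX : S ⊆ Finset.Icc 1 (2 ^ (R + T)))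
    (hS : ∀ n ∈ S, n ∈ (2 ^ (s * 2 ^ F) + 1).smoothNumbers) :
    (S.card : ℝ) ≤ 2 ^ R / R / 8 := by
  have hT16 : 16 ≤ T := by
    rw [hT]
    calc 16 = 2 ^ 4 := by norm_num
      _ ≤ 2 ^ s := Nat.pow_le_pow_right (by norm_num) hs
  have h256 : 256 * T ≤ R := hR ▸ mul_le_two_pow (by norm_num) hT16
  have hT' : (16 : ℝ) ≤ T := by exact_mod_cast hT16
  have hR' : (256 : ℝ) * T ≤ R := by exact_mod_cast h256
  have hR0 : (0 : ℝ) < R := by linarith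
  have hL1 : 1 ≤ s * 2 ^ F := Nat.mul_pos (by omega) (by positivity)
  have hsT : s ≤ 2 ^ s := Nat.lt_two_pow_self.le
  have hRF : (R : ℝ) = 2 ^ F * T * 64 := by
    have : R = 2 ^ F * T * 64 := by
      calc R = 2 ^ (F + s + 6) := by rw [hF, hR]
        _ = 2 ^ F * 2 ^ s * 64 := by ring
        _ = 2 ^ F * T * 64 := by rw [hT]
    exact_mod_cast this
  have hLR : s * 2 ^ F ≤ 2 ^ T := by
    calc s * 2 ^ F ≤ 2 ^ s * 2 ^ F := Nat.mul_le_mul_right _ hsT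
      _ = 2 ^ (F + s) := by ring
      _ ≤ 2 ^ T := Nat.pow_le_pow_right (by norm_num) (by omega)
  set η : ℝ := 64 * T / R with hη
  have hη0 : 0 ≤ η := by positivity
  have hη1 : η ≤ 1 / 4 := by
    rw [hη, div_le_iff₀ hR0]; linarith
  have hηR : η * R = 64 * T := div_mul_cancel₀ _ hR0.ne'
  have hlog : Real.log (s * 2 ^ F : ℕ) ≤ T := by
    calc Real.log (s * 2 ^ F : ℕ) ≤ Real.log ((2 ^ T : ℕ) : ℝ) :=
          Real.log_le_log (by exact_mod_cast hL1) (by exact_mod_cast hLR)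
      _ = T * Real.log 2 := by push_cast; rw [Real.log_pow]
      _ ≤ T * 1 := by
          gcongr
          linarith [Real.log_two_lt_d9]
      _ = T := mul_one _
  have hw : (2 : ℝ) ^ (η * (s * 2 ^ F : ℕ)) = T := by
    have : η * (s * 2 ^ F : ℕ) = s := by
      rw [hη, hRF]
      push_cast
      field_simp
    rw [this, Real.rpow_natCast, hT]
    push_cast
    rfl
  have h1 := card_smooth_le_rpow_mul_prod (σ := 1 - η) (by linarith) hSX hS
  have h2 := prod_primesBelow_inv_one_sub_rpow_le hη0 hη1 hL1
  rw [hw] at h2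
  have h3 : Real.exp (15 + 12 * Real.log (s * 2 ^ F : ℕ) + 12 * T) ≤ 2 ^ (30 + 48 * T : ℝ) := by
    rw [Real.rpow_def_of_pos (by norm_num)]
    apply Real.exp_le_exp.2
    nlinarith [Real.log_two_gt_d9]
  calc (S.card : ℝ) ≤ ((2 ^ (R + T) : ℕ) : ℝ) ^ (1 - η) * 2 ^ (30 + 48 * T : ℝ) :=
        h1.trans (by gcongr; exact h2.trans h3)
    _ = 2 ^ ((R + T : ℝ) * (1 - η) + (30 + 48 * T)) := by
        rw [Real.rpow_add (by norm_num) ((R + T : ℝ) * (1 - η)), Real.rpow_mul (by norm_num),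
          Nat.cast_pow, Nat.cast_ofNat, ← Real.rpow_natCast, Nat.cast_add]
    _ ≤ 2 ^ ((R : ℝ) - T - 3) := by
        apply Real.rpow_le_rpow_of_exponent_le (by norm_num)
        nlinarith
    _ = _ := by
        rw [Real.rpow_sub (by norm_num), Real.rpow_sub (by norm_num), Real.rpow_natCast,
          Real.rpow_natCast, hR]
        push_cast
        norm_num

lemma le_card_primes_Ioc_of_tower {T R M : ℕ} (hR : R = 2 ^ T) (hM : M + 2 * T = R)
    (hT : 16 ≤ T) :
    (2 : ℝ) ^ R / R * (3 / 4) ≤ ((Finset.Ioc (2 ^ M) (2 ^ R)).filter Nat.Prime).card := by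
  have hRT : 512 * T ≤ R := hR ▸ mul_le_two_pow le_rfl hT
  have h1 := le_card_primes_Ioc M R (by omega)
  have hRpow : (R : ℝ) = 2 ^ T := by rw [hR]; push_cast; rfl
  have h3 : (2 : ℝ) ^ M ≤ 2 ^ R / R / 8 := by
    rw [div_div, hRpow, le_div_iff₀ (by positivity)]
    calc (2 : ℝ) ^ M * (2 ^ T * 8) = 2 ^ (M + T + 3) := by ring
      _ ≤ 2 ^ R := pow_le_pow_right₀ (by norm_num) (by omega)
  have h4 : (2 : ℝ) ≤ 2 ^ R / R / 8 := by
    rw [div_div, hRpow, le_div_iff₀ (by positivity)]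
    calc (2 : ℝ) * (2 ^ T * 8) = 2 ^ (T + 4) := by ring
      _ ≤ 2 ^ R := pow_le_pow_right₀ (by norm_num) (by omega)
  linarith

/-- The Erdős–Rankin covering: with `R = 2 ^ T` and `T = 2 ^ s`, residue classes to the primes up
to `2 ^ R` not dividing `l` cover an interval of length `s * 2 ^ E`, where `2 ^ E` is a constant
multiple of `2 ^ R * R / T ^ 2`. -/
lemma exists_covering_residues {l s T R E : ℕ} (hl : 1 ≤ l) (hs : l + 16 ≤ s) (hT : T = 2 ^ s)
    (hR : R = 2 ^ T) (hE : E + 2 * s + (l + 15) = R + T) :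
    ∃ a : ℕ → ℕ, ∀ n ∈ Finset.Icc 1 (s * 2 ^ E),
      ∃ p ∈ (Finset.Icc 1 (2 ^ R)).filter (fun p => p.Prime ∧ ¬ p ∣ l), n ≡ a p [MOD p] := by
  classical
  have hTs : 16 * s ≤ T := hT ▸ mul_le_two_pow (by norm_num) (by omega)
  have hRT : 512 * T ≤ R := hR ▸ mul_le_two_pow (by norm_num) (by omega)
  obtain ⟨F, hF⟩ : ∃ F, F + s + 6 = T := ⟨T - s - 6, by omega⟩
  obtain ⟨M, hM⟩ : ∃ M, M + 2 * T = R := ⟨R - 2 * T, by omega⟩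
  set L := s * 2 ^ F with hL
  set U := s * 2 ^ E with hU
  have hsT : s ≤ 2 ^ s := Nat.lt_two_pow_self.le
  have hF1 : 1 ≤ 2 ^ F := Nat.one_le_two_pow
  have hL1 : 1 ≤ L := Nat.mul_pos (by omega) (by positivity)
  have hlL : l < 2 ^ L := by
    calc l ≤ L := by nlinarith
      _ < 2 ^ L := Nat.lt_two_pow_self
  have hLM : L ≤ M := by
    have h1 : L * 64 ≤ R := by
      calc L * 64 ≤ 2 ^ s * 2 ^ F * 64 := by rw [hL]; gcongr
        _ = 2 ^ (F + s + 6) := by ring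
        _ = R := by rw [hF, hR]
    omega
  have hLM2 : 2 ^ L ≤ 2 ^ M := Nat.pow_le_pow_right (by norm_num) hLM
  have hMR2 : 2 ^ M ≤ 2 ^ R := Nat.pow_le_pow_right (by norm_num) (by omega)
  have hUV : U ≤ 2 ^ (R + T) := by
    calc U ≤ 2 ^ s * 2 ^ E := Nat.mul_le_mul_right _ hsT
      _ = 2 ^ (s + E) := by ring
      _ ≤ _ := Nat.pow_le_pow_right (by norm_num) (by omega)
  set S₁ := (Finset.Icc 1 U).filter fun n => n ∈ (2 ^ L + 1).smoothNumbers with hS₁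
  set S₂ := (Finset.Icc 1 U).filter fun n => ∃ q, q.Prime ∧ 2 ^ M < q ∧ q ∣ n with hS₂
  set Q := (2 ^ L + 1).primesBelow.filter (fun p : ℕ => ¬ p ∣ l) with hQ
  obtain ⟨a₁, ha₁⟩ := exists_residues_card_survivors_le Q S₂ fun p hp =>
    Nat.prime_of_mem_primesBelow (Finset.mem_filter.1 hp).1
  set S₃ := S₂.filter fun n => ∀ p ∈ Q, ¬ n ≡ a₁ p [MOD p] with hS₃
  have hR0 : (0 : ℝ) < R := by exact_mod_cast (by omega : 0 < R)
  have hM0 : (0 : ℝ) < M := by exact_mod_cast (by omega : 0 < M)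
  have hT0 : (0 : ℝ) < T := by exact_mod_cast (by omega : 0 < T)
  have hs0 : (0 : ℝ) < s := by exact_mod_cast (by omega : 0 < s)
  have hc₁ : (S₁.card : ℝ) ≤ 2 ^ R / R / 8 :=
    card_smooth_le_of_tower (by omega) hT hR hF
      ((Finset.filter_subset _ _).trans (Finset.Icc_subset_Icc_right hUV))
      fun n hn => (Finset.mem_filter.1 hn).2
  have hc₂ : (S₂.card : ℝ) ≤ (R + T - M : ℕ) * (4 * U / M) :=
    card_le_of_forall_large_prime_factor (by omega) hUV (Finset.filter_subset _ _)
      fun n hn => (Finset.mem_filter.1 hn).2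
  have hc₃ : (S₃.card : ℝ) ≤ 2 ^ R / R / 8 := by
    have hMR : (R : ℝ) / 2 ≤ M := by
      have : R ≤ 2 * M := by omega
      have : (R : ℝ) ≤ 2 * M := by exact_mod_cast this
      linarith
    have hpow : (2 : ℝ) ^ R * 2 ^ F = 2 ^ E * 2 ^ s * 2 ^ l * 512 := by
      have h : R + F = E + s + l + 9 := by omega
      rw [← pow_add, h]
      ring
    have hprod : (0 : ℝ) ≤ ∏ p ∈ Q, (1 - ((p : ℕ) : ℝ)⁻¹) := Finset.prod_nonneg fun p hp => by
      have h1 : (1 : ℝ) ≤ p := by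
        exact_mod_cast (Nat.prime_of_mem_primesBelow (Finset.mem_filter.1 hp).1).one_le
      linarith [inv_le_one_of_one_le₀ h1]
    have h3T : R + T - M = 3 * T := by omega
    rw [h3T] at hc₂
    calc (S₃.card : ℝ) ≤ S₂.card * ∏ p ∈ Q, (1 - ((p : ℕ) : ℝ)⁻¹) := ha₁
      _ ≤ ((3 * T : ℕ) * (4 * U / (R / 2))) * (2 ^ l * (2 / L)) := by
          refine mul_le_mul (hc₂.trans ?_) (prod_one_sub_inv_not_dvd_le l L hl hL1) hprod
            (by positivity)
          gcongr
      _ = 48 * (2 ^ E * 2 ^ s * 2 ^ l) / (R * 2 ^ F) := by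
          rw [hU, hL]
          push_cast
          rw [show (T : ℝ) = 2 ^ s by rw [hT]; push_cast; rfl]
          field_simp
          ring
      _ ≤ _ := by
          rw [div_div, div_le_div_iff₀ (by positivity) (by positivity)]
          have : (0 : ℝ) ≤ 2 ^ E * 2 ^ s * 2 ^ l := by positivity
          calc _ = 384 * (2 ^ E * 2 ^ s * 2 ^ l) * (R : ℝ) := by ring
            _ ≤ 512 * (2 ^ E * 2 ^ s * 2 ^ l) * (R : ℝ) := by gcongr; norm_num
            _ = (2 ^ R * 2 ^ F) * R := by rw [hpow]; ring
            _ = _ := by ring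
  set P := (Finset.Ioc (2 ^ M) (2 ^ R)).filter Nat.Prime with hP
  have hcard : (S₁ ∪ S₃).card ≤ P.card := by
    have h1 := le_card_primes_Ioc_of_tower hR hM (by omega)
    have h2 : ((S₁ ∪ S₃).card : ℝ) ≤ S₁.card + S₃.card := by
      exact_mod_cast Finset.card_union_le _ _
    have h3 : (0 : ℝ) ≤ 2 ^ R / R := by positivity
    have : ((S₁ ∪ S₃).card : ℝ) ≤ P.card := by linarith
    exact_mod_cast this
  obtain ⟨a₂, ha₂⟩ := exists_residues_of_card_le P (S₁ ∪ S₃) hcard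
  let a : ℕ → ℕ := fun p => if p ≤ 2 ^ L then a₁ p else if p ≤ 2 ^ M then 0 else a₂ p
  have hlarge : ∀ n ∈ S₁ ∪ S₃, ∃ p ∈ (Finset.Icc 1 (2 ^ R)).filter
      (fun p => p.Prime ∧ ¬ p ∣ l), n ≡ a p [MOD p] := by
    intro n hn
    obtain ⟨p, hp, hnp⟩ := ha₂ n hn
    obtain ⟨hp1, hpp⟩ := Finset.mem_filter.1 hp
    obtain ⟨hpM, hpR⟩ := Finset.mem_Ioc.1 hp1
    refine ⟨p, Finset.mem_filter.2 ⟨Finset.mem_Icc.2 ⟨hpp.one_le, hpR⟩, hpp, fun h => ?_⟩, ?_⟩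
    · have := Nat.le_of_dvd hl h
      omega
    · simpa only [a, if_neg (show ¬ p ≤ 2 ^ L by omega), if_neg (show ¬ p ≤ 2 ^ M by omega)]
  refine ⟨a, fun n hn => ?_⟩
  by_cases hn₁ : n ∈ S₁
  · exact hlarge n (Finset.mem_union_left _ hn₁)
  have hsm : n ∉ (2 ^ L + 1).smoothNumbers := fun h => hn₁ (Finset.mem_filter.2 ⟨hn, h⟩)
  rw [Nat.mem_smoothNumbers'] at hsm
  push Not at hsm
  obtain ⟨p, hpp, hpn, hpL⟩ := hsm
  by_cases hpM : p ≤ 2 ^ M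
  · refine ⟨p, Finset.mem_filter.2 ⟨Finset.mem_Icc.2 ⟨hpp.one_le, by omega⟩, hpp, fun h => ?_⟩, ?_⟩
    · have := Nat.le_of_dvd hl h
      omega
    · simp only [a, if_neg (show ¬ p ≤ 2 ^ L by omega), if_pos hpM]
      exact (Nat.modEq_zero_iff_dvd).2 hpn
  have hn₂ : n ∈ S₂ := Finset.mem_filter.2 ⟨hn, p, hpp, by omega, hpn⟩
  by_cases hn₃ : n ∈ S₃
  · exact hlarge n (Finset.mem_union_right _ hn₃)
  · have : ∃ q ∈ Q, n ≡ a₁ q [MOD q] := by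
      by_contra! h
      exact hn₃ (Finset.mem_filter.2 ⟨hn₂, h⟩)
    obtain ⟨q, hq, hnq⟩ := this
    obtain ⟨hq1, hql⟩ := Finset.mem_filter.1 hq
    have hqL := Nat.lt_of_mem_primesBelow hq1
    have hqp := Nat.prime_of_mem_primesBelow hq1
    refine ⟨q, Finset.mem_filter.2 ⟨Finset.mem_Icc.2 ⟨hqp.one_le, by omega⟩, hqp, hql⟩, ?_⟩
    simpa only [a, if_pos (show q ≤ 2 ^ L by omega)]

/-- The Chinese remainder step: the block of `U` integers covered by `a` extends to the left to a
block preceded by an integer coprime to `∏ p ∈ P, p`, whose inverse determines `k`. -/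
lemma exists_modulus_of_covering {l U : ℕ} (hl : 1 ≤ l) {P : Finset ℕ}
    (hP : ∀ p ∈ P, p.Prime ∧ ¬ p ∣ l) {a : ℕ → ℕ}
    (ha : ∀ n ∈ Finset.Icc 1 U, ∃ p ∈ P, n ≡ a p [MOD p]) :
    ∃ k, Nat.gcd k l = 1 ∧ l * ∏ p ∈ P, p ≤ k ∧ k ≤ 2 * (l * ∏ p ∈ P, p) ∧
      ∀ n ∈ Finset.Icc 1 U, ¬ (k * n + l).Prime := by
  set Q := ∏ p ∈ P, p with hQ
  have hQ0 : 0 < Q := Finset.prod_pos fun p hp => (hP p hp).1.pos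
  have hQl : Nat.Coprime Q l :=
    Nat.Coprime.prod_left fun p hp => ((hP p hp).1.coprime_iff_not_dvd).2 (hP p hp).2
  have hdvdQ : ∀ p ∈ P, p ∣ Q := fun p hp => Finset.dvd_prod_of_mem _ hp
  obtain ⟨m₀, hm₀⟩ := Nat.chineseRemainderOfFinset (fun p => (p - 1) * a p) id P
    (fun p hp => (hP p hp).1.ne_zero)
    (fun p hp q hq hpq => (Nat.coprime_primes (hP p hp).1 (hP q hq).1).2 hpq)
  set m := m₀ + Q with hm
  have hcov : ∀ n ∈ Finset.Icc 1 U, ∃ p ∈ P, p ∣ m + n := by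
    intro n hn
    obtain ⟨p, hp, hnp⟩ := ha n hn
    refine ⟨p, hp, (Nat.modEq_zero_iff_dvd).1 ?_⟩
    have h1 : m ≡ (p - 1) * a p + 0 [MOD p] :=
      (hm₀ p hp).add ((Nat.modEq_zero_iff_dvd).2 (hdvdQ p hp))
    refine (h1.add hnp).trans ((Nat.modEq_zero_iff_dvd).2 ⟨a p, ?_⟩)
    have h2 : p = (p - 1) + 1 := by have := (hP p hp).1.pos; omega
    calc (p - 1) * a p + 0 + a p = ((p - 1) + 1) * a p := by ring
      _ = p * a p := by rw [← h2]
  set j := Nat.findGreatest (fun j => Nat.Coprime j Q) m with hj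
  have hjQ : Nat.Coprime j Q :=
    Nat.findGreatest_spec (P := fun j => Nat.Coprime j Q) (by omega : 1 ≤ m)
      (Nat.coprime_one_left Q)
  have hjm : j ≤ m := Nat.findGreatest_le m
  have hcov' : ∀ n ∈ Finset.Icc 1 U, ∃ p ∈ P, p ∣ j + n := by
    intro n hn
    obtain ⟨hn1, hnU⟩ := Finset.mem_Icc.1 hn
    by_cases hle : j + n ≤ m
    · have hnc : ¬ Nat.Coprime (j + n) Q :=
        Nat.findGreatest_is_greatest (P := fun j => Nat.Coprime j Q) (by omega) hle
      obtain ⟨q, hq, hqj, hqQ⟩ := Nat.Prime.not_coprime_iff_dvd.1 hnc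
      obtain ⟨p, hp, hqp⟩ := (Prime.dvd_finsetProd_iff hq.prime _).1 hqQ
      rw [(Nat.prime_dvd_prime_iff_eq hq (hP p hp).1).1 hqp] at hqj
      exact ⟨p, hp, hqj⟩
    · obtain ⟨p, hp, hd⟩ := hcov (j + n - m) (Finset.mem_Icc.2 ⟨by omega, by omega⟩)
      refine ⟨p, hp, ?_⟩
      rwa [show m + (j + n - m) = j + n by omega] at hd
  obtain ⟨x, -, hx⟩ := Nat.exists_mul_mod_eq_of_coprime l hjQ hQ0.ne'
  have hklt := Nat.chineseRemainder_lt_mul hQl x 1 hQ0.ne' (by omega)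
  obtain ⟨hk1, hk2⟩ := (Nat.chineseRemainder hQl x 1).2
  rw [mul_comm Q l] at hklt
  set k₀ : ℕ := (Nat.chineseRemainder hQl x 1 : ℕ)
  have hlQ : 0 < l * Q := Nat.mul_pos hl hQ0
  refine ⟨k₀ + l * Q, ?_, by omega, by omega, ?_⟩
  · have : k₀ + l * Q ≡ 1 + 0 [MOD l] := hk2.add ((Nat.modEq_zero_iff_dvd).2 ⟨Q, rfl⟩)
    rw [this.gcd_eq]
    simp
  · intro n hn hprime
    obtain ⟨p, hp, hd⟩ := hcov' n hn
    have hn1 := (Finset.mem_Icc.1 hn).1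
    have hkQ : k₀ + l * Q ≡ x + 0 [MOD Q] :=
      hk1.add ((Nat.modEq_zero_iff_dvd).2 (Dvd.intro_left l rfl))
    have hmod : (k₀ + l * Q) * n + l ≡ x * (j + n) [MOD Q] := by
      have h1 : (k₀ + l * Q) * n + l ≡ x * n + j * x [MOD Q] :=
        (hkQ.mul_right n).add (Nat.ModEq.symm hx)
      rwa [show x * n + j * x = x * (j + n) by ring] at h1
    have hdvd : p ∣ (k₀ + l * Q) * n + l :=
      ((hmod.of_dvd (hdvdQ p hp)).dvd_iff dvd_rfl).2 (dvd_mul_of_dvd_right hd x)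
    have heq := (Nat.prime_dvd_prime_iff_eq (hP p hp).1 hprime).1 hdvd
    have hpQ := Nat.le_of_dvd hQ0 (hdvdQ p hp)
    have h2 : l * Q ≤ (k₀ + l * Q) * n := by nlinarith
    have h3 : Q ≤ l * Q := Nat.le_mul_of_pos_left Q hl
    omega

lemma mul_le_leastPrimeAP {k l U : ℕ} (hk : k ≠ 0) (hkl : Nat.gcd k l = 1)
    (h : ∀ n ∈ Finset.Icc 1 U, ¬ (k * n + l).Prime) : k * U ≤ leastPrimeAP k l := by
  have hne : {p : ℕ | p.Prime ∧ ∃ n : ℕ, 1 ≤ n ∧ p = k * n + l}.Nonempty := by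
    obtain ⟨p, hpl, hp, hmod⟩ := Nat.forall_exists_prime_gt_and_modEq (k + l) hk
      (Nat.Coprime.symm hkl)
    obtain ⟨n, hn⟩ := (Nat.modEq_iff_dvd' (by omega)).1 hmod.symm
    refine ⟨p, hp, n, ?_, by omega⟩
    rcases Nat.eq_zero_or_pos n with rfl | h0
    · simp at hn
      omega
    · exact h0
  obtain ⟨hp, n, hn1, hpn⟩ := Nat.sInf_mem hne
  change leastPrimeAP k l = _ at hpn
  change (leastPrimeAP k l).Prime at hp
  have hnU : U < n := by
    by_contra! hle
    exact h n (Finset.mem_Icc.2 ⟨hn1, hle⟩) (hpn ▸ hp)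
  rw [hpn]
  nlinarith

lemma iterated_log_quotient_le {k : ℝ} {s T R : ℕ} (hs : 16 ≤ s) (hT : T = 2 ^ s)
    (hR : R = 2 ^ T) (hlow : (2 : ℝ) ^ (R - T - 2) ≤ Real.log k)
    (hup : Real.log k ≤ 2 ^ (R + 1)) :
    Real.log k * log2 k * log4 k / log3 k ^ 2 ≤ 32 * (2 ^ R * R * s) / T ^ 2 := by
  have hTs : 16 * s ≤ T := hT ▸ mul_le_two_pow (by norm_num) (by omega)
  have hRT : 512 * T ≤ R := hR ▸ mul_le_two_pow (by norm_num) (by omega)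
  have hs' : (16 : ℝ) ≤ s := by exact_mod_cast hs
  have hTs' : (16 : ℝ) * s ≤ T := by exact_mod_cast hTs
  have hRT' : (512 : ℝ) * T ≤ R := by exact_mod_cast hRT
  have hTpow : Real.log T = s * Real.log 2 := by
    rw [hT]; push_cast; rw [Real.log_pow]
  have hRpow : Real.log R = T * Real.log 2 := by
    rw [hR]; push_cast; rw [Real.log_pow]
  have hb1 := Real.log_two_gt_d9
  have hb2 := Real.log_two_lt_d9
  have hlog4 : Real.log 4 = 2 * Real.log 2 := by
    rw [show (4 : ℝ) = 2 ^ 2 by norm_num, Real.log_pow]; norm_num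
  have hk0 : 0 < Real.log k := lt_of_lt_of_le (by positivity) hlow
  have h2up : log2 k ≤ R := by
    calc log2 k ≤ Real.log (2 ^ (R + 1)) := Real.log_le_log hk0 hup
      _ = (R + 1) * Real.log 2 := by rw [Real.log_pow]; push_cast; rfl
      _ ≤ R := by nlinarith
  have h2low : (R : ℝ) / 4 ≤ log2 k := by
    calc (R : ℝ) / 4 ≤ (R - T - 2) * Real.log 2 := by nlinarith
      _ = Real.log (2 ^ (R - T - 2)) := by
          rw [Real.log_pow, Nat.cast_sub (by omega), Nat.cast_sub (by omega)]
          push_cast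
          rfl
      _ ≤ log2 k := Real.log_le_log (by positivity) hlow
  have h2pos : 0 < log2 k := by linarith
  have h3up : log3 k ≤ T := by
    calc log3 k ≤ Real.log R := Real.log_le_log h2pos h2up
      _ ≤ T := by rw [hRpow]; nlinarith
  have h3low : (T : ℝ) / 4 ≤ log3 k := by
    calc (T : ℝ) / 4 ≤ T * Real.log 2 - 2 * Real.log 2 := by nlinarith
      _ = Real.log (R / 4) := by rw [Real.log_div (by linarith) (by norm_num), hRpow, hlog4]
      _ ≤ log3 k := Real.log_le_log (by linarith) h2low
  have h3pos : 0 < log3 k := by linarith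
  have h4up : log4 k ≤ s := by
    calc log4 k ≤ Real.log T := Real.log_le_log h3pos h3up
      _ ≤ s := by rw [hTpow]; nlinarith
  calc _ ≤ 2 ^ (R + 1) * R * s / (T / 4 : ℝ) ^ 2 := by
        have hT0 : (0 : ℝ) < T := by linarith
        have h4pos : 0 ≤ log4 k := Real.log_nonneg (by linarith)
        gcongr
    _ = _ := by ring

/-- For every `l ≥ 1` there is an absolute constant `c > 0` such that there are infinitely
many `k ≥ l` with `gcd(k, l) = 1` for which
`p(k, l) ≥ c k (log k · log₂ k · log₄ k)/(log₃ k)²`. -/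
theorem statement14 (l : ℕ) (hl : 1 ≤ l) :
    ∃ c : ℝ, 0 < c ∧
      {k : ℕ | l ≤ k ∧ Nat.gcd k l = 1 ∧
        c * ((k : ℝ) * (Real.log k * log2 k * log4 k) / (log3 k) ^ 2) ≤
          (leastPrimeAP k l : ℝ)}.Infinite := by
  refine ⟨(2 ^ (l + 20))⁻¹, by positivity, Set.infinite_of_forall_exists_gt fun N => ?_⟩
  obtain ⟨s, hs⟩ : ∃ s, s = N + l + 16 := ⟨_, rfl⟩
  obtain ⟨T, hT⟩ : ∃ T, T = 2 ^ s := ⟨_, rfl⟩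
  obtain ⟨R, hR⟩ : ∃ R, R = 2 ^ T := ⟨_, rfl⟩
  have hTs : 16 * s ≤ T := hT ▸ mul_le_two_pow (by norm_num) (by omega)
  have hRT : 512 * T ≤ R := hR ▸ mul_le_two_pow (by norm_num) (by omega)
  obtain ⟨E, hE⟩ : ∃ E, E + 2 * s + (l + 15) = R + T := ⟨R + T - 2 * s - (l + 15), by omega⟩
  obtain ⟨M, hM⟩ : ∃ M, M + 2 * T = R := ⟨R - 2 * T, by omega⟩
  obtain ⟨a, ha⟩ := exists_covering_residues hl (by omega) hT hR hE
  obtain ⟨k, hkl, hk1, hk2, hk⟩ := exists_modulus_of_covering hl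
    (fun p hp => (Finset.mem_filter.1 hp).2) ha
  set P := (Finset.Icc 1 (2 ^ R)).filter (fun p => p.Prime ∧ ¬ p ∣ l) with hP
  have hQ1 : ∏ p ∈ P, p ≤ 4 ^ (2 ^ R) := by
    refine le_trans ?_ (primorial_le_four_pow _)
    unfold primorial
    apply Finset.prod_le_prod_of_subset_of_one_le'
    · intro p hp
      obtain ⟨h1, h2, -⟩ := Finset.mem_filter.1 hp
      exact Finset.mem_filter.2 ⟨Finset.mem_range.2 (by
        have := (Finset.mem_Icc.1 h1).2; omega), h2⟩
    · intro p hp _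
      exact (Finset.mem_filter.1 hp).2.one_le
  have hQ2 : 2 ^ ((Finset.Ioc (2 ^ M) (2 ^ R)).filter Nat.Prime).card ≤ ∏ p ∈ P, p := by
    refine (Finset.pow_card_le_prod _ _ _ fun p hp => (Finset.mem_filter.1 hp).2.two_le).trans
      (Finset.prod_le_prod_of_subset_of_one_le' ?_ ?_)
    · intro p hp
      obtain ⟨h1, h2⟩ := Finset.mem_filter.1 hp
      obtain ⟨h3, h4⟩ := Finset.mem_Ioc.1 h1
      have h5 : M < 2 ^ M := Nat.lt_two_pow_self
      refine Finset.mem_filter.2 ⟨Finset.mem_Icc.2 ⟨h2.one_le, h4⟩, h2, fun h => ?_⟩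
      have := Nat.le_of_dvd hl h
      omega
    · intro p hp _
      exact (Finset.mem_filter.1 hp).2.1.one_le
  set Q := ∏ p ∈ P, p with hQ
  have hQ0 : 0 < Q := lt_of_lt_of_le (by positivity) hQ2
  have hQ0' : (0 : ℝ) < Q := by exact_mod_cast hQ0
  have hQk : Q ≤ k := (Nat.le_mul_of_pos_left Q hl).trans hk1
  have hlk : l ≤ k := (Nat.le_mul_of_pos_right l hQ0).trans hk1
  have hQk' : (Q : ℝ) ≤ k := by exact_mod_cast hQk
  have hk0 : (0 : ℝ) < k := by linarith
  have hlow : (2 : ℝ) ^ (R - T - 2) ≤ Real.log k := by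
    have h1 := le_card_primes_Ioc_of_tower hR hM (by omega)
    have h2 : ((2 : ℝ) ^ ((Finset.Ioc (2 ^ M) (2 ^ R)).filter Nat.Prime).card) ≤ k := by
      exact_mod_cast hQ2.trans hQk
    have h3 := Real.log_le_log (by positivity) h2
    rw [Real.log_pow] at h3
    have h4 : (2 : ℝ) ^ (R - T - 2) = 2 ^ R / R / 4 := by
      rw [show (R : ℝ) = 2 ^ T by rw [hR]; push_cast; rfl, div_div, eq_div_iff (by positivity)]
      calc (2 : ℝ) ^ (R - T - 2) * (2 ^ T * 4) = 2 ^ (R - T - 2 + T + 2) := by ring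
        _ = 2 ^ R := by congr 1; omega
    rw [h4]
    have h5 : (0 : ℝ) ≤ 2 ^ R / R := by positivity
    nlinarith [Real.log_two_gt_d9]
  have hup : Real.log k ≤ 2 ^ (R + 1) := by
    have h1 : (k : ℝ) ≤ 2 * l * 4 ^ (2 ^ R) := by
      have : k ≤ 2 * (l * 4 ^ (2 ^ R)) := hk2.trans (by gcongr)
      rw [mul_assoc]
      exact_mod_cast this
    have hl0 : (0 : ℝ) < l := by exact_mod_cast hl
    have h2 := Real.log_le_log hk0 h1
    rw [Real.log_mul (by positivity) (by positivity), Real.log_pow,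
      show (4 : ℝ) = 2 ^ 2 by norm_num, Real.log_pow] at h2
    have h3 : Real.log (2 * l) ≤ 2 * l := Real.log_le_self (by positivity)
    have h4 : 512 * R ≤ 2 ^ R := mul_le_two_pow le_rfl (by omega)
    have h5 : (256 * l : ℝ) ≤ 2 ^ R := by exact_mod_cast (by omega : 256 * l ≤ 2 ^ R)
    push_cast at h2
    rw [pow_succ]
    nlinarith [Real.log_two_lt_d9]
  have hNk : N < k := by
    have h1 : R - T - 2 < 2 ^ (R - T - 2) := Nat.lt_two_pow_self
    have h2 : ((R - T - 2 : ℕ) : ℝ) < 2 ^ (R - T - 2) := by exact_mod_cast h1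
    have h3 : Real.log k ≤ k := Real.log_le_self hk0.le
    have h4 : ((R - T - 2 : ℕ) : ℝ) < k := by linarith
    have h5 : R - T - 2 < k := by exact_mod_cast h4
    omega
  refine ⟨k, ⟨hlk, hkl, ?_⟩, hNk⟩
  have hmain := iterated_log_quotient_le (by omega) hT hR hlow hup
  have hleast : (k : ℝ) * (s * 2 ^ E : ℕ) ≤ leastPrimeAP k l := by
    exact_mod_cast mul_le_leastPrimeAP (by omega) hkl hk
  have hT0 : (0 : ℝ) < T := by exact_mod_cast (by omega : 0 < T)
  have hpow : (2 : ℝ) ^ R * R = 2 ^ E * T ^ 2 * 2 ^ (l + 15) := by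
    rw [show (R : ℝ) = 2 ^ T by rw [hR]; push_cast; rfl,
      show (T : ℝ) = 2 ^ s by rw [hT]; push_cast; rfl, ← pow_add, ← hE]
    ring
  calc _ = (2 ^ (l + 20))⁻¹ * k * (Real.log k * log2 k * log4 k / log3 k ^ 2) := by ring
    _ ≤ (2 ^ (l + 20))⁻¹ * k * (32 * (2 ^ R * R * s) / T ^ 2) := by gcongr
    _ = (k : ℝ) * (s * 2 ^ E : ℕ) := by
        rw [hpow]
        push_cast
        field_simp
        ring
    _ ≤ _ := hleast
end
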